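/- arXiv:2101.00748 — 4 statements merged into one kernel-verified Lean document; each statement's English description precedes it below -/
import Mathlib

section
/- Let γ = -1 if d = 2 and γ = -(d-2)/2 if d ≥ 3. Suppose n ≥ 6 and that 12q^γ + 8q^{d+2}/|E|² + (24 + 12⌊n/2⌋)q^{(d+1)/2}/|E| ≤ 1. Then |C_n^prod(E) - |E|^n/q^n| ≤ (|E|^n/q^n)·(12q^γ + 8q^{d+1}/|E|² + (24 + 12⌊n/2⌋)q^{(d+1)/2}/|E|). -/
open Finset
open scoped Classical

/-- The number of cycles of length `n` in the dot-product graph of `E`: tuples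
`(x₀,…,x_{n-1}) ∈ Eⁿ` with `x_i · x_{i+1} = t` cyclically, where
`x·y = x₁y₁ + ⋯ + x_dy_d`. -/
noncomputable def cycleCountProd (F : Type) [Field F] [Fintype F] [DecidableEq F]
    (d n : ℕ) (t : F) (E : Finset (Fin d → F)) : ℕ :=
  (Finset.univ.filter (fun x : Fin n → (Fin d → F) =>
    (∀ i, x i ∈ E) ∧
    ∀ i : Fin n, ∑ j, x i j * x ⟨(i.val + 1) % n, Nat.mod_lt _ i.pos⟩ j = t)).card


namespace CycProd
open scoped Matrix.Norms.L2Operator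

section Walk
variable {V : Type*} [Fintype V] [DecidableEq V]

lemma walk_sum (A : Matrix V V ℝ) (m : ℕ) : ∀ h : V → V → ℝ,
    ∑ x : Fin (m+1) → V, (∏ i : Fin m, A (x i.castSucc) (x i.succ)) * h (x 0) (x (Fin.last m))
      = ∑ a, ∑ b, (A ^ m) a b * h a b := by
  induction m with
  | zero =>
    intro h
    rw [← (Equiv.funUnique (Fin 1) V).symm.sum_comp]
    simp [Matrix.one_apply]
  | succ m ih =>
    intro h
    rw [← (Fin.consEquiv (fun _ : Fin (m+2) => V)).sum_comp, Fintype.sum_prod_type, Finset.sum_comm]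
    have := ih (fun c b => ∑ a, A a c * h a b)
    calc _ = ∑ x : Fin (m+1) → V, (∏ i : Fin m, A (x i.castSucc) (x i.succ)) *
              ∑ a, A a (x 0) * h a (x (Fin.last m)) := by
          refine Finset.sum_congr rfl fun x _ => ?_
          rw [Finset.mul_sum]
          refine Finset.sum_congr rfl fun a _ => ?_
          have hl : (Fin.last (m+1)) = (Fin.last m).succ := rfl
          simp only [Fin.consEquiv, Equiv.coe_fn_mk, Fin.prod_univ_succ, Fin.castSucc_zero, hl, Fin.cons_zero, Fin.cons_succ]
          simp only [← Fin.succ_castSucc, Fin.cons_succ]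
          ring
      _ = _ := by
          rw [this]
          simp only [pow_succ', Matrix.mul_apply, Finset.sum_mul, Finset.mul_sum]
          have e1 : ∀ a : V, ∑ b, ∑ c, A a c * (A^m) c b * h a b = ∑ c, ∑ b, A a c * (A^m) c b * h a b :=
            fun a => Finset.sum_comm
          simp only [e1]
          rw [Finset.sum_comm (f := fun a c => ∑ b, A a c * (A^m) c b * h a b)]
          refine Finset.sum_congr rfl fun c _ => ?_
          rw [Finset.sum_comm]
          refine Finset.sum_congr rfl fun a _ => Finset.sum_congr rfl fun b _ => by ring

lemma walk_trace (A : Matrix V V ℝ) (m : ℕ) :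
    ∑ x : Fin (m+1) → V, (∏ i : Fin m, A (x i.castSucc) (x i.succ)) * A (x (Fin.last m)) (x 0)
      = (A ^ (m+1)).trace := by
  rw [walk_sum A m (fun a b => A b a), pow_succ]
  simp [Matrix.trace, Matrix.mul_apply]

end Walk

section Norm
variable {V : Type*} [Fintype V] [DecidableEq V]

lemma bilin_le (B : Matrix V V ℝ) (u w : V → ℝ) :
    |u ⬝ᵥ (B.mulVec w)| ≤ ‖WithLp.toLp 2 u‖ * (‖B‖ * ‖WithLp.toLp 2 w‖) := by
  have h1 : u ⬝ᵥ (B.mulVec w) = inner ℝ (WithLp.toLp 2 u) (WithLp.toLp 2 (B.mulVec w)) := by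
    simp [PiLp.inner_apply, dotProduct, mul_comm]
  rw [h1]
  refine (abs_real_inner_le_norm _ _).trans ?_
  gcongr
  exact Matrix.l2_opNorm_mulVec B (WithLp.toLp 2 w)

lemma opNorm_le (B : Matrix V V ℝ) (c : ℝ) (hc : 0 ≤ c)
    (h : ∀ v : V → ℝ, ∑ y, (∑ x, B y x * v x)^2 ≤ c^2 * ∑ x, v x^2) : ‖B‖ ≤ c := by
  rw [Matrix.l2_opNorm_def]
  refine ContinuousLinearMap.opNorm_le_bound _ hc fun v => ?_
  rw [← abs_of_nonneg (norm_nonneg _), ← abs_of_nonneg (mul_nonneg hc (norm_nonneg v)), ← sq_le_sq,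
    mul_pow, EuclideanSpace.real_norm_sq_eq, EuclideanSpace.real_norm_sq_eq]
  have := h v.ofLp
  simpa [Matrix.mulVec, dotProduct] using this

lemma telescope {S : Type*} [Ring S] (A R : S) (n : ℕ) :
    A^n - R^n = ∑ k ∈ range n, A^k * (A-R) * R^(n-1-k) := by
  induction n with
  | zero => simp
  | succ n ih =>
    rw [Finset.sum_range_succ]
    have : ∑ k ∈ range n, A^k * (A-R) * R^(n+1-1-k) = (A^n-R^n)*R := by
      rw [ih, Finset.sum_mul]
      refine Finset.sum_congr rfl fun k hk => ?_
      have := Finset.mem_range.1 hk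
      rw [mul_assoc _ _ R, ← pow_succ]
      congr 2; omega
    rw [this, pow_succ, pow_succ]
    simp; noncomm_ring

/-- trace of power of almost rank-one matrix -/
lemma trace_bound (R A : Matrix V V ℝ) (u : V → ℝ) (c s l : ℝ) (hc : 0 ≤ c)
    (hs : u ⬝ᵥ u = s) (hA : A = c • Matrix.vecMulVec u u + R) (hR : ‖R‖ ≤ l) (n : ℕ) (hn : 1 ≤ n) :
    |(A^n).trace - (R^n).trace - (c*s)^n| ≤ (c*s+l)^n - l^n - (c*s)^n := by
  have hl : 0 ≤ l := (norm_nonneg _).trans hR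
  have hu : ‖WithLp.toLp 2 u‖ ^2 = s := by
    rw [EuclideanSpace.real_norm_sq_eq, ← hs]; simp [dotProduct, sq]
  have hs0 : 0 ≤ s := by rw [← hu]; positivity
  set μ := c*s with hμ
  have hμ0 : 0 ≤ μ := mul_nonneg hc hs0
  have hvv : ∀ w, (Matrix.vecMulVec u u).mulVec w = (u ⬝ᵥ w) • u := by
    intro w; ext i; simp [Matrix.mulVec, dotProduct, Matrix.vecMulVec_apply, Finset.mul_sum, Finset.sum_mul]
    refine Finset.sum_congr rfl fun a _ => by ring
  have hAn : ‖A‖ ≤ μ + l := by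
    rw [hA]
    refine (norm_add_le _ _).trans (add_le_add ?_ hR)
    rw [norm_smul, Real.norm_eq_abs, abs_of_nonneg hc, hμ]
    gcongr
    rw [Matrix.l2_opNorm_def]
    refine ContinuousLinearMap.opNorm_le_bound _ hs0 fun v => ?_
    have : (Matrix.toEuclideanLin (𝕜 := ℝ) (Matrix.vecMulVec u u)) v = (u ⬝ᵥ v.ofLp) • WithLp.toLp 2 u := by
      have := hvv v.ofLp
      ext i
      simpa using congrFun this i
    have h2 : ‖(Matrix.toEuclideanLin (𝕜 := ℝ) (Matrix.vecMulVec u u)) v‖ ≤ s * ‖v‖ := by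
      rw [this, norm_smul, Real.norm_eq_abs]
      have h3 : u ⬝ᵥ v.ofLp = inner ℝ (WithLp.toLp 2 u) v := by
        simp [PiLp.inner_apply, dotProduct, mul_comm]
      rw [h3]
      have := abs_real_inner_le_norm (WithLp.toLp 2 u) v
      rw [← hu]
      nlinarith [norm_nonneg (WithLp.toLp 2 u)]
    simpa using h2
  have hone : ‖(1 : Matrix V V ℝ)‖ ≤ 1 := (opNorm_le _ 1 zero_le_one (by intro v; simp [Matrix.one_apply]))
  have hpow : ∀ (B : Matrix V V ℝ) (b : ℝ), ‖B‖ ≤ b → ∀ k, ‖B^k‖ ≤ b^k := by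
    intro B b hb k
    have hb0 : 0 ≤ b := (norm_nonneg _).trans hb
    induction k with
    | zero => simpa using hone
    | succ k ih =>
      rw [pow_succ, pow_succ]
      exact (norm_mul_le _ _).trans (mul_le_mul ih hb (norm_nonneg _) (by positivity))
  -- iterates
  have hit : ∀ m, ‖WithLp.toLp 2 ((A^m).mulVec u - μ^m • u)‖ ≤ ((μ+l)^m - μ^m) * ‖WithLp.toLp 2 u‖ := by
    intro m
    induction m with
    | zero => simp
    | succ m ih =>
      have e : (A^(m+1)).mulVec u - μ^(m+1) • u = A.mulVec ((A^m).mulVec u - μ^m • u) + μ^m • R.mulVec u := by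
        have e2 : A.mulVec u = μ • u + R.mulVec u := by
          rw [hA, Matrix.add_mulVec, Matrix.smul_mulVec, hvv, hs, smul_smul]
        rw [pow_succ', ← Matrix.mulVec_mulVec, Matrix.mulVec_sub, Matrix.mulVec_smul, e2, smul_add, smul_smul,
          ← pow_succ]
        abel
      rw [e, WithLp.toLp_add]
      refine (norm_add_le _ _).trans ?_
      have b1 := Matrix.l2_opNorm_mulVec A (WithLp.toLp 2 ((A^m).mulVec u - μ^m • u))
      have b2 := Matrix.l2_opNorm_mulVec R (WithLp.toLp 2 u)
      rw [WithLp.toLp_smul, norm_smul, Real.norm_eq_abs, abs_of_nonneg (pow_nonneg hμ0 m)]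
      have b1' := b1.trans (mul_le_mul hAn ih (norm_nonneg _) (by positivity))
      have b2' := b2.trans (mul_le_mul_of_nonneg_right hR (norm_nonneg _))
      have b3 := mul_le_mul_of_nonneg_left b2' (pow_nonneg hμ0 m)
      refine (add_le_add b1' b3).trans (le_of_eq ?_)
      simp
      ring
  set T : ℕ → ℝ := fun k => c * (u ⬝ᵥ (R^(n-1-k) * A^k).mulVec u) with hT
  have htr : (A^n).trace - (R^n).trace = ∑ k ∈ range n, T k := by
    rw [← Matrix.trace_sub, telescope, Matrix.trace_sum]
    refine Finset.sum_congr rfl fun k _ => ?_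
    have : A - R = c • Matrix.vecMulVec u u := by rw [hA]; abel
    rw [Matrix.trace_mul_comm, ← mul_assoc, this, Matrix.mul_smul, Matrix.trace_smul, Matrix.mul_vecMulVec, Matrix.trace_vecMulVec, hT, smul_eq_mul, dotProduct_comm]
  obtain ⟨m, rfl⟩ : ∃ m, n = m+1 := ⟨n-1, by omega⟩
  have hTk : ∀ k, |T k| ≤ μ * (l^(m-k) * (μ+l)^k) := by
    intro k
    simp only [hT, abs_mul, abs_of_nonneg hc]
    have h1 := bilin_le (R^(m-k) * A^k) u u
    have h2 : ‖R^(m-k) * A^k‖ ≤ l^(m-k) * (μ+l)^k :=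
      (norm_mul_le _ _).trans (mul_le_mul (hpow R l hR _) (hpow A _ hAn _) (norm_nonneg _) (by positivity))
    have h3 : ‖WithLp.toLp 2 u‖ * (‖R^(m-k) * A^k‖ * ‖WithLp.toLp 2 u‖) ≤ s * (l^(m-k) * (μ+l)^k) := by
      rw [← hu]
      nlinarith [sq_nonneg ‖WithLp.toLp 2 u‖]
    have := mul_le_mul_of_nonneg_left (h1.trans h3) hc
    rw [hμ, mul_assoc]
    simpa using this
  have hTm : |T m - μ^(m+1)| ≤ μ * (μ+l)^m - μ^(m+1) := by
    have e : T m - μ^(m+1) = c * inner ℝ (WithLp.toLp 2 u) (WithLp.toLp 2 ((A^m).mulVec u - μ^m • u)) := by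
      have : inner ℝ (WithLp.toLp 2 u) (WithLp.toLp 2 ((A^m).mulVec u - μ^m • u))
          = u ⬝ᵥ ((A^m).mulVec u - μ^m • u) := by
        simp [PiLp.inner_apply, dotProduct, mul_comm]
      rw [this, dotProduct_sub, dotProduct_smul, hs, hT]
      simp
      rw [hμ]; ring
    rw [e, abs_mul, abs_of_nonneg hc]
    have h1 := (abs_real_inner_le_norm (WithLp.toLp 2 u) (WithLp.toLp 2 ((A^m).mulVec u - μ^m • u))).trans
      (mul_le_mul_of_nonneg_left (hit m) (norm_nonneg _))
    refine (mul_le_mul_of_nonneg_left h1 hc).trans (le_of_eq ?_)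
    rw [pow_succ, hμ, ← hu]; ring
  have hg := geom_sum₂_mul (μ+l) l (m+1)
  rw [Finset.sum_range_succ] at hg
  rw [htr, Finset.sum_range_succ, add_sub_assoc]
  refine (abs_add_le _ _).trans ?_
  have h4 : |∑ k ∈ range m, T k| ≤ μ * ∑ k ∈ range m, (μ+l)^k * l^(m-k) := by
    rw [Finset.mul_sum]
    refine (Finset.abs_sum_le_sum_abs _ _).trans (Finset.sum_le_sum fun k _ => (hTk k).trans (le_of_eq (by ring)))
  simp only [Nat.add_sub_cancel, Nat.sub_self, pow_zero, mul_one, add_sub_cancel_right] at hg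
  linarith

lemma trace_pow_bound (R : Matrix V V ℝ) (hs : R.transpose = R) (l : ℝ) (hR : ‖R‖ ≤ l) (k : ℕ) :
    |(R^(k+2)).trace| ≤ l^k * ∑ x, ∑ y, R x y^2 := by
  have e : (R^(k+2)).trace = ∑ x, (R x) ⬝ᵥ (R^k).mulVec (R x) := by
    rw [pow_succ, pow_succ', Matrix.trace]
    refine Finset.sum_congr rfl fun x _ => ?_
    rw [Matrix.diag_apply, mul_assoc, Matrix.mul_apply_eq_vecMul, Matrix.vecMul_eq_sum]
    have hsx : ∀ a b, R a b = R b a := fun a b => by conv_lhs => rw [← hs, Matrix.transpose_apply]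
    simp only [dotProduct, Matrix.mulVec, Finset.sum_apply, Matrix.smul_apply, smul_eq_mul, Pi.smul_apply, Matrix.mul_apply]
    refine Finset.sum_congr rfl fun y _ => ?_
    congr 1
    exact Finset.sum_congr rfl fun z _ => by rw [hsx x z]
  have hl : 0 ≤ l := (norm_nonneg _).trans hR
  have hone : ‖(1 : Matrix V V ℝ)‖ ≤ 1 := (opNorm_le _ 1 zero_le_one (by intro v; simp [Matrix.one_apply]))
  have hpow : ∀ k, ‖R^k‖ ≤ l^k := by
    intro k
    induction k with
    | zero => simpa using hone
    | succ k ih =>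
      rw [pow_succ, pow_succ]
      exact (norm_mul_le _ _).trans (mul_le_mul ih hR (norm_nonneg _) (by positivity))
  have hpow := hpow k
  rw [e, Finset.mul_sum]
  refine (Finset.abs_sum_le_sum_abs _ _).trans (Finset.sum_le_sum fun x _ => ?_)
  refine (bilin_le _ _ _).trans ?_
  have : ∑ y, R x y^2 = ‖WithLp.toLp 2 (R x)‖^2 := by rw [EuclideanSpace.real_norm_sq_eq]
  rw [this]
  nlinarith [sq_nonneg ‖WithLp.toLp 2 (R x)‖]

end Norm
end CycProd

namespace CycProd
section FieldPart
variable {F : Type} [Field F] [Fintype F] {d : ℕ}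

noncomputable def rr (t : F) (x y : Fin d → F) : ℝ :=
  (if x ⬝ᵥ y = t then 1 else 0) - 1 / (Fintype.card F : ℝ)

lemma rr_symm (t : F) (x y : Fin d → F) : rr t x y = rr t y x := by
  unfold rr; rw [dotProduct_comm]

lemma qpos : (0:ℝ) < Fintype.card F := by exact_mod_cast Fintype.card_pos

lemma avg (t : F) (z y0 : Fin d → F) (h : z ⬝ᵥ y0 = 1) (g : (Fin d → F) → ℝ)
    (hg : ∀ y (s : F), g (y + s • y0) = g y) : ∑ y, g y * rr t z y = 0 := by
  have hq := qpos (F := F)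
  have h1 : ∀ s : F, ∑ y, g y * rr t z (y + s • y0) = ∑ y, g y * rr t z y := by
    intro s
    rw [← Equiv.sum_comp (Equiv.addRight (s • y0)) (fun y => g y * rr t z y)]
    simp [hg]
  have h2 : ∑ s : F, ∑ y, g y * rr t z (y + s • y0) = 0 := by
    rw [Finset.sum_comm]
    refine Finset.sum_eq_zero fun y _ => ?_
    rw [← Finset.mul_sum]
    have : ∑ s : F, rr t z (y + s • y0) = 0 := by
      unfold rr
      have e : ∀ s : F, (z ⬝ᵥ (y + s • y0) = t) ↔ s = t - z ⬝ᵥ y := by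
        intro s; rw [dotProduct_add, dotProduct_smul, h, smul_eq_mul, mul_one, eq_sub_iff_add_eq']
      simp only [e, Finset.sum_sub_distrib]
      simp [hq.ne']
    rw [this, mul_zero]
  simp only [h1, Finset.sum_const, Finset.card_univ, nsmul_eq_mul] at h2
  exact (mul_eq_zero.1 h2).resolve_left hq.ne'

lemma sum_rr (t : F) (z : Fin d → F) (hz : z ≠ 0) : ∑ y, rr t z y = 0 := by
  obtain ⟨i, hi⟩ := Function.ne_iff.1 hz
  have := avg t z (Pi.single i (z i)⁻¹) (by simpa using mul_inv_cancel₀ hi) (fun _ => 1) (fun _ _ => rfl)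
  simpa using this

noncomputable def KK (t : F) (x z : Fin d → F) : ℝ := ∑ y, rr t x y * rr t z y

lemma KK_symm (t : F) (x z : Fin d → F) : KK t x z = KK t z x := by
  unfold KK; exact Finset.sum_congr rfl fun _ _ => mul_comm _ _

lemma KK_zero (t : F) (x z y0 : Fin d → F) (hx : x ⬝ᵥ y0 = 0) (hz : z ⬝ᵥ y0 ≠ 0) : KK t x z = 0 := by
  refine avg t z ((z ⬝ᵥ y0)⁻¹ • y0) ?_ _ ?_
  · simp [hz]
  · intro y s
    simp [rr, hx]

lemma KK_indep (t : F) (x z : Fin d → F) (hx : x ≠ 0) (h : ∀ c : F, z ≠ c • x) : KK t x z = 0 := by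
  obtain ⟨i, hi⟩ := Function.ne_iff.1 hx
  simp only [Pi.zero_apply] at hi
  by_contra hK
  refine h (z i / x i) ?_
  ext j
  by_contra hj
  refine hK (KK_zero t x z (Pi.single j (x i) - Pi.single i (x j)) ?_ ?_)
  · simp [dotProduct_sub]; ring
  · simp only [dotProduct_sub, dotProduct_single]
    intro h0
    apply hj
    simp
    field_simp
    linear_combination h0

lemma KK_zero_right (t : F) (x : Fin d → F) (hx : x ≠ 0) : KK t x 0 = 0 := by
  obtain ⟨i, hi⟩ := Function.ne_iff.1 hx
  rw [KK_symm]
  exact KK_zero t 0 x (Pi.single i 1) (by simp) (by simpa using hi)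

lemma sum_ind (t : F) (z : Fin d → F) (hz : z ≠ 0) :
    ∑ y : Fin d → F, (if z ⬝ᵥ y = t then (1:ℝ) else 0) = (Fintype.card F : ℝ)^d / Fintype.card F := by
  have := sum_rr t z hz
  unfold rr at this
  rw [Finset.sum_sub_distrib, sub_eq_zero] at this
  rw [this]; simp [div_eq_mul_inv]

lemma KK_mul (t : F) (ht : t ≠ 0) (x : Fin d → F) (hx : x ≠ 0) (c : F) :
    |KK t x (c • x)| ≤ (Fintype.card F : ℝ)^d / (Fintype.card F)^2 +
      if c = 1 then (Fintype.card F : ℝ)^d / (Fintype.card F) else 0 := by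
  have hq := qpos (F := F)
  by_cases hc : c = 0
  · subst hc
    rw [zero_smul, KK_zero_right t x hx, abs_zero]
    split_ifs <;> positivity
  have hcx : c • x ≠ 0 := smul_ne_zero hc hx
  have e : KK t x (c • x) = ∑ y, (if x ⬝ᵥ y = t then (1:ℝ) else 0) * (if (c • x) ⬝ᵥ y = t then (1:ℝ) else 0)
      - (Fintype.card F : ℝ)^d / (Fintype.card F)^2 := by
    have h0 := sum_rr t (c • x) hcx
    have h1 := sum_ind t x hx
    have : ∀ y, rr t x y * rr t (c • x) y =
      (if x ⬝ᵥ y = t then (1:ℝ) else 0) * (if (c • x) ⬝ᵥ y = t then (1:ℝ) else 0)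
       - (if x ⬝ᵥ y = t then (1:ℝ) else 0) * (1/(Fintype.card F : ℝ)) - (1/(Fintype.card F : ℝ)) * rr t (c • x) y := by
      intro y; unfold rr; ring
    unfold KK
    simp only [this]
    rw [Finset.sum_sub_distrib, Finset.sum_sub_distrib, ← Finset.mul_sum, h0, ← Finset.sum_mul, h1]
    field_simp; ring
  rw [e]
  split_ifs with h
  · subst h
    have : ∑ y, (if x ⬝ᵥ y = t then (1:ℝ) else 0) * (if ((1:F) • x) ⬝ᵥ y = t then (1:ℝ) else 0)
        = (Fintype.card F : ℝ)^d / Fintype.card F := by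
      rw [← sum_ind t x hx]; refine Finset.sum_congr rfl fun y _ => ?_
      rw [one_smul]; split_ifs <;> simp
    rw [this, add_comm]
    refine (abs_sub _ _).trans (le_of_eq ?_)
    rw [abs_of_nonneg (by positivity), abs_of_nonneg (by positivity)]
  · have : ∑ y, (if x ⬝ᵥ y = t then (1:ℝ) else 0) * (if (c • x) ⬝ᵥ y = t then (1:ℝ) else 0) = 0 := by
      refine Finset.sum_eq_zero fun y _ => ?_
      by_cases h1 : x ⬝ᵥ y = t
      · have : ¬ (c • x) ⬝ᵥ y = t := by
          rw [smul_dotProduct, h1, smul_eq_mul]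
          intro h2
          exact h (mul_right_cancel₀ ht (by rw [h2, one_mul]))
        rw [if_neg this, mul_zero]
      · rw [if_neg h1, zero_mul]
    rw [this, zero_sub, abs_neg, add_zero, abs_of_nonneg (by positivity)]

lemma row_sum (t : F) (ht : t ≠ 0) (x : Fin d → F) :
    ∑ z, |KK t x z| ≤ 2 * (Fintype.card F : ℝ)^d / (Fintype.card F) := by
  have hq := qpos (F := F)
  have hq1 : (1:ℝ) ≤ Fintype.card F := by exact_mod_cast Fintype.card_pos (α := F)
  by_cases hx : x = 0
  · subst hx
    rw [Finset.sum_eq_single 0]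
    · unfold KK rr
      simp only [zero_dotProduct, ht.symm, if_false]
      simp
      rw [div_eq_mul_inv, mul_comm 2, mul_assoc]
      gcongr
      have : (Fintype.card F : ℝ)⁻¹ ≤ 1 := inv_le_one_of_one_le₀ hq1
      nlinarith [inv_pos.2 hq]
    · intro z _ hz; rw [KK_symm, KK_zero_right t z hz, abs_zero]
    · simp
  · have hinj : Function.Injective (fun c : F => c • x) := smul_left_injective F hx
    have : ∑ z, |KK t x z| = ∑ z ∈ (Finset.univ : Finset F).image (fun c : F => c • x), |KK t x z| := by
      symm
      refine Finset.sum_subset (Finset.subset_univ _) fun z _ hz => ?_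
      rw [KK_indep t x z hx, abs_zero]
      rintro c rfl
      exact hz (Finset.mem_image_of_mem _ (Finset.mem_univ c))
    rw [this, Finset.sum_image (fun a _ b _ h => hinj h)]
    refine (Finset.sum_le_sum fun c _ => KK_mul t ht x hx c).trans (le_of_eq ?_)
    rw [Finset.sum_add_distrib]
    simp
    field_simp; ring

lemma schur (t : F) (ht : t ≠ 0) (v : (Fin d → F) → ℝ) :
    ∑ y, (∑ x, rr t y x * v x)^2 ≤ 2 * (Fintype.card F : ℝ)^d / (Fintype.card F) * ∑ x, v x^2 := by
  have e : ∑ y, (∑ x, rr t y x * v x)^2 = ∑ x, ∑ z, KK t x z * (v x * v z) := by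
    simp only [sq, Finset.sum_mul_sum]
    simp only [KK, Finset.sum_mul]
    rw [Finset.sum_comm]
    refine Finset.sum_congr rfl fun x _ => ?_
    rw [Finset.sum_comm]
    refine Finset.sum_congr rfl fun z _ => Finset.sum_congr rfl fun y _ => ?_
    rw [rr_symm t y x, rr_symm t y z]; ring
  rw [e]
  calc _ ≤ ∑ x, ∑ z, (|KK t x z| * v x^2 / 2 + |KK t z x| * v z^2 / 2) := by
        refine Finset.sum_le_sum fun x _ => Finset.sum_le_sum fun z _ => ?_
        rw [KK_symm t z x]
        have h1 := le_abs_self (KK t x z * (v x * v z))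
        rw [abs_mul] at h1
        have h2 : |v x * v z| ≤ v x^2/2 + v z^2/2 := by
          rw [abs_le]; constructor <;> nlinarith [sq_nonneg (v x + v z), sq_nonneg (v x - v z)]
        nlinarith [mul_le_mul_of_nonneg_left h2 (abs_nonneg (KK t x z))]
    _ = ∑ x, v x^2 * ∑ z, |KK t x z| := by
        simp only [Finset.sum_add_distrib]
        rw [Finset.sum_comm (f := fun x z => |KK t z x| * v z^2 / 2), ← Finset.sum_add_distrib]
        refine Finset.sum_congr rfl fun x _ => ?_
        rw [← Finset.sum_add_distrib, Finset.mul_sum]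
        refine Finset.sum_congr rfl fun z _ => by ring
    _ ≤ _ := by
        rw [Finset.mul_sum]
        refine Finset.sum_le_sum fun x _ => ?_
        rw [mul_comm]
        exact mul_le_mul_of_nonneg_right (row_sum t ht x) (sq_nonneg _)

end FieldPart
end CycProd

namespace CycProd
open scoped Matrix.Norms.L2Operator
section Final
variable {F : Type} [Field F] [Fintype F] [DecidableEq F] {d : ℕ}

noncomputable def uu (E : Finset (Fin d → F)) (x : Fin d → F) : ℝ := if x ∈ E then 1 else 0

noncomputable def AA (t : F) (E : Finset (Fin d → F)) : Matrix (Fin d → F) (Fin d → F) ℝ :=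
  fun x y => if x ∈ E ∧ y ∈ E ∧ x ⬝ᵥ y = t then 1 else 0

noncomputable def RR (t : F) (E : Finset (Fin d → F)) : Matrix (Fin d → F) (Fin d → F) ℝ :=
  fun x y => uu E x * (rr t x y * uu E y)

lemma AA_eq (t : F) (E : Finset (Fin d → F)) :
    AA t E = (1 / (Fintype.card F : ℝ)) • Matrix.vecMulVec (uu E) (uu E) + RR t E := by
  ext x y
  simp only [AA, RR, uu, rr, Matrix.add_apply, Matrix.smul_apply, Matrix.vecMulVec_apply, smul_eq_mul]
  by_cases hx : x ∈ E <;> by_cases hy : y ∈ E <;> by_cases h : x ⬝ᵥ y = t <;> simp [hx, hy, h]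

lemma uu_dot (E : Finset (Fin d → F)) : uu E ⬝ᵥ uu E = E.card := by
  simp [uu, dotProduct]

lemma RR_norm (t : F) (ht : t ≠ 0) (E : Finset (Fin d → F)) (l : ℝ) (hl : 0 ≤ l)
    (h : l^2 = 2 * (Fintype.card F : ℝ)^d / (Fintype.card F)) : ‖RR t E‖ ≤ l := by
  refine opNorm_le _ l hl fun v => ?_
  rw [h]
  have hq := qpos (F := F)
  have hu : ∀ x, uu E x^2 ≤ 1 := by intro x; unfold uu; split_ifs <;> simp
  calc _ ≤ ∑ y, (∑ x, rr t y x * (uu E x * v x))^2 := by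
        refine Finset.sum_le_sum fun y _ => ?_
        have : ∑ x, RR t E y x * v x = uu E y * ∑ x, rr t y x * (uu E x * v x) := by
          rw [Finset.mul_sum]; refine Finset.sum_congr rfl fun x _ => by simp only [RR]; ring
        rw [this, mul_pow]
        exact mul_le_of_le_one_left (sq_nonneg _) (hu y)
    _ ≤ _ := schur t ht _
    _ ≤ _ := by
        refine mul_le_mul_of_nonneg_left (Finset.sum_le_sum fun x _ => ?_) (by positivity)
        rw [mul_pow]
        exact mul_le_of_le_one_left (sq_nonneg _) (hu x)

lemma RR_sq (t : F) (ht : t ≠ 0) (E : Finset (Fin d → F)) (l : ℝ) (hl : 0 ≤ l)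
    (h : l^2 = 2 * (Fintype.card F : ℝ)^d / (Fintype.card F)) :
    ∑ x, ∑ y, RR t E x y^2 ≤ (E.card:ℝ)^2 / (Fintype.card F) + l * E.card
      + (E.card:ℝ)^2 / (Fintype.card F)^2 := by
  have hq := qpos (F := F)
  set q : ℝ := (Fintype.card F : ℝ) with hqdef
  have h1 : ∀ x y, RR t E x y^2 ≤ RR t E x y + uu E x * uu E y * (1/q + 1/q^2) := by
    intro x y
    simp only [RR, uu, rr, ← hqdef]
    have e : (1/q)^2 = 1/q^2 := by rw [div_pow, one_pow]
    have p : 0 < 1/q := by positivity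
    by_cases hx : x ∈ E <;> by_cases hy : y ∈ E <;> by_cases h : x ⬝ᵥ y = t <;>
      simp only [hx, hy, h, if_true, if_false] <;> nlinarith
  have hsum : ∑ x, ∑ y, uu E x * uu E y * (1/q + 1/q^2) = (E.card:ℝ)^2 * (1/q+1/q^2) := by
    simp only [← Finset.sum_mul, ← Finset.mul_sum]
    simp [uu, sq]
  have hR : ∑ x, ∑ y, RR t E x y ≤ l * E.card := by
    have e : ∑ x, ∑ y, RR t E x y = uu E ⬝ᵥ (RR t E).mulVec (uu E) := by
      simp only [dotProduct, Matrix.mulVec, Finset.mul_sum]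
      refine Finset.sum_congr rfl fun x _ => Finset.sum_congr rfl fun y _ => ?_
      simp only [RR, uu]; split_ifs <;> simp
    rw [e]
    refine (le_abs_self _).trans ((bilin_le _ _ _).trans ?_)
    have hu : ‖WithLp.toLp 2 (uu E)‖ ^2 = E.card := by
      rw [EuclideanSpace.real_norm_sq_eq, ← uu_dot]; simp [dotProduct, sq]
    rw [← hu]
    nlinarith [RR_norm t ht E l hl h, sq_nonneg ‖WithLp.toLp 2 (uu E)‖]
  calc _ ≤ ∑ x, ∑ y, (RR t E x y + uu E x * uu E y * (1/q + 1/q^2)) :=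
        Finset.sum_le_sum fun x _ => Finset.sum_le_sum fun y _ => h1 x y
    _ ≤ _ := by
        simp only [Finset.sum_add_distrib] at hsum ⊢
        rw [hsum]
        have : (E.card:ℝ)^2 * (1/q+1/q^2) = (E.card:ℝ)^2/q + (E.card:ℝ)^2/q^2 := by ring
        linarith

lemma RR_symm (t : F) (E : Finset (Fin d → F)) : (RR t E).transpose = RR t E := by
  ext x y; simp only [Matrix.transpose_apply, RR]; rw [rr_symm]; ring

lemma num_pow (e : ℝ) (he : 0 ≤ e) (n : ℕ) (hn : n * e ≤ 1) : (1+e)^n - 1 ≤ 2 * (n * e) := by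
  have h1 : (1+e)^n ≤ Real.exp (n*e) := by
    rw [Real.exp_nat_mul]
    gcongr
    linarith [Real.add_one_le_exp e]
  have h0 : 0 ≤ n * e := by positivity
  have h2 := Real.abs_exp_sub_one_le (x := n*e) (by rwa [abs_of_nonneg h0])
  rw [abs_of_nonneg h0] at h2
  linarith [le_abs_self (Real.exp (n*e) - 1)]

end Final
end CycProd

lemma CycProd.count_eq (F : Type) [Field F] [Fintype F] [DecidableEq F]
    (d m : ℕ) (t : F) (E : Finset (Fin d → F)) :
    (cycleCountProd F d (m+1) t E : ℝ) = ((CycProd.AA t E)^(m+1)).trace := by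
  rw [← CycProd.walk_trace, cycleCountProd, Finset.card_filter]
  push_cast
  refine Finset.sum_congr rfl fun x _ => ?_
  simp only [CycProd.AA]
  rw [Finset.prod_ite_zero, Finset.prod_const_one, ite_zero_mul_ite_zero, mul_one]
  have hs : ∀ i : Fin m, (⟨(i.castSucc.val + 1) % (m+1), Nat.mod_lt _ i.castSucc.pos⟩ : Fin (m+1)) = i.succ := by
    intro i; ext; simp [Nat.mod_eq_of_lt]
  have hl : (⟨((Fin.last m).val + 1) % (m+1), Nat.mod_lt _ (Fin.last m).pos⟩ : Fin (m+1)) = 0 := by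
    ext; simp
  have key : (∀ i : Fin (m+1), ∑ j, x i j * x ⟨(i.val + 1) % (m+1), Nat.mod_lt _ i.pos⟩ j = t) ↔
      (∀ i : Fin m, x i.castSucc ⬝ᵥ x i.succ = t) ∧ x (Fin.last m) ⬝ᵥ x 0 = t := by
    rw [Fin.forall_fin_succ']
    simp only [hs, hl]
    rfl
  have key2 : ((∀ i, x i ∈ E) ∧
      ∀ i : Fin (m+1), ∑ j, x i j * x ⟨(i.val + 1) % (m+1), Nat.mod_lt _ i.pos⟩ j = t) ↔
      ((∀ i ∈ (Finset.univ : Finset (Fin m)), x i.castSucc ∈ E ∧ x i.succ ∈ E ∧ x i.castSucc ⬝ᵥ x i.succ = t) ∧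
        x (Fin.last m) ∈ E ∧ x 0 ∈ E ∧ x (Fin.last m) ⬝ᵥ x 0 = t) := by
    rw [key]
    constructor
    · rintro ⟨h1, h2, h3⟩
      exact ⟨fun i _ => ⟨h1 _, h1 _, h2 i⟩, h1 _, h1 _, h3⟩
    · rintro ⟨h1, h2, h3, h4⟩
      refine ⟨?_, fun i => (h1 i (Finset.mem_univ _)).2.2, h4⟩
      rw [Fin.forall_fin_succ']
      exact ⟨fun i => (h1 i (Finset.mem_univ _)).1, h2⟩
  by_cases h : ((∀ i, x i ∈ E) ∧
      ∀ i : Fin (m+1), ∑ j, x i j * x ⟨(i.val + 1) % (m+1), Nat.mod_lt _ i.pos⟩ j = t)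
  · rw [if_pos h, if_pos (key2.1 h)]
  · rw [if_neg h, if_neg (fun h' => h (key2.2 h'))]

theorem cycle_count_prod_main (F : Type) [Field F] [Fintype F] [DecidableEq F]
    (d : ℕ) (hd : 2 ≤ d) (t : F) (ht : t ≠ 0)
    (E : Finset (Fin d → F)) (n : ℕ) (hn : 6 ≤ n)
    (q : ℝ) (hq : q = (Fintype.card F : ℝ))
    (γ : ℝ) (hγ : γ = if d = 2 then (-1 : ℝ) else -(((d : ℝ) - 2) / 2))
    (hsize : 12 * q ^ γ + 8 * q ^ ((d : ℝ) + 2) / (E.card : ℝ) ^ 2 +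
      (24 + 12 * ((n / 2 : ℕ) : ℝ)) * q ^ (((d : ℝ) + 1) / 2) / (E.card : ℝ) ≤ 1) :
    |(cycleCountProd F d n t E : ℝ) - (E.card : ℝ) ^ n / q ^ n| ≤
      (E.card : ℝ) ^ n / q ^ n *
        (12 * q ^ γ + 8 * q ^ ((d : ℝ) + 1) / (E.card : ℝ) ^ 2 +
          (24 + 12 * ((n / 2 : ℕ) : ℝ)) * q ^ (((d : ℝ) + 1) / 2) / (E.card : ℝ)) := by
  have hq0 : 0 < q := by rw [hq]; exact CycProd.qpos
  have hq1 : 1 ≤ q := by rw [hq]; exact_mod_cast Fintype.card_pos (α := F)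
  obtain ⟨m, rfl⟩ : ∃ m, n = m + 1 := ⟨n - 1, by omega⟩
  obtain ⟨k, rfl⟩ : ∃ k, m = k + 1 := ⟨m - 1, by omega⟩
  rw [CycProd.count_eq]
  rcases E.eq_empty_or_nonempty with rfl | hE
  · have : CycProd.AA t (∅ : Finset (Fin d → F)) = 0 := by ext x y; simp [CycProd.AA]
    rw [this]; simp
  have hE0 : (0:ℝ) < E.card := by exact_mod_cast hE.card_pos
  set μ : ℝ := E.card / q with hμ
  set δ : ℝ := q ^ (((d : ℝ) + 1) / 2) / (E.card : ℝ) with hδ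
  have hμ0 : 0 < μ := by positivity
  have hδ0 : 0 < δ := by positivity
  have hpw : (q ^ (((d : ℝ) + 1) / 2))^2 = q ^ (d+1) := by
    rw [← Real.rpow_natCast, ← Real.rpow_mul hq0.le, ← Real.rpow_natCast]
    congr 1; push_cast; ring
  have hδ2 : δ^2 = q^(d+1) / (E.card:ℝ)^2 := by rw [hδ, div_pow, hpw]
  have e1 : 8 * q ^ ((d : ℝ) + 1) / (E.card : ℝ) ^ 2 = 8 * δ^2 := by
    rw [hδ2, show (d:ℝ)+1 = ((d+1:ℕ):ℝ) by push_cast; ring, Real.rpow_natCast]; ring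
  have e2 : 8 * q ^ ((d : ℝ) + 2) / (E.card : ℝ) ^ 2 = 8 * (q * δ^2) := by
    rw [hδ2, show (d:ℝ)+2 = ((d+2:ℕ):ℝ) by push_cast; ring, Real.rpow_natCast]; ring
  rw [mul_div_assoc (24 + _), e2, ← hδ] at hsize
  rw [mul_div_assoc (24 + _), e1, ← div_pow, ← hδ, ← hμ]
  have hg0 : 0 ≤ 12 * q ^ γ := by positivity
  set N : ℝ := (((k+1+1) / 2 : ℕ) : ℝ) with hN
  have hN1 : ((k+1+1 : ℕ) : ℝ) ≤ 2 * N + 1 := by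
    rw [hN]; exact_mod_cast (by omega : k+1+1 ≤ 2 * ((k+1+1)/2) + 1)
  have hN0 : 0 ≤ N := Nat.cast_nonneg _
  set s2 := Real.sqrt 2 with hs2
  have hs2s : s2^2 = 2 := Real.sq_sqrt (by norm_num)
  have hs20 : 0 ≤ s2 := Real.sqrt_nonneg _
  have hs2l : s2 ≤ 3/2 := by nlinarith
  set ε := s2 * δ with hε
  have hε0 : 0 ≤ ε := by positivity
  set l := ε * μ with hl
  have hl0 : 0 ≤ l := by positivity
  have hll : l^2 = 2 * (Fintype.card F : ℝ)^d / (Fintype.card F) := by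
    rw [← hq, hl, hε, mul_pow, mul_pow, hs2s, hδ2, hμ]
    field_simp
    ring
  have hqδ : q * δ^2 ≤ 1/8 := by linarith [mul_nonneg (by linarith : 0 ≤ 24 + 12 * N) hδ0.le]
  have hNδ : (24 + 12 * N) * δ ≤ 1 := by linarith [mul_nonneg hq0.le (sq_nonneg δ)]
  have hδ1 : δ ≤ 1/24 := by linarith [mul_nonneg hN0 hδ0.le]
  have hε1 : ε ≤ 1/16 := by linarith [mul_le_mul_of_nonneg_right hs2l hδ0.le]
  have B1 := CycProd.trace_bound (CycProd.RR t E) (CycProd.AA t E) (CycProd.uu E) (1/q) E.card l (by positivity)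
    (CycProd.uu_dot E) (by rw [hq]; exact CycProd.AA_eq t E) (CycProd.RR_norm t ht E l hl0 hll) (k+1+1) (by omega)
  have B2 := CycProd.trace_pow_bound (CycProd.RR t E) (CycProd.RR_symm t E) l (CycProd.RR_norm t ht E l hl0 hll) k
  have B3 := CycProd.RR_sq t ht E l hl0 hll
  rw [← hq] at B3
  have hμ' : 1/q * (E.card:ℝ) = μ := by rw [hμ]; ring
  rw [hμ'] at B1
  clear_value l ε s2 N δ μ
  have B4 : (μ + l)^(k+1+1) - l^(k+1+1) - μ^(k+1+1) ≤ μ^(k+1+1) * ((24+12*N)*δ) := by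
    have h1 : (μ+l)^(k+1+1) = μ^(k+1+1) * (1+ε)^(k+1+1) := by rw [← mul_pow, hl]; ring
    have hnδ : ((k+1+1:ℕ):ℝ) * δ ≤ (2*N+1)*δ := by gcongr
    have hne : ((k+1+1:ℕ):ℝ) * ε ≤ 3/2 * (((k+1+1:ℕ):ℝ) * δ) := by
      have : ε ≤ 3/2 * δ := by rw [hε]; gcongr
      calc _ ≤ ((k+1+1:ℕ):ℝ) * (3/2 * δ) := by gcongr
        _ = _ := by ring
    have h2 := CycProd.num_pow ε hε0 (k+1+1) (by linarith)
    have h3 : (1+ε)^(k+1+1) - 1 ≤ (24+12*N)*δ := by linarith [mul_nonneg hN0 hδ0.le]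
    have h4 : 0 ≤ l^(k+1+1) := by positivity
    have h5 := mul_le_mul_of_nonneg_left h3 (by positivity : 0 ≤ μ^(k+1+1))
    rw [h1]; linarith
  have B5 : l^k * ((E.card:ℝ)^2/q + l * E.card + (E.card:ℝ)^2/q^2) ≤ μ^(k+1+1) * (8 * δ^2) := by
    have hEq : (E.card:ℝ) = μ * q := by rw [hμ]; field_simp
    have h1 : (E.card:ℝ)^2/q + l * E.card + (E.card:ℝ)^2/q^2 = μ^2 * (q + ε * q + 1) := by
      rw [hEq, hl]; field_simp
    have h2 : μ^2 * (q + ε * q + 1) ≤ μ^2 * (3 * q) := by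
      gcongr; linarith [mul_le_mul_of_nonneg_right hε1 hq0.le]
    have h3 : ε^k ≤ ε^4 := pow_le_pow_of_le_one hε0 (by linarith) (by omega)
    have h4 : ε^4 = 4 * δ^4 := by
      have : ε^4 = (s2^2)^2 * δ^4 := by rw [hε]; ring
      rw [this, hs2s]; norm_num
    rw [h1]
    calc l^k * (μ^2 * (q + ε * q + 1)) ≤ l^k * (μ^2 * (3*q)) := by gcongr
      _ = μ^(k+1+1) * (3 * q * ε^k) := by rw [hl, mul_pow]; ring
      _ ≤ μ^(k+1+1) * (3 * q * (4 * δ^4)) := by rw [← h4]; gcongr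
      _ ≤ μ^(k+1+1) * (8 * δ^2) := by
          refine mul_le_mul_of_nonneg_left ?_ (by positivity)
          linarith [mul_le_mul_of_nonneg_right hqδ (sq_nonneg δ), sq_nonneg δ, (by ring : q * δ^2 * δ^2 = q * δ^4)]
  have B6 : |((CycProd.RR t E)^(k+2)).trace| ≤ μ^(k+1+1) * (8 * δ^2) :=
    B2.trans ((mul_le_mul_of_nonneg_left B3 (by positivity)).trans B5)
  have B7 : 0 ≤ μ^(k+1+1) * (12 * q^γ) := by positivity
  have B8 := abs_add_le (((CycProd.AA t E)^(k+1+1)).trace - ((CycProd.RR t E)^(k+1+1)).trace - μ^(k+1+1))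
    (((CycProd.RR t E)^(k+1+1)).trace)
  have e3 : ((CycProd.AA t E)^(k+1+1)).trace - ((CycProd.RR t E)^(k+1+1)).trace - μ^(k+1+1) + ((CycProd.RR t E)^(k+1+1)).trace
     = ((CycProd.AA t E)^(k+1+1)).trace - μ^(k+1+1) := by ring
  rw [e3] at B8
  have B6' : |((CycProd.RR t E)^(k+1+1)).trace| ≤ μ^(k+1+1) * (8 * δ^2) := B6
  linarith
end

section
/- Let γ = -1 if d = 2 and γ = -(d-2)/2 if d ≥ 3. Suppose that 12q^γ + 8q^{d+2}/|E|² + 48q^{(d+1)/2}/|E| ≤ 1. Then |C_4^prod(E) - |E|⁴/q⁴| ≤ (|E|⁴/q⁴)·(12q^γ + 8q^{d+2}/|E|² + 28q^{(d+1)/2}/|E|). -/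
open Finset
open scoped Classical

namespace CycleFour

/-- Dot product. -/
def dp {F : Type} [Field F] {d : ℕ} (x y : Fin d → F) : F := ∑ j, x j * y j

lemma dp_comm {F : Type} [Field F] {d : ℕ} (x y : Fin d → F) : dp x y = dp y x := by
  unfold dp
  exact Finset.sum_congr rfl fun j _ => mul_comm _ _

lemma dp_smul {F : Type} [Field F] {d : ℕ} (c : F) (x y : Fin d → F) :
    dp (c • x) y = c * dp x y := by
  unfold dp
  rw [Finset.mul_sum]
  exact Finset.sum_congr rfl fun j _ => by simp [mul_assoc]

lemma dp_add {F : Type} [Field F] {d : ℕ} (x x' y : Fin d → F) :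
    dp (x + x') y = dp x y + dp x' y := by
  unfold dp
  rw [← Finset.sum_add_distrib]
  exact Finset.sum_congr rfl fun j _ => by simp [add_mul]

lemma exists_dp {F : Type} [Field F] {d : ℕ} (v : Fin d → F) (hv : v ≠ 0) (s : F) :
    ∃ x, dp x v = s := by
  obtain ⟨j, hj⟩ := Function.ne_iff.mp hv
  have hj' : v j ≠ 0 := hj
  refine ⟨Pi.single j (s / v j), ?_⟩
  unfold dp
  rw [Finset.sum_eq_single j]
  · simp [hj']
  · intro b _ hb
    simp [hb]
  · simp

/-- Number of solutions of `x·v = 0`. -/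
lemma count_dp {F : Type} [Field F] [Fintype F] {d : ℕ} (v : Fin d → F) (hv : v ≠ 0) :
    (Fintype.card F : ℝ) * ∑ x : Fin d → F, (if dp x v = 0 then (1 : ℝ) else 0)
      = (Fintype.card F : ℝ) ^ d := by
  have h1 : ∀ s : F, ∑ x : Fin d → F, (if dp x v = s then (1 : ℝ) else 0)
      = ∑ x : Fin d → F, (if dp x v = 0 then (1 : ℝ) else 0) := by
    intro s
    obtain ⟨x0, h0⟩ := exists_dp v hv s
    symm
    apply Fintype.sum_equiv (Equiv.addRight x0)
    intro x
    simp [dp_add, h0]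
  have h2 : ∑ s : F, ∑ x : Fin d → F, (if dp x v = s then (1 : ℝ) else 0)
      = (Fintype.card F : ℝ) ^ d := by
    rw [Finset.sum_comm]
    simp
  rw [← h2, Finset.sum_congr rfl fun s _ => h1 s]
  simp

/-- Fibre sums. -/
noncomputable def g {F : Type} [Field F] [Fintype F] {d : ℕ} (f : (Fin d → F) → ℝ)
    (x : Fin d → F) (s : F) : ℝ := ∑ y, (if dp x y = s then f y else 0)

lemma sum_g {F : Type} [Field F] [Fintype F] {d : ℕ} (f : (Fin d → F) → ℝ)
    (x : Fin d → F) : ∑ s, g f x s = ∑ y, f y := by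
  unfold g
  rw [Finset.sum_comm]
  simp

lemma sum_g_sq {F : Type} [Field F] [Fintype F] {d : ℕ} (f : (Fin d → F) → ℝ)
    (x : Fin d → F) : ∑ s, g f x s ^ 2
      = ∑ y, ∑ y', f y * f y' * (if dp x (y - y') = 0 then 1 else 0) := by
  unfold g
  simp_rw [sq, Finset.sum_mul_sum]
  rw [Finset.sum_comm]
  refine Finset.sum_congr rfl fun y _ => ?_
  rw [Finset.sum_comm]
  refine Finset.sum_congr rfl fun y' _ => ?_
  have : dp x (y - y') = dp x y - dp x y' := by
    unfold dp
    rw [← Finset.sum_sub_distrib]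
    exact Finset.sum_congr rfl fun j _ => by simp [mul_sub]
  rw [this, sub_eq_zero]
  by_cases h : dp x y = dp x y' <;> simp [h, ite_mul]

lemma g_scale {F : Type} [Field F] [Fintype F] {d : ℕ} (f : (Fin d → F) → ℝ)
    (a : ℝ) (c s : F) (hc : c ≠ 0) :
    ∑ x, (g f x (c * s) - a) ^ 2 = ∑ x, (g f x s - a) ^ 2 := by
  symm
  apply Fintype.sum_equiv (MulAction.toPerm (Units.mk0 c hc))
  intro x
  have : (MulAction.toPerm (Units.mk0 c hc)) x = c • x := rfl
  rw [this]
  unfold g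
  simp_rw [dp_smul, mul_right_inj' hc]

lemma op_bound {F : Type} [Field F] [Fintype F] {d : ℕ} (f : (Fin d → F) → ℝ)
    (t : F) (ht : t ≠ 0) :
    (Fintype.card F : ℝ) * ∑ x, (g f x t - (∑ y, f y) / (Fintype.card F : ℝ)) ^ 2
      ≤ (Fintype.card F : ℝ) ^ d * ∑ y, f y ^ 2 := by
  set q : ℝ := (Fintype.card F : ℝ) with hq
  set S := ∑ y, f y with hS
  have hq1 : 1 < q := by
    rw [hq]; exact_mod_cast Fintype.one_lt_card
  have hq0 : q ≠ 0 := by positivity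
  set Z := ∑ x, (g f x t - S / q) ^ 2 with hZ
  have h1 : ∀ s : F, s ≠ 0 → ∑ x, (g f x s - S / q) ^ 2 = Z := by
    intro s hs
    have := g_scale f (S / q) (s / t) t (div_ne_zero hs ht)
    rwa [div_mul_cancel₀ _ ht] at this
  have h2 : (q - 1) * Z ≤ ∑ s : F, ∑ x, (g f x s - S / q) ^ 2 := by
    have h3 : ∑ s ∈ Finset.univ.erase (0 : F), ∑ x, (g f x s - S / q) ^ 2 = (q - 1) * Z := by
      rw [Finset.sum_congr rfl fun s hs => h1 s (Finset.ne_of_mem_erase hs)]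
      rw [Finset.sum_const, Finset.card_erase_of_mem (Finset.mem_univ _), nsmul_eq_mul,
        Finset.card_univ, Nat.cast_sub Fintype.card_pos]
      simp [hq]
    rw [← h3]
    apply Finset.sum_le_sum_of_subset_of_nonneg (Finset.subset_univ _)
    intro s _ _
    exact Finset.sum_nonneg fun x _ => sq_nonneg _
  have h4 : ∀ x : Fin d → F, ∑ s : F, (g f x s - S / q) ^ 2 = ∑ s, g f x s ^ 2 - S ^ 2 / q := by
    intro x
    simp_rw [sub_sq]
    rw [Finset.sum_add_distrib, Finset.sum_sub_distrib, ← Finset.sum_mul, ← Finset.mul_sum, sum_g]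
    simp only [Finset.sum_const, Finset.card_univ, nsmul_eq_mul]
    rw [← hq, ← hS]
    field_simp
    ring
  have h5 : ∑ x : Fin d → F, ∑ s, g f x s ^ 2
      = q ^ d / q * S ^ 2 + (q ^ d - q ^ d / q) * ∑ y, f y ^ 2 := by
    simp_rw [sum_g_sq]
    rw [Finset.sum_comm]
    have h6 : ∀ y : Fin d → F, ∑ x : Fin d → F, ∑ y', f y * f y' *
        (if dp x (y - y') = 0 then (1 : ℝ) else 0)
        = ∑ y', (q ^ d / q * (f y * f y') +
          (if y = y' then (q ^ d - q ^ d / q) * f y ^ 2 else 0)) := by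
      intro y
      rw [Finset.sum_comm]
      refine Finset.sum_congr rfl fun y' _ => ?_
      rw [← Finset.mul_sum]
      by_cases h : y = y'
      · subst h
        have : ∀ x : Fin d → F, dp x (y - y) = 0 := by intro x; simp [dp]
        simp only [this, if_true, Finset.sum_const, Finset.card_univ, nsmul_eq_mul,
          Fintype.card_fun, Fintype.card_fin, Nat.cast_pow, ← hq]
        ring
      · have := count_dp (y - y') (sub_ne_zero.mpr h)
        rw [← hq] at this
        simp only [h, if_false, add_zero]
        rw [← this]
        field_simp
    rw [Finset.sum_congr rfl fun y _ => h6 y]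
    simp_rw [Finset.sum_add_distrib, ← Finset.mul_sum]
    rw [← Finset.sum_mul, ← hS]
    simp only [Finset.sum_ite_eq, Finset.mem_univ, if_true, ← Finset.mul_sum, ← Finset.sum_mul]
    ring
  rw [Finset.sum_comm, Finset.sum_congr rfl fun x _ => h4 x, Finset.sum_sub_distrib, h5] at h2
  simp only [Finset.sum_const, Finset.card_univ, nsmul_eq_mul, Fintype.card_fun,
    Fintype.card_fin, Nat.cast_pow, ← hq] at h2
  have h7 : q ^ d / q * S ^ 2 + (q ^ d - q ^ d / q) * ∑ y, f y ^ 2 - q ^ d * (S ^ 2 / q)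
      = (q - 1) * ((q ^ d * ∑ y, f y ^ 2) / q) := by
    field_simp
    ring
  rw [h7] at h2
  have h8 := le_of_mul_le_mul_left h2 (by linarith)
  rw [le_div_iff₀ (by linarith)] at h8
  linarith

/-- The centred adjacency matrix. -/
noncomputable def B {F : Type} [Field F] [Fintype F] {d : ℕ} (t : F) (x y : Fin d → F) : ℝ :=
  (if dp x y = t then 1 else 0) - 1 / (Fintype.card F : ℝ)

lemma B_comm {F : Type} [Field F] [Fintype F] {d : ℕ} (t : F) (x y : Fin d → F) :
    B t x y = B t y x := by
  unfold B
  rw [dp_comm]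

lemma B_bound {F : Type} [Field F] [Fintype F] {d : ℕ} (t : F) (ht : t ≠ 0)
    (E : Finset (Fin d → F)) (f : (Fin d → F) → ℝ) :
    ∑ x ∈ E, (∑ y ∈ E, B t x y * f y) ^ 2
      ≤ (Fintype.card F : ℝ) ^ d / (Fintype.card F : ℝ) * ∑ y ∈ E, f y ^ 2 := by
  have hq1 : (0 : ℝ) < (Fintype.card F : ℝ) := by exact_mod_cast Fintype.card_pos
  have h := op_bound (fun y => if y ∈ E then f y else 0) t ht
  have h1 : ∀ x, ∑ y ∈ E, B t x y * f y = g (fun y => if y ∈ E then f y else 0) x t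
      - (∑ y, if y ∈ E then f y else 0) / (Fintype.card F : ℝ) := by
    intro x
    unfold g B
    rw [Finset.sum_div, ← Finset.sum_sub_distrib, ← Finset.sum_subset (Finset.subset_univ E)]
    · refine Finset.sum_congr rfl fun y hy => ?_
      simp only [hy, if_true]
      split_ifs <;> ring
    · intro y _ hy
      simp [hy]
  have h2 : ∑ y, (if y ∈ E then f y else 0) ^ 2 = ∑ y ∈ E, f y ^ 2 := by
    simp [ite_pow, Finset.sum_ite_mem]
  simp only [h2] at h
  calc ∑ x ∈ E, (∑ y ∈ E, B t x y * f y) ^ 2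
      ≤ ∑ x, (∑ y ∈ E, B t x y * f y) ^ 2 :=
        Finset.sum_le_sum_of_subset_of_nonneg (Finset.subset_univ _) fun _ _ _ => sq_nonneg _
    _ ≤ _ := by
        simp only [h1]
        rw [div_mul_eq_mul_div, le_div_iff₀ hq1]
        linarith

lemma count_eq {F : Type} [Field F] [Fintype F] [DecidableEq F] (d : ℕ) (t : F)
    (E : Finset (Fin d → F)) :
    (cycleCountProd F d 4 t E : ℝ) = ∑ x ∈ E, ∑ z ∈ E,
      (∑ y ∈ E, (B t x y + 1 / (Fintype.card F : ℝ)) * (B t y z + 1 / (Fintype.card F : ℝ))) ^ 2 := by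
  have h1 : cycleCountProd F d 4 t E = ((E ×ˢ E ×ˢ E ×ˢ E).filter
      (fun p => dp p.1 p.2.2.1 = t ∧ dp p.2.2.1 p.2.1 = t ∧ dp p.2.1 p.2.2.2 = t ∧
        dp p.2.2.2 p.1 = t)).card := by
    unfold cycleCountProd
    apply Finset.card_nbij' (fun x => (x 0, x 2, x 1, x 3))
      (fun p => ![p.1, p.2.2.1, p.2.1, p.2.2.2])
    · intro x hx
      simp only [Finset.coe_filter, Finset.mem_univ, true_and, Set.mem_ofPred_eq] at hx
      obtain ⟨ha, hb⟩ := hx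
      simp only [Finset.coe_filter, Set.mem_ofPred_eq, Finset.mem_product]
      exact ⟨⟨ha 0, ha 2, ha 1, ha 3⟩, hb 0, hb 1, hb 2, hb 3⟩
    · intro p hp
      simp only [Finset.coe_filter, Set.mem_ofPred_eq, Finset.mem_product] at hp
      obtain ⟨⟨ha, hb, hc, hd⟩, h1, h2, h3, h4⟩ := hp
      simp only [Finset.coe_filter, Finset.mem_univ, true_and, Set.mem_ofPred_eq]
      constructor
      · intro i
        fin_cases i
        · exact ha
        · exact hc
        · exact hb
        · exact hd
      · intro i
        fin_cases i
        · exact h1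
        · exact h2
        · exact h3
        · exact h4
    · intro x _
      ext i
      fin_cases i <;> rfl
    · intro p _
      rfl
  rw [h1, Finset.card_filter]
  push_cast
  rw [Finset.sum_product]
  refine Finset.sum_congr rfl fun x _ => ?_
  rw [Finset.sum_product]
  refine Finset.sum_congr rfl fun z _ => ?_
  rw [Finset.sum_product, sq, Finset.sum_mul_sum]
  refine Finset.sum_congr rfl fun y _ => ?_
  refine Finset.sum_congr rfl fun w _ => ?_
  have e : ∀ a b : Fin d → F, B t a b + 1 / (Fintype.card F : ℝ) = if dp a b = t then 1 else 0 := by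
    intro a b
    unfold B
    ring
  rw [e, e, e, e, dp_comm z w, dp_comm w x]
  split_ifs <;> simp_all

/-- Algebraic expansion. -/
lemma expand {V : Type} (E : Finset V) (b : V → V → ℝ) (hb : ∀ x y, b x y = b y x) (c : ℝ) :
    ∑ x ∈ E, ∑ z ∈ E, (∑ y ∈ E, (b x y + c) * (b y z + c)) ^ 2
      = (E.card : ℝ) ^ 4 * c ^ 4 + 4 * (E.card : ℝ) ^ 2 * c ^ 3 * (∑ x ∈ E, ∑ y ∈ E, b x y)
        + 4 * E.card * c ^ 2 * (∑ x ∈ E, (∑ y ∈ E, b x y) ^ 2)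
        + 2 * c ^ 2 * (∑ x ∈ E, ∑ y ∈ E, b x y) ^ 2
        + 4 * c * (∑ x ∈ E, (∑ y ∈ E, b x y) * ∑ y ∈ E, b x y * ∑ z ∈ E, b y z)
        + ∑ z ∈ E, ∑ x ∈ E, (∑ y ∈ E, b x y * b y z) ^ 2 := by
  set N : ℝ := (E.card : ℝ) with hN
  set r : V → ℝ := fun x => ∑ y ∈ E, b x y with hr
  set Q : V → V → ℝ := fun x z => ∑ y ∈ E, b x y * b y z with hQ
  have hP : ∀ x z, ∑ y ∈ E, (b x y + c) * (b y z + c) = N * c ^ 2 + c * (r x + r z) + Q x z := by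
    intro x z
    have : ∀ y, (b x y + c) * (b y z + c) = c ^ 2 + c * (b x y + b z y) + b x y * b y z := by
      intro y
      rw [hb z y]
      ring
    simp only [this, Finset.sum_add_distrib, ← Finset.mul_sum, hr, hQ, Finset.sum_const,
      nsmul_eq_mul, hN]
  have hQs : ∑ x ∈ E, ∑ z ∈ E, Q x z = ∑ x ∈ E, r x ^ 2 := by
    simp only [hQ, hr]
    have : ∀ x ∈ E, ∑ z ∈ E, ∑ y ∈ E, b x y * b y z = ∑ y ∈ E, b x y * ∑ z ∈ E, b y z := by
      intro x _
      rw [Finset.sum_comm]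
      simp_rw [Finset.mul_sum]
    rw [Finset.sum_congr rfl this, Finset.sum_comm]
    refine Finset.sum_congr rfl fun y _ => ?_
    rw [← Finset.sum_mul, sq]
    congr 1
    exact Finset.sum_congr rfl fun x _ => hb _ _
  have hQc : ∀ x z, Q x z = Q z x := by
    intro x z
    simp only [hQ]
    refine Finset.sum_congr rfl fun y _ => ?_
    rw [hb x y, hb y z, mul_comm]
  have hK1 : ∑ x ∈ E, ∑ z ∈ E, r x * Q x z = ∑ x ∈ E, r x * ∑ y ∈ E, b x y * r y := by
    refine Finset.sum_congr rfl fun x _ => ?_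
    rw [← Finset.mul_sum]
    congr 1
    simp only [hQ, hr]
    rw [Finset.sum_comm]
    simp_rw [Finset.mul_sum]
  have hK2 : ∑ x ∈ E, ∑ z ∈ E, r z * Q x z = ∑ x ∈ E, r x * ∑ y ∈ E, b x y * r y := by
    rw [Finset.sum_comm, ← hK1]
    refine Finset.sum_congr rfl fun x _ => Finset.sum_congr rfl fun z _ => ?_
    rw [hQc]
  have hQ2 : ∑ z ∈ E, ∑ x ∈ E, Q x z ^ 2 = ∑ x ∈ E, ∑ z ∈ E, Q x z ^ 2 := Finset.sum_comm
  change _ = N ^ 4 * c ^ 4 + 4 * N ^ 2 * c ^ 3 * (∑ x ∈ E, r x)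
        + 4 * N * c ^ 2 * (∑ x ∈ E, r x ^ 2)
        + 2 * c ^ 2 * (∑ x ∈ E, r x) ^ 2
        + 4 * c * (∑ x ∈ E, r x * ∑ y ∈ E, b x y * r y)
        + ∑ z ∈ E, ∑ x ∈ E, Q x z ^ 2
  have hexp : ∀ x z, (N * c ^ 2 + c * (r x + r z) + Q x z) ^ 2
      = N ^ 2 * c ^ 4 + 2 * N * c ^ 3 * r x + 2 * N * c ^ 3 * r z + c ^ 2 * r x ^ 2
        + c ^ 2 * r z ^ 2 + 2 * c ^ 2 * (r x * r z) + 2 * N * c ^ 2 * Q x z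
        + 2 * c * (r x * Q x z) + 2 * c * (r z * Q x z) + Q x z ^ 2 := by
    intro x z
    ring
  have hrr : ∑ x ∈ E, ∑ z ∈ E, r x * r z = (∑ x ∈ E, r x) ^ 2 := by
    rw [sq, Finset.sum_mul_sum]
  simp only [hP, hexp, Finset.sum_add_distrib, ← Finset.mul_sum, hQ2] 
  simp only [Finset.mul_sum] at hK1 hK2 hrr ⊢
  simp only [← Finset.mul_sum] at hK1 hK2 hrr ⊢
  rw [hK1, hK2, hQs]
  simp only [Finset.sum_const, nsmul_eq_mul, ← hN, ← Finset.sum_mul, ← Finset.mul_sum]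
  ring

/-- Final numerical estimate. -/
lemma final_bound (N q l R R2 K T C : ℝ) (hN : 0 < N) (hq : 2 ≤ q) (hl : 0 < l)
    (ha : 48 * (q * l) ≤ N)
    (hR2 : R2 ≤ l ^ 2 * N) (hR20 : 0 ≤ R2) (hR : R ^ 2 ≤ N * R2)
    (hK : K ^ 2 ≤ R2 * (l ^ 2 * R2)) (hT0 : 0 ≤ T)
    (hT : T ≤ l ^ 2 * (|R| + N ^ 2 / q))
    (hC : C = N ^ 4 * (1 / q) ^ 4 + 4 * N ^ 2 * (1 / q) ^ 3 * R + 4 * N * (1 / q) ^ 2 * R2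
      + 2 * (1 / q) ^ 2 * R ^ 2 + 4 * (1 / q) * K + T) :
    |C - N ^ 4 / q ^ 4| ≤ N ^ 4 / q ^ 4 *
      (8 * (q * (q * l) ^ 2) / N ^ 2 + 28 * (q * l) / N) := by
  have hq0 : 0 < q := by linarith
  have hRa : |R| ≤ N * l := by
    apply abs_le_of_sq_le_sq _ (by positivity)
    nlinarith
  have hKa : |K| ≤ l ^ 3 * N := by
    apply abs_le_of_sq_le_sq _ (by positivity)
    have : R2 * (l ^ 2 * R2) ≤ (l ^ 2 * N) * (l ^ 2 * (l ^ 2 * N)) := by gcongr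
    nlinarith
  have hRs : R ^ 2 ≤ N ^ 2 * l ^ 2 := by nlinarith
  have hdiff : |C - N ^ 4 / q ^ 4| ≤ 4 * N ^ 2 * (1 / q) ^ 3 * (N * l)
      + 4 * N * (1 / q) ^ 2 * (l ^ 2 * N) + 2 * (1 / q) ^ 2 * (N ^ 2 * l ^ 2)
      + 4 * (1 / q) * (l ^ 3 * N) + l ^ 2 * (N * l + N ^ 2 / q) := by
    have e : C - N ^ 4 / q ^ 4 = 4 * N ^ 2 * (1 / q) ^ 3 * R + 4 * N * (1 / q) ^ 2 * R2
      + 2 * (1 / q) ^ 2 * R ^ 2 + 4 * (1 / q) * K + T := by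
      rw [hC]
      ring
    rw [e]
    have t1 : |4 * N ^ 2 * (1 / q) ^ 3 * R| ≤ 4 * N ^ 2 * (1 / q) ^ 3 * (N * l) := by
      rw [abs_mul, abs_of_nonneg (by positivity : 0 ≤ 4 * N ^ 2 * (1 / q) ^ 3)]
      gcongr
    have t2 : |4 * N * (1 / q) ^ 2 * R2| ≤ 4 * N * (1 / q) ^ 2 * (l ^ 2 * N) := by
      rw [abs_of_nonneg (by positivity)]
      gcongr
    have t3 : |2 * (1 / q) ^ 2 * R ^ 2| ≤ 2 * (1 / q) ^ 2 * (N ^ 2 * l ^ 2) := by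
      rw [abs_of_nonneg (by positivity)]
      gcongr
    have t4 : |4 * (1 / q) * K| ≤ 4 * (1 / q) * (l ^ 3 * N) := by
      rw [abs_mul, abs_of_nonneg (by positivity : 0 ≤ 4 * (1 / q))]
      gcongr
    have t5 : |T| ≤ l ^ 2 * (N * l + N ^ 2 / q) := by
      rw [abs_of_nonneg hT0]
      refine hT.trans ?_
      gcongr
    refine (abs_add_le _ _).trans (add_le_add ((abs_add_le _ _).trans (add_le_add
      ((abs_add_le _ _).trans (add_le_add ((abs_add_le _ _).trans (add_le_add t1 t2)) t3)) t4)) t5)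
  refine hdiff.trans ?_
  set a := q * l / N with haa
  have ha0 : 0 < a := by positivity
  have ha1 : 48 * a ≤ 1 := by
    rw [haa, ← mul_div_assoc, div_le_one hN]
    exact ha
  have hl' : l = a * N / q := by
    rw [haa]
    field_simp
  have e1 : 4 * N ^ 2 * (1 / q) ^ 3 * (N * l)
      + 4 * N * (1 / q) ^ 2 * (l ^ 2 * N) + 2 * (1 / q) ^ 2 * (N ^ 2 * l ^ 2)
      + 4 * (1 / q) * (l ^ 3 * N) + l ^ 2 * (N * l + N ^ 2 / q)
      = N ^ 4 / q ^ 4 * (4 * a + 6 * a ^ 2 + 4 * a ^ 3 + q * a ^ 2 + q * a ^ 3) := by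
    rw [hl']
    field_simp
    ring
  have e2 : 8 * (q * (q * l) ^ 2) / N ^ 2 + 28 * (q * l) / N = 8 * (q * a ^ 2) + 28 * a := by
    rw [haa]
    field_simp
  rw [e1, e2]
  apply mul_le_mul_of_nonneg_left _ (by positivity)
  have b2 : a ^ 2 ≤ a := by nlinarith
  have b3 : a ^ 3 ≤ a ^ 2 := by nlinarith
  have b4 : q * a ^ 3 ≤ q * a ^ 2 := by gcongr
  have b5 : 0 ≤ q * a ^ 2 := by positivity
  linarith

end CycleFour

theorem cycle_count_prod_four (F : Type) [Field F] [Fintype F] [DecidableEq F]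
    (d : ℕ) (hd : 2 ≤ d) (t : F) (ht : t ≠ 0)
    (E : Finset (Fin d → F))
    (q : ℝ) (hq : q = (Fintype.card F : ℝ))
    (γ : ℝ) (hγ : γ = if d = 2 then (-1 : ℝ) else -(((d : ℝ) - 2) / 2))
    (hsize : 12 * q ^ γ + 8 * q ^ ((d : ℝ) + 2) / (E.card : ℝ) ^ 2 +
      48 * q ^ (((d : ℝ) + 1) / 2) / (E.card : ℝ) ≤ 1) :
    |(cycleCountProd F d 4 t E : ℝ) - (E.card : ℝ) ^ 4 / q ^ 4| ≤
      (E.card : ℝ) ^ 4 / q ^ 4 *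
        (12 * q ^ γ + 8 * q ^ ((d : ℝ) + 2) / (E.card : ℝ) ^ 2 +
          28 * q ^ (((d : ℝ) + 1) / 2) / (E.card : ℝ)) := by
  have hq2 : 2 ≤ q := by
    rw [hq]; exact_mod_cast Fintype.one_lt_card (α := F)
  have hq0 : 0 < q := by linarith
  have hγ0 : 0 ≤ q ^ γ := by positivity
  rcases E.eq_empty_or_nonempty with hE | hE
  · subst hE
    have : cycleCountProd F d 4 t ∅ = 0 := by
      unfold cycleCountProd
      rw [Finset.card_eq_zero, Finset.filter_eq_empty_iff]
      rintro x _ ⟨h, _⟩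
      simpa using h 0
    rw [this]
    simp
  have hN : (0 : ℝ) < E.card := by exact_mod_cast hE.card_pos
  set N : ℝ := (E.card : ℝ) with hNdef
  set l : ℝ := q ^ (((d : ℝ) - 1) / 2) with hl
  have hl0 : 0 < l := by positivity
  have hp : q ^ (((d : ℝ) + 1) / 2) = q * l := by
    rw [hl, show ((d : ℝ) + 1) / 2 = 1 + ((d : ℝ) - 1) / 2 by ring, Real.rpow_add hq0,
      Real.rpow_one]
  have hl2 : q ^ d / q = l ^ 2 := by
    rw [hl, ← Real.rpow_natCast (q ^ _) 2, ← Real.rpow_mul hq0.le,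
      show ((d : ℝ) - 1) / 2 * ((2 : ℕ) : ℝ) = d - 1 by push_cast; ring,
      Real.rpow_sub hq0, Real.rpow_one, Real.rpow_natCast]
  have hp2 : q ^ ((d : ℝ) + 2) = q * (q * l) ^ 2 := by
    rw [mul_pow, ← hl2, show ((d : ℝ) + 2) = ((d + 2 : ℕ) : ℝ) by push_cast; ring,
      Real.rpow_natCast]
    field_simp
    try ring
  rw [hp, hp2] at hsize ⊢
  have ha : 48 * (q * l) ≤ N := by
    have h1 : 0 ≤ 8 * (q * (q * l) ^ 2) / N ^ 2 := by positivity
    have h2 : 48 * (q * l) / N ≤ 1 := by linarith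
    rwa [div_le_one hN] at h2
  have hop := CycleFour.B_bound t ht E
  rw [← hq, hl2] at hop
  have hR2 := hop (fun _ => 1)
  simp only [mul_one, one_pow, Finset.sum_const, nsmul_eq_mul, ← hNdef] at hR2
  have hR := sq_sum_le_card_mul_sum_sq (s := E) (f := fun x => ∑ y ∈ E, CycleFour.B t x y)
  have hK := Finset.sum_mul_sq_le_sq_mul_sq E (fun x => ∑ y ∈ E, CycleFour.B t x y)
    (fun x => ∑ y ∈ E, CycleFour.B t x y * ∑ z ∈ E, CycleFour.B t y z)
  have hR20 : 0 ≤ ∑ x ∈ E, (∑ y ∈ E, CycleFour.B t x y) ^ 2 :=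
    Finset.sum_nonneg fun _ _ => sq_nonneg _
  have hK' := hK.trans (mul_le_mul_of_nonneg_left
    (hop (fun y => ∑ z ∈ E, CycleFour.B t y z)) hR20)
  have hBsq : ∀ x y : Fin d → F, CycleFour.B t x y ^ 2
      = (1 - 2 / q) * CycleFour.B t x y + (1 / q - 1 / q ^ 2) := by
    intro x y
    unfold CycleFour.B
    rw [← hq]
    split_ifs <;> field_simp <;> ring
  have hT : ∑ z ∈ E, ∑ x ∈ E, (∑ y ∈ E, CycleFour.B t x y * CycleFour.B t y z) ^ 2
      ≤ l ^ 2 * (|∑ x ∈ E, ∑ y ∈ E, CycleFour.B t x y| + N ^ 2 / q) := by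
    calc _ ≤ ∑ z ∈ E, l ^ 2 * ∑ y ∈ E, CycleFour.B t y z ^ 2 :=
          Finset.sum_le_sum fun z _ => hop (fun y => CycleFour.B t y z)
      _ = l ^ 2 * ((1 - 2 / q) * (∑ x ∈ E, ∑ y ∈ E, CycleFour.B t x y)
            + N ^ 2 * (1 / q - 1 / q ^ 2)) := by
          rw [← Finset.mul_sum, Finset.sum_comm]
          simp only [hBsq, Finset.sum_add_distrib, ← Finset.mul_sum, Finset.sum_const,
            nsmul_eq_mul, ← hNdef]
          ring
      _ ≤ _ := by
          have h1 : 0 ≤ 1 - 2 / q := by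
            rw [sub_nonneg, div_le_one hq0]; exact hq2
          have h2 : 1 - 2 / q ≤ 1 := by
            have : 0 ≤ 2 / q := by positivity
            linarith
          have h3 : N ^ 2 * (1 / q - 1 / q ^ 2) ≤ N ^ 2 / q := by
            have : 0 ≤ N ^ 2 * (1 / q ^ 2) := by positivity
            have e : N ^ 2 * (1 / q - 1 / q ^ 2) = N ^ 2 / q - N ^ 2 * (1 / q ^ 2) := by ring
            linarith
          have h4 : (1 - 2 / q) * (∑ x ∈ E, ∑ y ∈ E, CycleFour.B t x y)
              ≤ |∑ x ∈ E, ∑ y ∈ E, CycleFour.B t x y| :=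
            (mul_le_mul_of_nonneg_left (le_abs_self _) h1).trans
              (mul_le_of_le_one_left (abs_nonneg _) h2)
          gcongr
  have hC := CycleFour.count_eq d t E
  rw [CycleFour.expand E _ (CycleFour.B_comm t), ← hq, ← hNdef] at hC
  have hfin := CycleFour.final_bound N q l _ _ _ _ _ hN hq2 hl0 ha hR2 hR20 hR hK'
    (Finset.sum_nonneg fun _ _ => Finset.sum_nonneg fun _ _ => sq_nonneg _) hT hC
  refine hfin.trans (mul_le_mul_of_nonneg_left ?_ (by positivity))
  linarith
end

section
/- Let n ≥ 5 and let δ satisfy 0 < δ < 1/(2⌊n/2⌋²). There exists Q, depending only on d, n and δ, such that for every q ≥ Q the following holds: if |E| ≥ q^{(1/2)(d+2-(k-2)/(k-1)+δ)} when n = 2k is even, and |E| ≥ q^{(1/2)(d+2-(2k-3)/(2k-1)+δ)} when n = 2k+1 is odd, then |C_n^prod(E) - |E|^n/q^n| ≤ (36 + 80·6^{⌊n/2⌋-2} + 12⌊n/2⌋)·(|E|^n/q^n)·q^{-(n/2-1)δ}. -/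
open Finset
open scoped Classical

section
open scoped Matrix.Norms.L2Operator
open Matrix

variable {ι : Type} [Fintype ι] [DecidableEq ι]

lemma aux_bil (B : Matrix ι ι ℝ) (v w : ι → ℝ) :
    |v ⬝ᵥ (B *ᵥ w)| ≤ ‖B‖ * (√(v ⬝ᵥ v) * √(w ⬝ᵥ w)) := by
  have hn : ∀ z : ι → ℝ, √(z ⬝ᵥ z) = ‖(WithLp.toLp 2 z : EuclideanSpace ℝ ι)‖ := by
    intro z
    rw [EuclideanSpace.norm_eq]
    simp [dotProduct, pow_two]
  have h1 := Matrix.l2_opNorm_mulVec B (WithLp.toLp 2 w : EuclideanSpace ℝ ι)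
  have h2 := abs_real_inner_le_norm (WithLp.toLp 2 (B *ᵥ w) : EuclideanSpace ℝ ι) (WithLp.toLp 2 v)
  have h3 : inner ℝ (WithLp.toLp 2 (B *ᵥ w) : EuclideanSpace ℝ ι) (WithLp.toLp 2 v)
      = v ⬝ᵥ (B *ᵥ w) := by
    simp [EuclideanSpace.inner_eq_star_dotProduct]
  rw [h3] at h2
  rw [hn, hn]
  refine h2.trans ?_
  have h4 : ‖(WithLp.toLp 2 (B *ᵥ w) : EuclideanSpace ℝ ι)‖ ≤ ‖B‖ * ‖(WithLp.toLp 2 w : EuclideanSpace ℝ ι)‖ := h1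
  have h5 := norm_nonneg (WithLp.toLp 2 v : EuclideanSpace ℝ ι)
  nlinarith [mul_le_mul_of_nonneg_right h4 h5]

lemma aux_norm_le (B : Matrix ι ι ℝ) (c : ℝ) (hc : 0 ≤ c)
    (h : ∀ w : ι → ℝ, ∑ x, (∑ y, B x y * w y) ^ 2 ≤ c ^ 2 * ∑ y, w y ^ 2) : ‖B‖ ≤ c := by
  rw [Matrix.l2_opNorm_def]
  refine ContinuousLinearMap.opNorm_le_bound _ hc ?_
  intro w
  have h1 := h w
  rw [← sq_le_sq₀ (norm_nonneg _) (by positivity), mul_pow, EuclideanSpace.norm_sq_eq,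
    EuclideanSpace.norm_sq_eq]
  simpa [Matrix.toLpLin_apply, mulVec, dotProduct] using h1

lemma aux_norm_pow [Nonempty ι] (B : Matrix ι ι ℝ) (c : ℝ) (h : ‖B‖ ≤ c) (m : ℕ) :
    ‖B ^ m‖ ≤ c ^ m :=
  (norm_pow_le B m).trans (pow_le_pow_left₀ (norm_nonneg _) h m)

lemma aux_tele (M R : Matrix ι ι ℝ) (n : ℕ) :
    (M + R) ^ n = R ^ n + ∑ i ∈ range n, (M + R) ^ i * M * R ^ (n - 1 - i) := by
  induction n with
  | zero => simp
  | succ n ih =>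
    rw [sum_range_succ, pow_succ, mul_add]
    nth_rewrite 2 [ih]
    rw [add_mul, sum_mul, ← pow_succ]
    have : ∀ i ∈ range n, (M + R) ^ i * M * R ^ (n - 1 - i) * R
        = (M + R) ^ i * M * R ^ (n + 1 - 1 - i) := by
      intro i hi
      have := mem_range.1 hi
      rw [mul_assoc, ← pow_succ]
      congr 2
      omega
    rw [sum_congr rfl this]
    simp
    abel

lemma aux_trace (B : Matrix ι ι ℝ) (u : ι → ℝ) (κ : ℝ) :
    (κ • vecMulVec u u * B).trace = κ * (u ⬝ᵥ (B *ᵥ u)) := by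
  rw [smul_mul_assoc, trace_smul, Matrix.trace_mul_comm, smul_eq_mul]
  congr 1
  rw [Matrix.mul_vecMulVec, Matrix.trace_vecMulVec, dotProduct_comm]

lemma aux_traceR (R : Matrix ι ι ℝ) (hR : Rᵀ = R) (B : Matrix ι ι ℝ) :
    |(R * B * R).trace| ≤ ‖B‖ * ∑ x, ∑ y, R x y ^ 2 := by
  have : (R * B * R).trace = ∑ x, (R x) ⬝ᵥ (B *ᵥ (R x)) := by
    rw [Matrix.trace]
    refine sum_congr rfl fun x _ => ?_
    have h2 : ∀ z, R z x = R x z := fun z => by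
      conv_lhs => rw [← hR]
      rfl
    rw [Matrix.diag_apply, Matrix.mul_assoc, Matrix.mul_apply]
    simp only [dotProduct, mulVec, Matrix.mul_apply, h2]
  rw [this, mul_sum]
  refine (abs_sum_le_sum_abs _ _).trans (sum_le_sum fun x _ => ?_)
  refine (aux_bil _ _ _).trans (le_of_eq ?_)
  rw [Real.mul_self_sqrt (by simp only [dotProduct]; exact sum_nonneg fun i _ => mul_self_nonneg _)]
  simp [dotProduct, pow_two]

lemma aux_main [Nonempty ι] (R : Matrix ι ι ℝ) (hR : Rᵀ = R) (u : ι → ℝ) (κ l N : ℝ) (hκ : 0 ≤ κ)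
    (hl : ‖R‖ ≤ l) (hN : u ⬝ᵥ u = N) (m : ℕ) :
    |((κ • vecMulVec u u + R) ^ (m + 2)).trace - (κ * N) ^ (m + 2)| ≤
      l ^ m * (∑ x, ∑ y, R x y ^ 2) + ((κ * N + l) ^ (m + 2) - (κ * N) ^ (m + 2)) := by
  set M := κ • vecMulVec u u with hM
  set a := κ * N with ha
  have hN0 : 0 ≤ N := by
    rw [← hN]; simp only [dotProduct]; exact sum_nonneg fun i _ => mul_self_nonneg _
  have hl0 : 0 ≤ l := (norm_nonneg _).trans hl
  have ha0 : 0 ≤ a := mul_nonneg hκ hN0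
  have hMn : ‖M‖ ≤ a := by
    apply aux_norm_le _ _ ha0
    intro w
    have h1 : ∀ x, (∑ y, M x y * w y) = κ * (u x * ∑ y, u y * w y) := by
      intro x
      rw [mul_sum, mul_sum]
      refine sum_congr rfl fun y _ => ?_
      simp [hM, vecMulVec_apply]; ring
    simp_rw [h1, mul_pow]
    rw [← mul_sum, ← sum_mul]
    have h2 : ∑ x, u x ^ 2 = N := by rw [← hN]; simp [dotProduct, pow_two]
    have h3 := sum_mul_sq_le_sq_mul_sq univ u w
    rw [h2] at h3 ⊢
    rw [ha]
    calc κ ^ 2 * (N * (∑ y, u y * w y) ^ 2) ≤ κ ^ 2 * (N * (N * ∑ y, w y ^ 2)) := by gcongr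
      _ = _ := by ring
  have hA : ‖M + R‖ ≤ a + l := (norm_add_le _ _).trans (add_le_add hMn hl)
  have hclose : ∀ i : ℕ, ‖(M + R) ^ i - M ^ i‖ ≤ (a + l) ^ i - a ^ i := by
    intro i
    induction i with
    | zero => simp
    | succ i ih =>
      have e : (M + R) ^ (i + 1) - M ^ (i + 1) = (M + R) * ((M + R) ^ i - M ^ i) + R * M ^ i := by
        rw [pow_succ', pow_succ']; noncomm_ring
      rw [e]
      calc _ ≤ ‖M + R‖ * ‖(M + R) ^ i - M ^ i‖ + ‖R‖ * ‖M ^ i‖ :=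
            (norm_add_le _ _).trans (add_le_add (norm_mul_le _ _) (norm_mul_le _ _))
        _ ≤ (a + l) * ((a + l) ^ i - a ^ i) + l * a ^ i := by
            have := aux_norm_pow M a hMn i
            gcongr
        _ = _ := by ring
  have hMu : ∀ i : ℕ, M ^ i *ᵥ u = a ^ i • u := by
    intro i
    induction i with
    | zero => simp
    | succ i ih =>
      rw [pow_succ', ← mulVec_mulVec, ih, mulVec_smul]
      have : M *ᵥ u = a • u := by
        rw [hM, smul_mulVec, vecMulVec_mulVec, hN]
        ext x; simp [ha]; ring
      rw [this, smul_smul, pow_succ]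
  have hbil : ∀ B : Matrix ι ι ℝ, |u ⬝ᵥ (B *ᵥ u)| ≤ ‖B‖ * N := by
    intro B
    have := aux_bil B u u
    rwa [hN, Real.mul_self_sqrt hN0] at this
  rw [aux_tele, trace_add, trace_sum, sum_range_succ]
  have hlast : |((M + R) ^ (m + 1) * M * R ^ (m + 2 - 1 - (m + 1))).trace - a ^ (m + 2)| ≤
      a * ((a + l) ^ (m + 1) - a ^ (m + 1)) := by
    have e1 : m + 2 - 1 - (m + 1) = 0 := by omega
    rw [e1, pow_zero, mul_one, Matrix.trace_mul_comm, aux_trace]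
    have e2 : κ * (u ⬝ᵥ ((M + R) ^ (m + 1) *ᵥ u)) - a ^ (m + 2)
        = κ * (u ⬝ᵥ (((M + R) ^ (m + 1) - M ^ (m + 1)) *ᵥ u)) := by
      rw [sub_mulVec, dotProduct_sub, hMu, dotProduct_smul, hN, smul_eq_mul, mul_sub, ha]; ring
    rw [e2, abs_mul, abs_of_nonneg hκ]
    calc _ ≤ κ * (((a + l) ^ (m + 1) - a ^ (m + 1)) * N) := by
          gcongr
          refine (hbil _).trans ?_
          gcongr
          exact hclose _
      _ = _ := by rw [ha]; ring
  have hterm : ∀ i ∈ range (m + 1), |((M + R) ^ i * M * R ^ (m + 2 - 1 - i)).trace| ≤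
      a * ((a + l) ^ i * l ^ (m + 2 - 1 - i)) := by
    intro i _
    rw [mul_assoc, Matrix.trace_mul_comm, mul_assoc, aux_trace, abs_mul, abs_of_nonneg hκ]
    calc _ ≤ κ * (l ^ (m + 2 - 1 - i) * (a + l) ^ i * N) := by
          gcongr
          refine (hbil _).trans ?_
          gcongr
          refine (norm_mul_le _ _).trans ?_
          have h1 := aux_norm_pow R l hl (m + 2 - 1 - i)
          have h2 := aux_norm_pow (M + R) (a + l) hA i
          gcongr
      _ = _ := by rw [ha]; ring
  have hsum : |∑ i ∈ range (m + 1), ((M + R) ^ i * M * R ^ (m + 2 - 1 - i)).trace| ≤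
      a * ∑ i ∈ range (m + 1), ((a + l) ^ i * l ^ (m + 2 - 1 - i)) := by
    rw [mul_sum]
    exact (abs_sum_le_sum_abs _ _).trans (sum_le_sum hterm)
  have hRn : |(R ^ (m + 2)).trace| ≤ l ^ m * (∑ x, ∑ y, R x y ^ 2) := by
    have e : R ^ (m + 2) = R * R ^ m * R := by rw [← pow_succ', ← pow_succ]
    rw [e]
    refine (aux_traceR R hR _).trans ?_
    gcongr
    exact aux_norm_pow R l hl m
  have hg := geom_sum₂_mul (a + l) l (m + 2)
  rw [sum_range_succ] at hg
  have e1 : m + 2 - 1 - (m + 1) = 0 := by omega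
  rw [e1] at hg
  have hl2 : 0 ≤ l ^ (m + 2) := by positivity
  have hfin : a * (∑ i ∈ range (m + 1), ((a + l) ^ i * l ^ (m + 2 - 1 - i)))
      + a * ((a + l) ^ (m + 1) - a ^ (m + 1)) = (a + l) ^ (m + 2) - l ^ (m + 2) - a ^ (m + 2) := by
    rw [← hg]; ring
  rw [abs_le] at hRn hsum hlast ⊢
  constructor <;> linarith [hRn.1, hRn.2, hsum.1, hsum.2, hlast.1, hlast.2]

lemma aux_walk (A : Matrix ι ι ℝ) (m : ℕ) : ∀ (g : ι → ι → ℝ),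
    ∑ f : Fin (m + 1) → ι, (∏ i : Fin m, A (f i.castSucc) (f i.succ)) * g (f 0) (f (Fin.last m))
      = ∑ x, ∑ y, (A ^ m) x y * g x y := by
  induction m with
  | zero =>
    intro g
    rw [← (Equiv.funUnique (Fin 1) ι).symm.sum_comp]
    simp [Matrix.one_apply]
  | succ m ih =>
    intro g
    rw [← (Fin.consEquiv (fun _ => ι)).sum_comp, Fintype.sum_prod_type]
    refine sum_congr rfl fun x _ => ?_
    have := ih (fun y z => A x y * g x z)
    have e : ∀ f : Fin (m + 1) → ι, (∏ i : Fin (m + 1), A ((Fin.consEquiv (fun _ => ι)) (x, f) i.castSucc) ((Fin.consEquiv (fun _ => ι)) (x, f) i.succ)) * g ((Fin.consEquiv (fun _ => ι)) (x, f) 0) ((Fin.consEquiv (fun _ => ι)) (x, f) (Fin.last (m + 1))) = (∏ i : Fin m, A (f i.castSucc) (f i.succ)) * (A x (f 0) * g x (f (Fin.last m))) := by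
      intro f
      rw [Fin.prod_univ_succ]
      simp [Fin.consEquiv, ← Fin.succ_last]
      ring
    rw [sum_congr rfl fun f _ => e f, this, sum_comm]
    refine sum_congr rfl fun z _ => ?_
    rw [pow_succ', Matrix.mul_apply, sum_mul]
    refine sum_congr rfl fun y _ => ?_
    ring

lemma aux_cyc (A : Matrix ι ι ℝ) (n : ℕ) (hn : 0 < n) :
    ∑ f : Fin n → ι, ∏ i : Fin n, A (f i) (f ⟨(i.val + 1) % n, Nat.mod_lt _ i.pos⟩)
      = (A ^ n).trace := by
  obtain ⟨m, rfl⟩ : ∃ m, n = m + 1 := ⟨n - 1, by omega⟩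
  have := aux_walk A m (fun x y => A y x)
  rw [pow_succ, Matrix.trace]
  simp only [Matrix.diag_apply, Matrix.mul_apply]
  rw [← this]
  refine sum_congr rfl fun f _ => ?_
  rw [Fin.prod_univ_castSucc]
  congr 1
  · refine prod_congr rfl fun i _ => ?_
    congr 2
    ext
    simp [Nat.mod_eq_of_lt]
  · congr 2
    ext
    simp
end

section
variable {F : Type} [Field F] [Fintype F] [DecidableEq F] {d : ℕ}

lemma cnt_one (y : Fin d → F) (hy : y ≠ 0) (t : F) :
    (∑ x : Fin d → F, if x ⬝ᵥ y = t then (1 : ℝ) else 0) =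
      (Fintype.card F : ℝ) ^ d / (Fintype.card F : ℝ) ^ 2 * Fintype.card F := by
  have hq : (Fintype.card F : ℝ) ≠ 0 := by simp
  obtain ⟨i, hi⟩ : ∃ i, y i ≠ 0 := by
    by_contra h; push Not at h; exact hy (funext h)
  have key : ∀ s, (∑ x : Fin d → F, if x ⬝ᵥ y = s then (1 : ℝ) else 0) =
      (∑ x : Fin d → F, if x ⬝ᵥ y = t then (1 : ℝ) else 0) := by
    intro s
    rw [← Equiv.sum_comp (Equiv.addRight (Pi.single i ((s - t) / y i)))]
    refine sum_congr rfl fun x _ => ?_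
    have : (x + Pi.single i ((s - t) / y i)) ⬝ᵥ y = x ⬝ᵥ y + (s - t) := by
      rw [add_dotProduct, single_dotProduct]; field_simp
    simp only [Equiv.coe_addRight, this]
    congr 1
    apply propext
    constructor <;> intro h <;> linear_combination h
  have tot : ∑ s : F, (∑ x : Fin d → F, if x ⬝ᵥ y = s then (1 : ℝ) else 0) =
      (Fintype.card F : ℝ) ^ d := by
    rw [sum_comm]; simp
  rw [sum_congr rfl fun s _ => key s, sum_const, card_univ, nsmul_eq_mul] at tot
  field_simp
  linear_combination tot

lemma cnt_two (y z : Fin d → F) (hy : y ≠ 0) (hz : ∀ c : F, z ≠ c • y) (t : F) :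
    (∑ x : Fin d → F, if x ⬝ᵥ y = t ∧ x ⬝ᵥ z = t then (1 : ℝ) else 0) =
      (Fintype.card F : ℝ) ^ d / (Fintype.card F : ℝ) ^ 2 := by
  have hq : (Fintype.card F : ℝ) ≠ 0 := by simp
  obtain ⟨i, hi⟩ : ∃ i, y i ≠ 0 := by
    by_contra h; push Not at h; exact hy (funext h)
  obtain ⟨j, hj⟩ : ∃ j, y i * z j - y j * z i ≠ 0 := by
    by_contra h; push Not at h
    apply hz (z i / y i)
    ext j
    have := h j
    simp only [Pi.smul_apply, smul_eq_mul]
    field_simp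
    linear_combination this
  have key : ∀ p : F × F, (∑ x : Fin d → F, if x ⬝ᵥ y = p.1 ∧ x ⬝ᵥ z = p.2 then (1 : ℝ) else 0) =
      (∑ x : Fin d → F, if x ⬝ᵥ y = t ∧ x ⬝ᵥ z = t then (1 : ℝ) else 0) := by
    rintro ⟨r, s⟩
    obtain ⟨D, hD⟩ : ∃ D, D = y i * z j - y j * z i := ⟨_, rfl⟩
    have hD0 : D ≠ 0 := hD ▸ hj
    obtain ⟨v, hv1, hv2⟩ : ∃ v : Fin d → F, v ⬝ᵥ y = r - t ∧ v ⬝ᵥ z = s - t := by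
      refine ⟨Pi.single i (((r - t) * z j - (s - t) * y j) / D) +
        Pi.single j (((s - t) * y i - (r - t) * z i) / D), ?_, ?_⟩
      · rw [add_dotProduct, single_dotProduct, single_dotProduct]; field_simp; rw [hD]; ring
      · rw [add_dotProduct, single_dotProduct, single_dotProduct]; field_simp; rw [hD]; ring
    rw [← Equiv.sum_comp (Equiv.addRight v)]
    refine sum_congr rfl fun x _ => ?_
    simp only [Equiv.coe_addRight, add_dotProduct, hv1, hv2]
    congr 1
    apply propext
    constructor <;> rintro ⟨h1, h2⟩ <;> constructor
    · linear_combination h1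
    · linear_combination h2
    · linear_combination h1
    · linear_combination h2
  have tot : ∑ p : F × F, (∑ x : Fin d → F, if x ⬝ᵥ y = p.1 ∧ x ⬝ᵥ z = p.2 then (1 : ℝ) else 0) =
      (Fintype.card F : ℝ) ^ d := by
    rw [sum_comm]
    have : ∀ x : Fin d → F, ∑ p : F × F, (if x ⬝ᵥ y = p.1 ∧ x ⬝ᵥ z = p.2 then (1 : ℝ) else 0) = 1 := by
      intro x
      rw [← sum_filter, sum_const]
      have : (univ.filter fun p : F × F => x ⬝ᵥ y = p.1 ∧ x ⬝ᵥ z = p.2) = {(x ⬝ᵥ y, x ⬝ᵥ z)} := by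
        ext p; simp [Prod.ext_iff, eq_comm]
      rw [this]; simp
    rw [sum_congr rfl fun x _ => this x]; simp
  rw [sum_congr rfl fun s _ => key s, sum_const, card_univ, nsmul_eq_mul, Fintype.card_prod] at tot
  push_cast at tot
  field_simp
  linear_combination tot

/-- the centred kernel -/
noncomputable def ker0 (t : F) (x y : Fin d → F) : ℝ :=
  (if x ⬝ᵥ y = t then (1 : ℝ) else 0) - 1 / Fintype.card F

lemma ker_form (t : F) (ht : t ≠ 0) (y z : Fin d → F) :
    ∑ x, ker0 t x y * ker0 t x z =
      (Fintype.card F : ℝ) ^ d / (Fintype.card F : ℝ) ^ 2 *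
      ((Fintype.card F : ℝ) * (if y = z then 1 else 0)
        - (if (Quotient.mk (MulAction.orbitRel Fˣ (Fin d → F)) y) = Quotient.mk _ z then 1 else 0)
        - ((Fintype.card F : ℝ) - 2) * ((if y = 0 then 1 else 0) * (if z = 0 then 1 else 0))) := by
  have hq : (Fintype.card F : ℝ) ≠ 0 := by simp
  set q : ℝ := (Fintype.card F : ℝ) with hqd
  set P : ℝ := q ^ d / q ^ 2 with hP
  have e : ∑ x, ker0 t x y * ker0 t x z =
      (∑ x : Fin d → F, if x ⬝ᵥ y = t ∧ x ⬝ᵥ z = t then (1 : ℝ) else 0)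
      - 1 / q * (∑ x : Fin d → F, if x ⬝ᵥ y = t then (1 : ℝ) else 0)
      - 1 / q * (∑ x : Fin d → F, if x ⬝ᵥ z = t then (1 : ℝ) else 0) + P := by
    have : P = ∑ x : Fin d → F, 1 / q * (1 / q) := by
      simp [hP, hqd]; field_simp
    rw [this, mul_sum, mul_sum, ← sum_sub_distrib, ← sum_sub_distrib, ← sum_add_distrib]
    refine sum_congr rfl fun x _ => ?_
    simp only [ker0, ← hqd]
    by_cases h1 : x ⬝ᵥ y = t <;> by_cases h2 : x ⬝ᵥ z = t <;> simp [h1, h2] <;> ring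
  have c0 : (∑ x : Fin d → F, if x ⬝ᵥ (0 : Fin d → F) = t then (1 : ℝ) else 0) = 0 := by
    simp [ht.symm]
  have hor : (Quotient.mk (MulAction.orbitRel Fˣ (Fin d → F)) y) = Quotient.mk _ z ↔
      ∃ c : Fˣ, c • z = y := by
    rw [Quotient.eq]; exact Iff.rfl
  rw [e]
  by_cases hy : y = 0
  · by_cases hz : z = 0
    · subst hy hz
      simp [ht.symm]; ring
    · subst hy
      have h1 := cnt_one z hz t
      rw [← hqd, ← hP] at h1
      have h2 : ¬ ((Quotient.mk (MulAction.orbitRel Fˣ (Fin d → F)) 0) = Quotient.mk _ z) := by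
        rw [hor]; rintro ⟨c, hc⟩
        exact hz ((smul_eq_zero_iff_eq c).1 hc)
      rw [h1]
      simp [ht.symm, h2, hz, Ne.symm hz]
      field_simp; ring
  · have h1 := cnt_one y hy t
    rw [← hqd, ← hP] at h1
    by_cases hz : z = 0
    · subst hz
      have h2 : ¬ ((Quotient.mk (MulAction.orbitRel Fˣ (Fin d → F)) y) = Quotient.mk _ 0) := by
        rw [hor]; rintro ⟨c, hc⟩
        exact hy (by rw [← hc]; simp)
      rw [h1]
      simp [ht.symm, h2, hy]
      field_simp; ring
    · have h1' := cnt_one z hz t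
      rw [← hqd, ← hP] at h1'
      rw [h1, h1']
      by_cases hyz : y = z
      · subst hyz
        simp only [and_self, h1]
        simp [hy]
        field_simp; ring
      by_cases hp : ∃ c : Fˣ, c • z = y
      · have h3 : ∀ x : Fin d → F, ¬ (x ⬝ᵥ y = t ∧ x ⬝ᵥ z = t) := by
          rintro x ⟨hx1, hx2⟩
          obtain ⟨c, rfl⟩ := hp
          apply hyz
          have : (c : F) * t = t := by
            rw [← hx2, ← smul_eq_mul, ← dotProduct_smul]
            rw [← Units.smul_def, hx1, hx2]
          have : (c : F) = 1 := by simpa [ht] using this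
          rw [Units.val_eq_one] at this
          simp [this]
        rw [sum_congr rfl fun x _ => if_neg (h3 x)]
        rw [if_pos (hor.2 hp)]
        simp [hy, hyz]
        field_simp; ring
      · have hz' : ∀ c : F, y ≠ c • z := by
          intro c hc
          by_cases hc0 : c = 0
          · subst hc0; simp at hc; exact hy hc
          · exact hp ⟨Units.mk0 c hc0, by rw [hc]; rfl⟩
        have h3 := cnt_two z y hz hz' t
        rw [← hqd, ← hP] at h3
        simp only [and_comm] at h3
        have h4 : ¬ ((Quotient.mk (MulAction.orbitRel Fˣ (Fin d → F)) y) = Quotient.mk _ z) := by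
          rwa [hor]
        rw [h3, if_neg h4]
        simp [hy, hyz]
        field_simp; ring

lemma class_nonneg {V W : Type} [Fintype V] [Fintype W] (φ : V → W) (g : V → ℝ) :
    0 ≤ ∑ y, ∑ z, (if φ y = φ z then (1 : ℝ) else 0) * (g y * g z) := by
  have : ∑ y, ∑ z, (if φ y = φ z then (1 : ℝ) else 0) * (g y * g z)
      = ∑ w, (∑ y, if φ y = w then g y else 0) ^ 2 := by
    simp_rw [pow_two, sum_mul_sum]
    rw [sum_comm (s := (univ : Finset W))]
    refine sum_congr rfl fun y _ => ?_
    rw [sum_comm (s := (univ : Finset W))]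
    refine sum_congr rfl fun z _ => ?_
    rw [sum_eq_single (φ y)]
    · simp [eq_comm]
    · intro w _ hw
      simp [hw.symm]
    · simp
  rw [this]
  positivity

lemma ker_bound (t : F) (ht : t ≠ 0) (g : (Fin d → F) → ℝ) :
    ∑ x, (∑ y, ker0 t x y * g y) ^ 2 ≤
      (Fintype.card F : ℝ) ^ d / (Fintype.card F : ℝ) * ∑ y, g y ^ 2 := by
  have hq : (Fintype.card F : ℝ) ≠ 0 := by simp
  have hq2 : (2 : ℝ) ≤ Fintype.card F := by
    have : 1 < Fintype.card F := Fintype.one_lt_card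
    exact_mod_cast this
  have e : ∑ x, (∑ y, ker0 t x y * g y) ^ 2 =
      ∑ y, ∑ z, (∑ x, ker0 t x y * ker0 t x z) * (g y * g z) := by
    simp_rw [pow_two, sum_mul_sum]
    rw [sum_comm]
    refine sum_congr rfl fun y _ => ?_
    rw [sum_comm]
    refine sum_congr rfl fun z _ => ?_
    rw [sum_mul]
    refine sum_congr rfl fun x _ => ?_
    ring
  rw [e]
  simp_rw [ker_form t ht]
  set q : ℝ := (Fintype.card F : ℝ) with hqd
  set P : ℝ := q ^ d / q ^ 2 with hP
  have hP0 : 0 ≤ P := by positivity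
  have h1 : 0 ≤ ∑ y, ∑ z, (if (Quotient.mk (MulAction.orbitRel Fˣ (Fin d → F)) y) = Quotient.mk _ z then (1 : ℝ) else 0) * (g y * g z) := by
    convert class_nonneg (Quotient.mk (MulAction.orbitRel Fˣ (Fin d → F))) g
  have e2 : ∑ y, ∑ z, (P *
      (q * (if y = z then 1 else 0)
        - (if (Quotient.mk (MulAction.orbitRel Fˣ (Fin d → F)) y) = Quotient.mk _ z then 1 else 0)
        - (q - 2) * ((if y = 0 then 1 else 0) * (if z = 0 then 1 else 0)))) * (g y * g z)
      = P * q * (∑ y, ∑ z, (if y = z then 1 else 0) * (g y * g z))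
       - P * (∑ y, ∑ z, (if (Quotient.mk (MulAction.orbitRel Fˣ (Fin d → F)) y) = Quotient.mk _ z then (1 : ℝ) else 0) * (g y * g z))
       - P * (q - 2) * (∑ y, ∑ z, ((if y = 0 then 1 else 0) * (if z = 0 then 1 else 0)) * (g y * g z)) := by
    simp_rw [mul_sum, ← sum_sub_distrib]
    refine sum_congr rfl fun y _ => sum_congr rfl fun z _ => ?_
    ring
  rw [e2]
  have e3 : (∑ y, ∑ z, (if y = z then (1 : ℝ) else 0) * (g y * g z)) = ∑ y, g y ^ 2 := by
    simp [pow_two]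
  have e4 : (∑ y : Fin d → F, ∑ z : Fin d → F, ((if y = 0 then (1 : ℝ) else 0) * (if z = 0 then 1 else 0)) * (g y * g z)) = g 0 ^ 2 := by
    rw [pow_two]
    rw [Finset.sum_eq_single 0, Finset.sum_eq_single 0] <;> simp +contextual
  rw [e3, e4]
  have e5 : P * q = q ^ d / q := by rw [hP]; field_simp
  rw [← e5]
  have := mul_nonneg hP0 h1
  have : 0 ≤ P * (q - 2) * g 0 ^ 2 := by
    have : 0 ≤ q - 2 := by linarith
    positivity
  linarith
end

section
open scoped Matrix.Norms.L2Operator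
open Matrix

lemma count_bound {F : Type} [Field F] [Fintype F] [DecidableEq F] (d m : ℕ) (t : F) (ht : t ≠ 0)
    (E : Finset (Fin d → F)) (q N l : ℝ) (hq : q = Fintype.card F) (hN : N = E.card)
    (hl0 : 0 ≤ l) (hl : l ^ 2 = q ^ d / q) :
    |(cycleCountProd F d (m + 2) t E : ℝ) - (N / q) ^ (m + 2)| ≤
      l ^ m * (l * N + N ^ 2 / q + N ^ 2 / q ^ 2) + ((N / q + l) ^ (m + 2) - (N / q) ^ (m + 2)) := by
  have hq0 : 0 < q := by rw [hq]; exact_mod_cast Fintype.card_pos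
  set u : (Fin d → F) → ℝ := fun x => if x ∈ E then 1 else 0 with hu
  have huu : ∀ x, u x * u x = u x := fun x => by simp [hu]
  have hu0 : ∀ x, 0 ≤ u x := fun x => by simp only [hu]; split_ifs <;> simp
  have hu1 : ∀ x, u x ≤ 1 := fun x => by simp only [hu]; split_ifs <;> simp
  have hsu : ∑ x, u x = N := by simp [hu, hN]
  set R : Matrix (Fin d → F) (Fin d → F) ℝ := Matrix.of fun x y => u x * u y * ker0 t x y with hRd
  have hRa : ∀ x y, R x y = u x * u y * ker0 t x y := fun x y => rfl
  have hRT : Rᵀ = R := by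
    ext x y
    rw [transpose_apply, hRa, hRa]
    simp only [ker0, dotProduct_comm y x]
    ring
  have hnorm : ‖R‖ ≤ l := by
    apply aux_norm_le _ _ hl0
    intro w
    have h1 := ker_bound t ht (fun y => u y * w y)
    rw [← hq, ← hl] at h1
    refine le_trans (sum_le_sum fun x _ => ?_) (h1.trans ?_)
    · have : ∑ y, R x y * w y = u x * ∑ y, ker0 t x y * (u y * w y) := by
        rw [mul_sum]; refine sum_congr rfl fun y _ => ?_
        rw [hRa]; ring
      rw [this, mul_pow]
      have : u x ^ 2 ≤ 1 := by rw [pow_two, huu]; exact hu1 x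
      nlinarith [sq_nonneg (∑ y, ker0 t x y * (u y * w y))]
    · refine mul_le_mul_of_nonneg_left (sum_le_sum fun y _ => ?_) (sq_nonneg l)
      have : u y ^ 2 ≤ 1 := by rw [pow_two, huu]; exact hu1 y
      rw [mul_pow]
      nlinarith [sq_nonneg (w y)]
  have hun : u ⬝ᵥ u = N := by simp only [dotProduct, huu, hsu]
  have hN0 : 0 ≤ N := by rw [hN]; positivity
  have hmain := aux_main R hRT u (1 / q) l N (by positivity) hnorm hun m
  have hA : ∀ x y, ((1 / q) • vecMulVec u u + R) x y
      = u x * u y * (if x ⬝ᵥ y = t then 1 else 0) := by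
    intro x y
    simp only [Matrix.add_apply, Matrix.smul_apply, vecMulVec_apply, hRa, ker0, ← hq, smul_eq_mul]
    ring
  have hcount : (((1 / q) • vecMulVec u u + R) ^ (m + 2)).trace
      = (cycleCountProd F d (m + 2) t E : ℝ) := by
    rw [← aux_cyc _ _ (by omega), cycleCountProd, Finset.card_filter]
    push_cast
    refine sum_congr rfl fun f _ => ?_
    simp only [hA]
    by_cases h1 : ∀ i, f i ∈ E
    · by_cases h2 : ∀ i : Fin (m + 2), ∑ j, f i j * f ⟨(i.val + 1) % (m + 2), Nat.mod_lt _ i.pos⟩ j = t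
      · rw [if_pos ⟨h1, h2⟩]
        refine prod_eq_one fun i _ => ?_
        have := h2 i
        simp [hu, h1, dotProduct, this]
      · rw [if_neg (fun h => h2 h.2)]
        push Not at h2
        obtain ⟨i, hi⟩ := h2
        refine prod_eq_zero (mem_univ i) ?_
        simp [dotProduct, hi]
    · rw [if_neg (fun h => h1 h.1)]
      push Not at h1
      obtain ⟨i, hi⟩ := h1
      refine prod_eq_zero (mem_univ i) ?_
      simp [hu, hi]
  have hS : ∑ x, ∑ y, R x y ^ 2 ≤ l * N + N ^ 2 / q + N ^ 2 / q ^ 2 := by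
    have h1 := aux_bil R u u
    rw [hun, Real.mul_self_sqrt hN0] at h1
    have h2 : u ⬝ᵥ (R *ᵥ u) ≤ l * N :=
      (le_abs_self _).trans (h1.trans (by gcongr))
    have h3 : u ⬝ᵥ (R *ᵥ u) = ∑ x, ∑ y, R x y := by
      simp only [dotProduct, mulVec]
      refine sum_congr rfl fun x _ => ?_
      rw [mul_sum]
      refine sum_congr rfl fun y _ => ?_
      rw [hRa]
      linear_combination (ker0 t x y * u x * u x) * huu y + (ker0 t x y * u y) * huu x
    have h4 : ∑ x, ∑ y, u x * u y = N ^ 2 := by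
      rw [← sum_mul_sum, hsu, pow_two]
    calc ∑ x, ∑ y, R x y ^ 2 ≤ ∑ x, ∑ y, (R x y + (1 / q) * (u x * u y) + (1 / q ^ 2) * (u x * u y)) := by
          refine sum_le_sum fun x _ => sum_le_sum fun y _ => ?_
          have e : R x y ^ 2 = u x * u y * ker0 t x y ^ 2 := by
            rw [hRa]
            linear_combination (ker0 t x y ^ 2 * u x * u x) * huu y + (ker0 t x y ^ 2 * u y) * huu x
          rw [e, hRa]
          have hp : 0 ≤ u x * u y := mul_nonneg (hu0 x) (hu0 y)
          have : ker0 t x y ^ 2 ≤ ker0 t x y + 1 / q + 1 / q ^ 2 := by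
            simp only [ker0, ← hq]
            have : 0 < 1 / q := by positivity
            have e2 : 1 / q ^ 2 = (1 / q) ^ 2 := by simp
            rw [e2]
            split_ifs <;> nlinarith
          nlinarith [mul_le_mul_of_nonneg_left this hp]
      _ = u ⬝ᵥ (R *ᵥ u) + (1 / q) * N ^ 2 + (1 / q ^ 2) * N ^ 2 := by
          rw [h3, ← h4]
          simp only [sum_add_distrib, mul_sum]
      _ ≤ _ := by
          have e1 : (1 / q) * N ^ 2 = N ^ 2 / q := by ring
          have e2 : (1 / q ^ 2) * N ^ 2 = N ^ 2 / q ^ 2 := by ring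
          rw [e1, e2]; linarith
  rw [hcount] at hmain
  have e : 1 / q * N = N / q := by ring
  rw [e] at hmain
  refine hmain.trans ?_
  gcongr
end

lemma num_one (n : ℕ) (ε : ℝ) (h0 : 0 ≤ ε) (h1 : n * ε ≤ 1) : (1 + ε) ^ n ≤ 1 + 2 * (n * ε) := by
  have h2 : (1 + ε) ^ n ≤ Real.exp (n * ε) := by
    rw [Real.exp_nat_mul]
    gcongr
    linarith [Real.add_one_le_exp ε]
  have h3 := Real.abs_exp_sub_one_le (x := n * ε) (by rw [abs_of_nonneg (by positivity)]; exact h1)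
  rw [abs_of_nonneg (a := (n : ℝ) * ε) (by positivity)] at h3
  linarith [(abs_le.1 h3).2]

set_option maxHeartbeats 1000000 in
theorem cycle_count_prod_long (d n : ℕ) (hd : 2 ≤ d) (hn : 5 ≤ n) (δ : ℝ)
    (hδ0 : 0 < δ) (hδ1 : δ < 1 / (2 * ((n / 2 : ℕ) : ℝ) ^ 2)) :
    ∃ Q : ℕ, ∀ (F : Type) [Field F] [Fintype F] [DecidableEq F],
      Q ≤ Fintype.card F → ∀ t : F, t ≠ 0 → ∀ E : Finset (Fin d → F),
      (Fintype.card F : ℝ) ^ ((1 / 2 : ℝ) * ((d : ℝ) + 2 -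
          (if n % 2 = 0 then (((n / 2 : ℕ) : ℝ) - 2) / (((n / 2 : ℕ) : ℝ) - 1)
           else (2 * ((n / 2 : ℕ) : ℝ) - 3) / (2 * ((n / 2 : ℕ) : ℝ) - 1)) + δ)) ≤
        (E.card : ℝ) →
      |(cycleCountProd F d n t E : ℝ) - (E.card : ℝ) ^ n / (Fintype.card F : ℝ) ^ n| ≤
        (36 + 80 * (6 : ℝ) ^ (n / 2 - 2) + 12 * ((n / 2 : ℕ) : ℝ)) *
          ((E.card : ℝ) ^ n / (Fintype.card F : ℝ) ^ n) *
          (Fintype.card F : ℝ) ^ (-(((n : ℝ) / 2 - 1) * δ)) := by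
  obtain ⟨m, rfl⟩ : ∃ m, n = m + 2 := ⟨n - 2, by omega⟩
  refine ⟨(m + 2) ^ m, ?_⟩
  intro F _ _ _ hQ t ht E hE
  have hm3 : (3 : ℝ) ≤ m := by exact_mod_cast (by omega : 3 ≤ m)
  obtain ⟨k, hk⟩ : ∃ k, k = (m + 2) / 2 := ⟨_, rfl⟩
  rw [← hk] at hE hδ1 ⊢
  have hk2 : (2 : ℝ) ≤ k := by exact_mod_cast (by omega : 2 ≤ k)
  have hmk : (m : ℝ) + 1 ≤ 2 * k := by exact_mod_cast (by omega : m + 1 ≤ 2 * k)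
  have hexp : (1 / 2 : ℝ) * ((d : ℝ) + 2 -
          (if (m + 2) % 2 = 0 then ((k : ℝ) - 2) / ((k : ℝ) - 1)
           else (2 * (k : ℝ) - 3) / (2 * (k : ℝ) - 1)) + δ) = ((d : ℝ) + 1) / 2 + (1 / m + δ / 2) := by
    split_ifs with h
    · have : (m : ℝ) = 2 * (k - 1) := by
        have : m + 2 = 2 * k := by omega
        have : (m : ℝ) + 2 = 2 * k := by exact_mod_cast this
        linarith
      have h1 : (k : ℝ) - 1 ≠ 0 := by linarith
      rw [this]; field_simp; ring
    · have : (m : ℝ) = 2 * k - 1 := by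
        have : m + 1 = 2 * k := by omega
        have : (m : ℝ) + 1 = 2 * k := by exact_mod_cast this
        linarith
      have h1 : 2 * (k : ℝ) - 1 ≠ 0 := by linarith
      rw [this]; field_simp; ring
  rw [hexp] at hE
  obtain ⟨q, hq⟩ : ∃ q : ℝ, q = Fintype.card F := ⟨_, rfl⟩
  obtain ⟨N, hN⟩ : ∃ N : ℝ, N = E.card := ⟨_, rfl⟩
  have hq1 : 1 < q := by
    rw [hq]; exact_mod_cast Fintype.one_lt_card
  have hq0 : 0 < q := by linarith
  have hQ' : ((m : ℝ) + 2) ^ m ≤ q := by rw [hq]; exact_mod_cast hQ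
  set l : ℝ := q ^ (((d : ℝ) - 1) / 2) with hl
  have hl0 : 0 < l := by positivity
  have hl2 : l ^ 2 = q ^ d / q := by
    rw [hl, ← Real.rpow_natCast, ← Real.rpow_mul hq0.le, ← Real.rpow_natCast q d]
    nth_rewrite 3 [← Real.rpow_one q]
    rw [← Real.rpow_sub hq0]
    congr 1; push_cast; ring
  have hb := count_bound d m t ht E q N l hq hN hl0.le hl2
  rw [← hq, ← hN] at hE ⊢
  have hN0 : 0 < N := lt_of_lt_of_le (by positivity) hE
  set a := N / q with ha
  have ha0 : 0 < a := by positivity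
  rw [← div_pow, ← ha]
  obtain ⟨ε, hε⟩ : ∃ ε, ε = l / a := ⟨_, rfl⟩
  have hε0 : 0 < ε := by rw [hε]; positivity
  have hla : l = ε * a := by rw [hε]; field_simp
  have hε1 : ε ≤ q ^ (-(1 / (m : ℝ) + δ / 2)) := by
    rw [hε, ha, div_le_iff₀ ha0]
    calc l = q ^ (-(1 / (m : ℝ) + δ / 2)) * (q ^ (((d : ℝ) + 1) / 2 + (1 / m + δ / 2)) / q) := by
          nth_rewrite 3 [← Real.rpow_one q]
          rw [hl, ← Real.rpow_sub hq0, ← Real.rpow_add hq0]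
          congr 1; ring
      _ ≤ q ^ (-(1 / (m : ℝ) + δ / 2)) * (N / q) := by gcongr
  obtain ⟨η, hη⟩ : ∃ η : ℝ, η = q ^ (-((((m + 2 : ℕ) : ℝ) / 2 - 1) * δ)) := ⟨_, rfl⟩
  rw [← hη]
  have hη0 : 0 < η := by rw [hη]; positivity
  have hεη : ε ≤ η := by
    refine hε1.trans ?_
    rw [hη]
    apply Real.rpow_le_rpow_of_exponent_le hq1.le
    push_cast
    have h1 : (m : ℝ) * (m - 1) * δ ≤ 2 := by
      have h2 : δ * (2 * (k : ℝ) ^ 2) ≤ 1 := by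
        rw [lt_div_iff₀ (by positivity)] at hδ1; exact hδ1.le
      have h3 : (m : ℝ) * (m - 1) ≤ 2 * (2 * (k : ℝ) ^ 2) := by nlinarith
      nlinarith
    have h4 : ((m : ℝ) - 1) * δ / 2 ≤ 1 / m := by
      rw [le_div_iff₀ (by linarith)]; linarith
    linarith
  have hεm : ε ^ m * q ≤ η := by
    have h1 : ε ^ m ≤ (q ^ (-(1 / (m : ℝ) + δ / 2))) ^ m := by gcongr
    have h2 : (q ^ (-(1 / (m : ℝ) + δ / 2))) ^ m * q = η := by
      rw [← Real.rpow_natCast, ← Real.rpow_mul hq0.le]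
      nth_rewrite 2 [← Real.rpow_one q]
      rw [← Real.rpow_add hq0, hη]
      congr 1; push_cast; field_simp; ring
    rw [← h2]; gcongr
  have hεn : ((m + 2 : ℕ) : ℝ) * ε ≤ 1 := by
    have h1 : ε ≤ q ^ (-(1 / (m : ℝ))) := by
      refine hε1.trans (Real.rpow_le_rpow_of_exponent_le hq1.le (by linarith))
    have h2 : (m : ℝ) + 2 ≤ q ^ (1 / (m : ℝ)) := by
      calc (m : ℝ) + 2 = (((m : ℝ) + 2) ^ m) ^ (1 / (m : ℝ)) := by
            rw [one_div, Real.pow_rpow_inv_natCast (by positivity) (by omega)]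
        _ ≤ _ := by gcongr
    push_cast
    calc ((m : ℝ) + 2) * ε ≤ q ^ (1 / (m : ℝ)) * q ^ (-(1 / (m : ℝ))) := by gcongr
      _ = 1 := by rw [← Real.rpow_add hq0]; simp
  have hε_one : ε ≤ 1 := by
    push_cast at hεn; nlinarith
  have hone := num_one (m + 2) ε hε0.le hεn
  refine hb.trans ?_
  have hNa : N = a * q := by rw [ha]; field_simp
  have t1 : l ^ m * (l * N + N ^ 2 / q + N ^ 2 / q ^ 2) ≤ 3 * a ^ (m + 2) * η := by
    have h1 : l * N + N ^ 2 / q + N ^ 2 / q ^ 2 ≤ 3 * (a ^ 2 * q) := by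
      have e1 : N ^ 2 / q = a ^ 2 * q := by rw [hNa]; field_simp
      have e2 : N ^ 2 / q ^ 2 = a ^ 2 := by rw [hNa]; field_simp
      have e3 : l * N = ε * (a ^ 2 * q) := by rw [hla, hNa]; ring
      rw [e1, e2, e3]
      have : 0 < a ^ 2 := by positivity
      have h7 : 0 < a ^ 2 * q := by positivity
      have h8 := mul_le_mul_of_nonneg_right hε_one h7.le
      have h9 := mul_le_mul_of_nonneg_left hq1.le (sq_nonneg a)
      linarith
    calc _ ≤ l ^ m * (3 * (a ^ 2 * q)) := by gcongr
      _ = 3 * a ^ (m + 2) * (ε ^ m * q) := by rw [hla]; ring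
      _ ≤ _ := by gcongr
  have t2 : (a + l) ^ (m + 2) - a ^ (m + 2) ≤ a ^ (m + 2) * (2 * ((m + 2 : ℕ) * η)) := by
    have e : (a + l) ^ (m + 2) = a ^ (m + 2) * (1 + ε) ^ (m + 2) := by
      rw [← mul_pow, hla]; congr 1; ring
    rw [e]
    have h1 : (1 + ε) ^ (m + 2) - 1 ≤ 2 * ((m + 2 : ℕ) * η) := by
      have : ((m + 2 : ℕ) : ℝ) * ε ≤ (m + 2 : ℕ) * η := by gcongr
      linarith
    have h2 : 0 < a ^ (m + 2) := by positivity
    nlinarith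
  have h6 : (0 : ℝ) ≤ 80 * 6 ^ (k - 2) := by positivity
  have hX : 0 < a ^ (m + 2) * η := by positivity
  calc _ ≤ 3 * a ^ (m + 2) * η + a ^ (m + 2) * (2 * ((m + 2 : ℕ) * η)) := add_le_add t1 t2
    _ = (3 + 2 * ((m : ℝ) + 2)) * (a ^ (m + 2) * η) := by push_cast; ring
    _ ≤ (36 + 80 * (6 : ℝ) ^ (k - 2) + 12 * (k : ℝ)) * (a ^ (m + 2) * η) := by
        exact mul_le_mul_of_nonneg_right (by linarith) hX.le
    _ = _ := by ring
end

section
/- Let n ≥ 4 and let δ satisfy 0 < δ < 1/(2⌊n/2⌋²). Set K_4 = 48 and K_n = 36 + 80·6^{⌊n/2⌋-2} + 12⌊n/2⌋ for n ≥ 5, c_n = (n-1)^{n-3}·2^{C(n-1,2)-n+3} where C(n-1,2) = (n-1)(n-2)/2, and ε = 1 - (k-2)/(k-1) + δ if n = 2k is even, ε = 1 - (2k-3)/(2k-1) + δ if n = 2k+1 is odd. There exists Q, depending only on d, n and δ, such that for every q ≥ Q the following holds: if |E| ≥ q^{(1/2)(d+2-(k-2)/(k-1)+δ)} when n = 2k,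 and |E| ≥ q^{(1/2)(d+2-(2k-3)/(2k-1)+δ)} when n = 2k+1, then |N_n^prod(E) - |E|^n/q^n| ≤ (|E|^n/q^n)·(K_n q^{-(n/2-1)δ} + 2n q^{-2/(n-1)} + c_n q^{-(d-3)/2 - ε}). -/
open Finset
open scoped Classical

/-- The number of non-degenerate cycles of length `n` in the dot-product graph of `E`:
tuples `(x₀,…,x_{n-1}) ∈ Eⁿ` with pairwise distinct coordinates and
`x_i · x_{i+1} = t` cyclically, where `x·y = x₁y₁ + ⋯ + x_dy_d`. -/
noncomputable def nondegCycleCountProd (F : Type) [Field F] [Fintype F] [DecidableEq F]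
    (d n : ℕ) (t : F) (E : Finset (Fin d → F)) : ℕ :=
  (Finset.univ.filter (fun x : Fin n → (Fin d → F) =>
    (∀ i, x i ∈ E) ∧ Function.Injective x ∧
    ∀ i : Fin n, ∑ j, x i j * x ⟨(i.val + 1) % n, Nat.mod_lt _ i.pos⟩ j = t)).card


lemma ncp_card_hyper {F : Type} [Field F] [Fintype F] [DecidableEq F] {d : ℕ} (z : Fin d → F) (hz : z ≠ 0) :
    (∑ x : Fin d → F, if ∑ j, x j * z j = 0 then (1:ℝ) else 0) * (Fintype.card F : ℝ)
      = (Fintype.card F : ℝ) ^ d := by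
  obtain ⟨k, hk⟩ : ∃ k, z k ≠ 0 := by
    by_contra h; push Not at h; exact hz (funext h)
  have key : ∀ r : F, (∑ x : Fin d → F, if ∑ j, x j * z j = r then (1:ℝ) else 0)
      = ∑ x : Fin d → F, if ∑ j, x j * z j = 0 then (1:ℝ) else 0 := by
    intro r
    rw [← Equiv.sum_comp (Equiv.addRight (Pi.single k (r / z k) : Fin d → F))]
    apply Finset.sum_congr rfl
    intro x _
    have : ∑ j, (Equiv.addRight (Pi.single k (r / z k) : Fin d → F) x) j * z j
        = ∑ j, x j * z j + r := by
      simp [add_mul, Finset.sum_add_distrib, Pi.single_apply, hk]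
    rw [this]
    simp
  have h2 : ∑ r : F, (∑ x : Fin d → F, if ∑ j, x j * z j = r then (1:ℝ) else 0)
      = (Fintype.card F : ℝ) ^ d := by
    rw [Finset.sum_comm]
    simp
  rw [← h2, Finset.sum_congr rfl (fun r _ => key r)]
  simp [mul_comm]

lemma ncp_full_bound {F : Type} [Field F] [Fintype F] [DecidableEq F] {d : ℕ} (t : F) (ht : t ≠ 0)
    (f : (Fin d → F) → ℝ) :
    (Fintype.card F : ℝ) * ∑ x : Fin d → F, ((∑ y, if ∑ j, x j * y j = t then f y else 0)
        - (∑ y, f y) / (Fintype.card F : ℝ)) ^ 2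
      ≤ (Fintype.card F : ℝ) ^ d * ∑ y, f y ^ 2 := by
  set q : ℝ := (Fintype.card F : ℝ) with hq
  have hq1 : 1 < q := by
    rw [hq]; exact_mod_cast Fintype.one_lt_card
  set S := ∑ y, f y with hS
  let g : (Fin d → F) → F → ℝ := fun x r => ∑ y, if ∑ j, x j * y j = r then f y else 0
  have hgs : ∀ x, ∑ r, g x r = S := by
    intro x
    simp only [g]
    rw [Finset.sum_comm]
    simp [hS]
  have hg2 : ∀ x, ∑ r, g x r ^ 2
      = ∑ y, ∑ y', f y * f y' * (if ∑ j, x j * (y - y') j = 0 then 1 else 0) := by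
    intro x
    simp only [g, sq, Finset.sum_mul_sum]
    rw [Finset.sum_comm]
    refine Finset.sum_congr rfl fun y _ => ?_
    rw [Finset.sum_comm]
    refine Finset.sum_congr rfl fun y' _ => ?_
    have : (∑ j, x j * (y - y') j = 0) ↔ (∑ j, x j * y' j = ∑ j, x j * y j) := by
      simp only [Pi.sub_apply, mul_sub, Finset.sum_sub_distrib]
      rw [sub_eq_zero, eq_comm]
    simp only [this]
    simp only [ite_mul, zero_mul, Finset.sum_ite_eq, Finset.mem_univ, if_true]
    split_ifs <;> simp
  have hH : ∀ z : Fin d → F, q * (∑ x : Fin d → F, if ∑ j, x j * z j = 0 then (1:ℝ) else 0)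
      = q ^ d + if z = 0 then (q * q ^ d - q ^ d) else 0 := by
    intro z
    by_cases hz : z = 0
    · subst hz; simp [hq]
    · rw [mul_comm, ncp_card_hyper z hz]; simp [hz, hq]
  have htot : q * ∑ x, ∑ r, g x r ^ 2 = q ^ d * S ^ 2 + (q * q ^ d - q ^ d) * ∑ y, f y ^ 2 := by
    simp only [hg2]
    rw [Finset.sum_comm]
    have : ∀ y, ∑ x : Fin d → F, ∑ y', f y * f y' * (if ∑ j, x j * (y - y') j = 0 then (1:ℝ) else 0)
        = ∑ y', f y * f y' * (∑ x : Fin d → F, if ∑ j, x j * (y - y') j = 0 then (1:ℝ) else 0) := by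
      intro y
      rw [Finset.sum_comm]
      simp only [Finset.mul_sum]
    simp only [this]
    simp only [Finset.mul_sum]
    have h3 : ∀ y y', q * (f y * f y' * (∑ x : Fin d → F, if ∑ j, x j * (y - y') j = 0 then (1:ℝ) else 0))
       = q ^ d * (f y * f y') + if y = y' then (q * q ^ d - q ^ d) * (f y * f y') else 0 := by
      intro y y'
      have := hH (y - y')
      simp only [sub_eq_zero] at this
      rw [mul_left_comm, this]
      split_ifs <;> ring
    simp only [← Finset.mul_sum]
    simp only [Finset.mul_sum]
    simp only [← Finset.mul_sum]
    rw [Finset.mul_sum]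
    simp_rw [Finset.mul_sum _ _ q, h3]
    simp only [Finset.sum_add_distrib, Finset.sum_ite_eq, Finset.mem_univ, if_true]
    simp only [← Finset.mul_sum]
    rw [hS, sq, Finset.sum_mul_sum]
    simp only [← Finset.mul_sum, sq]
  have hvar : ∀ x, ∑ r, (g x r - S / q) ^ 2 = ∑ r, g x r ^ 2 - S ^ 2 / q := by
    intro x
    simp only [sub_sq, Finset.sum_add_distrib, Finset.sum_sub_distrib]
    rw [← Finset.sum_mul, ← Finset.mul_sum, hgs]
    simp only [Finset.sum_const, Finset.card_univ, nsmul_eq_mul, ← hq]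
    field_simp
    ring
  have hscale : ∀ r : F, r ≠ 0 → ∑ x, (g x r - S / q) ^ 2 = ∑ x, (g x t - S / q) ^ 2 := by
    intro r hr
    have hs : r / t ≠ 0 := div_ne_zero hr ht
    rw [← Equiv.sum_comp (MulAction.toPerm (Units.mk0 (r / t) hs) : Equiv.Perm (Fin d → F))]
    refine Finset.sum_congr rfl fun x _ => ?_
    have : g ((MulAction.toPerm (Units.mk0 (r / t) hs) : Equiv.Perm (Fin d → F)) x) r = g x t := by
      simp only [g]
      refine Finset.sum_congr rfl fun y _ => ?_
      have h1 : ∑ j, ((MulAction.toPerm (Units.mk0 (r / t) hs) : Equiv.Perm (Fin d → F)) x) j * y j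
          = (r / t) * ∑ j, x j * y j := by
        rw [Finset.mul_sum]
        refine Finset.sum_congr rfl fun j _ => ?_
        simp [Units.smul_def, mul_assoc]
      rw [h1]
      have h2 : (r / t) * ∑ j, x j * y j = r ↔ ∑ j, x j * y j = t := by
        constructor
        · intro h
          field_simp at h
          exact h
        · intro h; rw [h]; field_simp
      simp only [h2]
    rw [this]
  have hfin : (q - 1) * ∑ x, (g x t - S / q) ^ 2 ≤ ∑ r, ∑ x, (g x r - S / q) ^ 2 := by
    rw [← Finset.add_sum_erase _ _ (Finset.mem_univ (0:F))]
    rw [Finset.sum_congr rfl (fun r hr => hscale r (Finset.ne_of_mem_erase hr))]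
    rw [Finset.sum_const, Finset.card_erase_of_mem (Finset.mem_univ _), Finset.card_univ, nsmul_eq_mul,
      Nat.cast_sub Fintype.card_pos]
    have : 0 ≤ ∑ x, (g x 0 - S / q) ^ 2 := Finset.sum_nonneg fun _ _ => sq_nonneg _
    push_cast
    linarith
  rw [Finset.sum_comm] at hfin
  simp only [hvar, Finset.sum_sub_distrib] at hfin
  have hc : ∑ x : Fin d → F, S ^ 2 / q = q ^ d * (S ^ 2 / q) := by
    simp [hq]
  rw [hc] at hfin
  have h5 : q * ((q - 1) * ∑ x, (g x t - S / q) ^ 2) ≤ (q * q ^ d - q ^ d) * ∑ y, f y ^ 2 := by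
    have h6 := mul_le_mul_of_nonneg_left hfin (by linarith : 0 ≤ q)
    have h7 : q * (q ^ d * (S ^ 2 / q)) = q ^ d * S ^ 2 := by field_simp
    rw [mul_sub, htot, h7] at h6
    linarith
  have h8 : (q - 1) * (q * ∑ x, (g x t - S / q) ^ 2) ≤ (q - 1) * (q ^ d * ∑ y, f y ^ 2) := by
    linarith
  exact le_of_mul_le_mul_left h8 (by linarith)

lemma ncp_spectral {ι : Type} [Fintype ι] [DecidableEq ι] (A : Matrix ι ι ℝ)
    (hA : ∀ x y, A x y = A y x) :
    ∃ (μ : ι → ℝ) (v : ι → ι → ℝ),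
      (∀ i j, ∑ x, v i x * v j x = if i = j then 1 else 0) ∧
      (∀ x y, ∑ i, v i x * v i y = if x = y then 1 else 0) ∧
      (∀ (m : ℕ) x y, (A ^ m) x y = ∑ i, μ i ^ m * (v i x * v i y)) := by
  have hH : A.IsHermitian := by
    ext x y; simp [Matrix.conjTranspose_apply, hA x y]
  refine ⟨hH.eigenvalues, fun i x => (hH.eigenvectorUnitary : Matrix ι ι ℝ) x i, ?_, ?_, ?_⟩
  · intro i j
    have h := congrFun (congrFun (Unitary.coe_star_mul_self hH.eigenvectorUnitary) i) j
    rw [Matrix.mul_apply] at h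
    simpa [Matrix.one_apply, Matrix.star_apply] using h
  · intro i j
    have h := congrFun (congrFun (Unitary.coe_mul_star_self hH.eigenvectorUnitary) i) j
    rw [Matrix.mul_apply] at h
    simpa [Matrix.one_apply, Matrix.star_apply] using h
  · intro m x y
    conv_lhs => rw [hH.spectral_theorem, ← map_pow, Unitary.conjStarAlgAut_apply, Matrix.diagonal_pow]
    rw [Matrix.mul_apply]
    refine Finset.sum_congr rfl fun i _ => ?_
    rw [Matrix.mul_diagonal]
    simp [Matrix.star_apply]
    ring

lemma ncp_top {ι : Type} [Fintype ι] [DecidableEq ι] (A : Matrix ι ι ℝ) (u : ι → ℝ)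
    (q L : ℝ) (hq : 0 < q) (hL : 0 ≤ L)
    (hB : ∀ f : ι → ℝ, ∑ x, ((∑ y, A x y * f y) - (∑ y, u y * f y) / q * u x) ^ 2
      ≤ L ^ 2 * ∑ x, f x ^ 2)
    (N : ℝ) (hN : N = ∑ x, u x ^ 2) (hR : 2 * L < N / q)
    (μ : ι → ℝ) (v : ι → ι → ℝ)
    (h1 : ∀ i j, ∑ x, v i x * v j x = if i = j then 1 else 0)
    (h2 : ∀ x y, ∑ i, v i x * v i y = if x = y then 1 else 0)
    (h3 : ∀ x y, A x y = ∑ i, μ i * (v i x * v i y)) :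
    ∃ i0, |μ i0 - N / q| ≤ L ∧ ∀ i, i ≠ i0 → |μ i| ≤ L := by
  have hNp : 0 < N := by
    have : 0 < N / q := by linarith
    have h := mul_pos this hq
    rwa [div_mul_cancel₀ _ hq.ne'] at h
  have hev : ∀ i x, ∑ y, A x y * v i y = μ i * v i x := by
    intro i x
    simp only [h3, Finset.sum_mul]
    rw [Finset.sum_comm]
    have : ∀ j, ∑ y, μ j * (v j x * v j y) * v i y = μ j * v j x * if j = i then 1 else 0 := by
      intro j
      rw [← h1 j i, Finset.mul_sum]
      exact Finset.sum_congr rfl fun y _ => by ring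
    simp [this]
  have hform : ∀ f : ι → ℝ, |∑ x, f x * (∑ y, A x y * f y) - (∑ y, u y * f y) ^ 2 / q|
      ≤ L * ∑ x, f x ^ 2 := by
    intro f
    have e : ∑ x, f x * (∑ y, A x y * f y) - (∑ y, u y * f y) ^ 2 / q
        = ∑ x, f x * ((∑ y, A x y * f y) - (∑ y, u y * f y) / q * u x) := by
      simp only [mul_sub, Finset.sum_sub_distrib]
      congr 1
      have : ∀ x, f x * ((∑ y, u y * f y) / q * u x) = (∑ y, u y * f y) / q * (u x * f x) :=
        fun x => by ring
      simp only [this, ← Finset.mul_sum]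
      ring
    rw [e]
    have hs : 0 ≤ ∑ x, f x ^ 2 := Finset.sum_nonneg fun _ _ => sq_nonneg _
    apply abs_le_of_sq_le_sq _ (mul_nonneg hL hs)
    refine (Finset.sum_mul_sq_le_sq_mul_sq _ _ _).trans ?_
    have := mul_le_mul_of_nonneg_left (hB f) hs
    linarith
  have huniq : ∀ i j, i ≠ j → L < |μ i| → |μ j| ≤ L := by
    intro i j hij hi
    by_contra hj
    push Not at hj
    have hi2 : L ^ 2 < μ i ^ 2 := by
      rw [← sq_abs (μ i)]; exact pow_lt_pow_left₀ hi hL (by norm_num)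
    have hj2 : L ^ 2 < μ j ^ 2 := by
      rw [← sq_abs (μ j)]; exact pow_lt_pow_left₀ hj hL (by norm_num)
    have gen : ∀ a b : ℝ, a * (∑ y, u y * v i y) + b * (∑ y, u y * v j y) = 0 →
        μ i ^ 2 * a ^ 2 + μ j ^ 2 * b ^ 2 ≤ L ^ 2 * (a ^ 2 + b ^ 2) := by
      intro a b hab
      have hh := hB (fun x => a * v i x + b * v j x)
      have e1 : ∑ y, u y * (a * v i y + b * v j y) = 0 := by
        rw [← hab, Finset.mul_sum, Finset.mul_sum, ← Finset.sum_add_distrib]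
        exact Finset.sum_congr rfl fun y _ => by ring
      have e2 : ∀ x, ∑ y, A x y * (a * v i y + b * v j y) = (a * μ i) * v i x + (b * μ j) * v j x := by
        intro x
        have := hev i x
        have h' := hev j x
        calc _ = a * ∑ y, A x y * v i y + b * ∑ y, A x y * v j y := by
              rw [Finset.mul_sum, Finset.mul_sum, ← Finset.sum_add_distrib]
              exact Finset.sum_congr rfl fun y _ => by ring
          _ = _ := by rw [this, h']; ring
      have e3 : ∀ a b : ℝ, ∑ x, (a * v i x + b * v j x) ^ 2 = a ^ 2 + b ^ 2 := by
        intro a b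
        have : ∀ x, (a * v i x + b * v j x) ^ 2 = a ^ 2 * (v i x * v i x)
          + b ^ 2 * (v j x * v j x) + 2 * a * b * (v i x * v j x) := fun x => by ring
        simp only [this, Finset.sum_add_distrib, ← Finset.mul_sum, h1]
        simp [hij]
      simp only [e1, e2, zero_div, zero_mul, sub_zero, e3] at hh
      linarith
    by_cases hc : (∑ y, u y * v i y) = 0
    · have := gen 1 0 (by simp [hc])
      nlinarith
    · have := gen (∑ y, u y * v j y) (-(∑ y, u y * v i y)) (by ring)
      have hp : 0 < (∑ y, u y * v i y) ^ 2 := by positivity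
      have hp' : 0 ≤ (∑ y, u y * v j y) ^ 2 := by positivity
      nlinarith
  -- Rayleigh quotient
  have hcs : ∑ i, (∑ y, u y * v i y) ^ 2 = N := by
    rw [hN]
    simp only [sq, Finset.sum_mul_sum]
    rw [Finset.sum_comm]
    refine Finset.sum_congr rfl fun x _ => ?_
    rw [Finset.sum_comm]
    have : ∀ y, ∑ i, u x * v i x * (u y * v i y) = u x * u y * if x = y then 1 else 0 := by
      intro y
      rw [← h2 x y, Finset.mul_sum]
      exact Finset.sum_congr rfl fun y _ => by ring
    simp [this]
  have hray : ∑ i, μ i * (∑ y, u y * v i y) ^ 2 = ∑ x, u x * ∑ y, A x y * u y := by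
    simp only [h3, sq, Finset.sum_mul_sum, Finset.mul_sum, Finset.sum_mul]
    rw [Finset.sum_comm]
    refine Finset.sum_congr rfl fun x _ => ?_
    rw [Finset.sum_comm]
    refine Finset.sum_congr rfl fun y _ => ?_
    refine Finset.sum_congr rfl fun i _ => by ring
  have huu : ∑ y, u y * u y = N := by rw [hN]; exact Finset.sum_congr rfl fun y _ => by ring
  have hRl : (N / q - L) * N ≤ ∑ i, μ i * (∑ y, u y * v i y) ^ 2 := by
    rw [hray]
    have := (abs_le.1 (hform u)).1
    rw [huu, ← hN] at this
    have e : N ^ 2 / q = N / q * N := by ring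
    nlinarith
  obtain ⟨i0, hi0⟩ : ∃ i0, N / q - L ≤ μ i0 := by
    by_contra hcon
    push Not at hcon
    have : ∃ i, 0 < (∑ y, u y * v i y) ^ 2 := by
      by_contra hc
      push Not at hc
      have := Finset.sum_nonpos (fun i (_ : i ∈ Finset.univ) => hc i)
      linarith
    obtain ⟨i, hi⟩ := this
    have hlt : ∑ i, μ i * (∑ y, u y * v i y) ^ 2 < ∑ i, (N / q - L) * (∑ y, u y * v i y) ^ 2 := by
      apply Finset.sum_lt_sum
      · intro j _
        exact mul_le_mul_of_nonneg_right (hcon j).le (sq_nonneg _)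
      · exact ⟨i, Finset.mem_univ _, mul_lt_mul_of_pos_right (hcon i) hi⟩
    rw [← Finset.mul_sum, hcs] at hlt
    linarith
  have hpos : L < |μ i0| := lt_of_lt_of_le (by linarith) (le_abs_self _)
  refine ⟨i0, ?_, fun i hi => huniq i0 i (Ne.symm hi) hpos⟩
  rw [abs_le]
  refine ⟨by linarith, ?_⟩
  have hf := (abs_le.1 (hform (v i0))).2
  simp only [hev] at hf
  have hv1 : ∑ x, v i0 x ^ 2 = 1 := by
    have := h1 i0 i0
    simp only [if_true] at this
    rw [← this]; exact Finset.sum_congr rfl fun y _ => by ring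
  have e1 : ∑ x, v i0 x * (μ i0 * v i0 x) = μ i0 := by
    have : ∀ x, v i0 x * (μ i0 * v i0 x) = μ i0 * v i0 x ^ 2 := fun x => by ring
    simp only [this, ← Finset.mul_sum, hv1, mul_one]
  have hcs2 : (∑ y, u y * v i0 y) ^ 2 ≤ N := by
    have := Finset.sum_mul_sq_le_sq_mul_sq Finset.univ u (v i0)
    rw [hv1, ← hN] at this
    linarith
  have := div_le_div_of_nonneg_right hcs2 hq.le
  rw [e1, hv1] at hf
  linarith

lemma ncp_abstract {ι : Type} [Fintype ι] [DecidableEq ι] (A : Matrix ι ι ℝ) (u : ι → ℝ)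
    (hA : ∀ x y, A x y = A y x) (h01 : ∀ x y, A x y * A x y = A x y)
    (huA : ∀ x y, A x y * u y = A x y) (hu : ∀ x, u x ^ 2 = u x)
    (q L : ℝ) (hq : 0 < q) (hL : 1 ≤ L)
    (hB : ∀ f : ι → ℝ, ∑ x, ((∑ y, A x y * f y) - (∑ y, u y * f y) / q * u x) ^ 2
      ≤ L ^ 2 * ∑ x, f x ^ 2)
    (N : ℝ) (hN : N = ∑ x, u x ^ 2) (hNL : N ≤ L ^ 2 * q ^ 2)
    (R : ℝ) (hRdef : R = N / q) (hR : 2 * L < R) :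
    (∀ n : ℕ, 2 ≤ n → |∑ x, (A ^ n) x x - R ^ n| ≤
        n * L * (2 * R) ^ (n - 1) + 2 * (L ^ (n - 2) * N * R)) ∧
    (∀ a b : ℕ, 1 ≤ a → 1 ≤ b → 4 ≤ a + b → ∑ x, (A ^ a) x x * (A ^ b) x x ≤
        12 * L * (2 * R) ^ (a + b - 1) + 4 * (L ^ (a + b - 4) * N * R ^ 2)
          + 2 * (L ^ (a + b - 3) * N * R)) := by
  have hL0 : 0 ≤ L := by linarith
  have hRp : 0 < R := by linarith
  have hNp : 0 < N := by
    have := mul_pos hRp hq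
    rwa [hRdef, div_mul_cancel₀ _ hq.ne'] at this
  obtain ⟨μ, v, h1, h2, h3⟩ := ncp_spectral A hA
  obtain ⟨i0, hi0, hoth⟩ := ncp_top A u q L hq hL0 hB N hN (by rw [← hRdef]; exact hR) μ v h1 h2
    (fun x y => by simpa using h3 1 x y)
  rw [← hRdef] at hi0
  have hμ1 : μ i0 ≤ 2 * R := by have := (abs_le.1 hi0).2; linarith
  have hμ0 : 0 < μ i0 := by have := (abs_le.1 hi0).1; linarith
  set deg : ι → ℝ := fun x => (A ^ 2) x x with hdeg
  have hA0 : ∀ x y, 0 ≤ A x y := fun x y => by rw [← h01]; exact mul_self_nonneg _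
  have hA1 : ∀ x y, A x y ≤ 1 := fun x y => by nlinarith [h01 x y, mul_self_nonneg (A x y - 1)]
  have hpow0 : ∀ (m : ℕ) x y, 0 ≤ (A ^ m) x y := by
    intro m
    induction m with
    | zero => intro x y; simp only [pow_zero, Matrix.one_apply]; split_ifs <;> norm_num
    | succ k ih =>
      intro x y
      rw [pow_succ, Matrix.mul_apply]
      exact Finset.sum_nonneg fun z _ => mul_nonneg (ih _ _) (hA0 _ _)
  have hdeg0 : ∀ x, 0 ≤ deg x := fun x => hpow0 2 x x
  have F1 : ∀ x, deg x = ∑ y, A x y * u y := by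
    intro x
    simp only [hdeg, pow_two, Matrix.mul_apply]
    exact Finset.sum_congr rfl fun y _ => by rw [hA y x, h01, huA]
  have huu : ∑ y, u y * u y = N := by rw [hN]; exact Finset.sum_congr rfl fun y _ => by ring
  have F3 : ∑ x, deg x ^ 2 ≤ 4 * R ^ 2 * N := by
    have hb := hB u
    rw [huu, ← hRdef, ← hN] at hb
    simp only [← F1] at hb
    have : ∑ x, deg x ^ 2 ≤ ∑ x, (2 * (deg x - R * u x) ^ 2 + 2 * R ^ 2 * u x ^ 2) :=
      Finset.sum_le_sum fun x _ => by nlinarith [sq_nonneg (deg x - 2 * R * u x)]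
    rw [Finset.sum_add_distrib, ← Finset.mul_sum, ← Finset.mul_sum, ← hN] at this
    have h5 : L ^ 2 * N ≤ R ^ 2 * N :=
      mul_le_mul_of_nonneg_right (pow_le_pow_left₀ hL0 (by linarith) 2) hNp.le
    linarith
  have F2 : ∑ x, deg x ≤ 2 * (N * R) := by
    have hud : ∀ x, deg x = u x * deg x := by
      intro x
      rw [F1, Finset.mul_sum]
      refine Finset.sum_congr rfl fun y _ => ?_
      have : A x y = A x y * u x := by rw [hA x y, huA]
      calc A x y * u y = (A x y * u x) * u y := by rw [← this]
        _ = _ := by ring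
    have e : ∑ x, deg x = ∑ x, u x * deg x := Finset.sum_congr rfl fun x _ => hud x
    rw [e]
    apply le_of_sq_le_sq _ (by positivity)
    refine (Finset.sum_mul_sq_le_sq_mul_sq _ _ _).trans ?_
    rw [← hN]
    have := mul_le_mul_of_nonneg_left F3 hNp.le
    linarith
  have F4 : ∀ x, deg x ≤ 4 * L ^ 2 := by
    intro x
    have hb := hB (Pi.single x 1)
    simp only [Pi.single_apply, mul_ite, mul_one, mul_zero, Finset.sum_ite_eq', Finset.mem_univ,
      if_true, ite_pow, one_pow, ne_eq, OfNat.ofNat_ne_zero, not_false_eq_true, zero_pow] at hb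
    have e : deg x = ∑ y, A y x ^ 2 := by
      simp only [hdeg, pow_two, Matrix.mul_apply]
      exact Finset.sum_congr rfl fun y _ => by rw [hA y x]
    have h6 : ∑ y, A y x ^ 2 ≤ ∑ y, (2 * (A y x - u x / q * u y) ^ 2 + 2 * (u x / q) ^ 2 * u y ^ 2) :=
      Finset.sum_le_sum fun y _ => by nlinarith [sq_nonneg (A y x - 2 * (u x / q * u y))]
    rw [Finset.sum_add_distrib, ← Finset.mul_sum, ← Finset.mul_sum, ← hN] at h6
    have h7 : (u x / q) ^ 2 * N ≤ L ^ 2 := by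
      have hux : u x ≤ 1 := by nlinarith [hu x, sq_nonneg (u x - 1)]
      rw [div_pow, hu x, div_mul_eq_mul_div, div_le_iff₀ (by positivity)]
      nlinarith
    linarith
  have hm0 : ∀ x, 0 ≤ v i0 x ^ 2 := fun x => sq_nonneg _
  have hms : ∑ x, v i0 x ^ 2 = 1 := by
    have := h1 i0 i0
    simp only [if_true] at this
    rw [← this]; exact Finset.sum_congr rfl fun y _ => by ring
  have F5 : ∀ (a : ℕ) x, 2 ≤ a → |(A ^ a) x x - μ i0 ^ a * v i0 x ^ 2| ≤ L ^ (a - 2) * deg x := by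
    intro a x ha
    have e : (A ^ a) x x - μ i0 ^ a * v i0 x ^ 2
        = ∑ i ∈ Finset.univ.erase i0, μ i ^ a * (v i x * v i x) := by
      rw [h3, ← Finset.add_sum_erase _ _ (Finset.mem_univ i0)]
      ring
    rw [e]
    refine (Finset.abs_sum_le_sum_abs _ _).trans ?_
    have e2 : deg x = ∑ i, μ i ^ 2 * (v i x * v i x) := h3 2 x x
    rw [e2, Finset.mul_sum]
    refine le_trans (Finset.sum_le_sum (g := fun i => L ^ (a - 2) * (μ i ^ 2 * (v i x * v i x))) ?_)
      (Finset.sum_le_sum_of_subset_of_nonneg (Finset.subset_univ _) ?_)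
    · intro i hi
      have hil := hoth i (Finset.ne_of_mem_erase hi)
      obtain ⟨b, rfl⟩ := Nat.exists_eq_add_of_le ha
      rw [Nat.add_sub_cancel_left, abs_mul, abs_of_nonneg (mul_self_nonneg (v i x)), abs_pow, pow_add,
        sq_abs]
      have := pow_le_pow_left₀ (abs_nonneg _) hil b
      have h0 : 0 ≤ μ i ^ 2 * (v i x * v i x) := mul_nonneg (sq_nonneg _) (mul_self_nonneg _)
      nlinarith [mul_le_mul_of_nonneg_right this h0]
    · intro i _ _
      exact mul_nonneg (pow_nonneg hL0 _) (mul_nonneg (sq_nonneg _) (mul_self_nonneg _))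
  have F6 : ∀ x, μ i0 ^ 2 * v i0 x ^ 2 ≤ 4 * L ^ 2 := by
    intro x
    refine le_trans ?_ (F4 x)
    have e2 : deg x = ∑ i, μ i ^ 2 * (v i x * v i x) := h3 2 x x
    rw [e2, ← Finset.add_sum_erase _ _ (Finset.mem_univ i0)]
    have : 0 ≤ ∑ i ∈ Finset.univ.erase i0, μ i ^ 2 * (v i x * v i x) :=
      Finset.sum_nonneg fun i _ => mul_nonneg (sq_nonneg _) (mul_self_nonneg _)
    nlinarith
  have F7 : ∀ b : ℕ, 2 ≤ b → |∑ x, (A ^ b) x x - μ i0 ^ b| ≤ 2 * (L ^ (b - 2) * N * R) := by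
    intro b hb
    have e : ∑ x, (A ^ b) x x - μ i0 ^ b = ∑ x, ((A ^ b) x x - μ i0 ^ b * v i0 x ^ 2) := by
      rw [Finset.sum_sub_distrib, ← Finset.mul_sum, hms, mul_one]
    rw [e]
    refine (Finset.abs_sum_le_sum_abs _ _).trans ?_
    refine (Finset.sum_le_sum fun x _ => F5 b x hb).trans ?_
    rw [← Finset.mul_sum]
    have := mul_le_mul_of_nonneg_left F2 (pow_nonneg hL0 (b - 2))
    linarith
  have hμp : ∀ b : ℕ, μ i0 ^ b ≤ (2 * R) ^ b := fun b => pow_le_pow_left₀ hμ0.le hμ1 b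
  have hLp : ∀ b : ℕ, L ^ b ≤ (2 * R) ^ b := fun b => pow_le_pow_left₀ hL0 (by linarith) b
  have hone : ∀ b : ℕ, 3 ≤ b → ∑ x, A x x * (A ^ b) x x
      ≤ L * (2 * R) ^ b + 2 * (L ^ (b - 2) * N * R) := by
    intro b hb
    have h8 : ∑ x, A x x * (A ^ b) x x ≤ ∑ x, (A ^ b) x x :=
      Finset.sum_le_sum fun x _ => by nlinarith [hpow0 b x x, hA1 x x]
    have h9 := (abs_le.1 (F7 b (by omega))).2
    have h10 : 0 ≤ (2 * R) ^ b := by positivity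
    nlinarith [hμp b]
  refine ⟨?_, ?_⟩
  · intro n hn
    have h7 := F7 n hn
    have h8 : |μ i0 ^ n - R ^ n| ≤ n * L * (2 * R) ^ (n - 1) := by
      refine (abs_pow_sub_pow_le _ _ _).trans ?_
      have hmx : max |μ i0| |R| ≤ 2 * R := by
        rw [abs_of_pos hμ0, abs_of_pos hRp]; exact max_le hμ1 (by linarith)
      have := pow_le_pow_left₀ (le_max_of_le_left (abs_nonneg _)) hmx (n - 1)
      calc _ ≤ L * n * (2 * R) ^ (n - 1) := by gcongr
        _ = _ := by ring
    calc _ = |(∑ x, (A ^ n) x x - μ i0 ^ n) + (μ i0 ^ n - R ^ n)| := by congr 1; ring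
      _ ≤ _ := abs_add_le _ _
      _ ≤ _ := by linarith
  · intro a b ha hb hab
    have p1 : 0 ≤ L * (2 * R) ^ (a + b - 1) := by positivity
    have p2 : 0 ≤ L ^ (a + b - 4) * N * R ^ 2 := by positivity
    have p3 : 0 ≤ L ^ (a + b - 3) * N * R := by positivity
    rcases Nat.lt_or_ge a 2 with ha2 | ha2
    · obtain rfl : a = 1 := by omega
      have := hone b (by omega)
      rw [show 1 + b - 1 = b by omega] at *
      rw [show 1 + b - 3 = b - 2 by omega] at *
      simp only [pow_one]
      linarith
    rcases Nat.lt_or_ge b 2 with hb2 | hb2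
    · obtain rfl : b = 1 := by omega
      have := hone a (by omega)
      rw [show a + 1 - 1 = a by omega] at *
      rw [show a + 1 - 3 = a - 2 by omega] at *
      simp only [pow_one]
      simp only [mul_comm ((A ^ a) _ _)]
      linarith
    obtain ⟨a', rfl⟩ := Nat.exists_eq_add_of_le' ha2
    obtain ⟨b', rfl⟩ := Nat.exists_eq_add_of_le' hb2
    have hpt : ∀ x, (A ^ (a' + 2)) x x * (A ^ (b' + 2)) x x ≤
        12 * L ^ 2 * (2 * R) ^ (a' + b' + 2) * v i0 x ^ 2 + L ^ (a' + b') * deg x ^ 2 := by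
      intro x
      have ea := (abs_le.1 (F5 (a' + 2) x ha2)).2
      have eb := (abs_le.1 (F5 (b' + 2) x hb2)).2
      simp only [Nat.add_sub_cancel] at ea eb
      have ea' : (A ^ (a' + 2)) x x ≤ μ i0 ^ (a' + 2) * v i0 x ^ 2 + L ^ a' * deg x := by linarith
      have eb' : (A ^ (b' + 2)) x x ≤ μ i0 ^ (b' + 2) * v i0 x ^ 2 + L ^ b' * deg x := by linarith
      have hmul := mul_le_mul ea' eb' (hpow0 _ _ _) (le_trans (hpow0 _ _ _) ea')
      refine hmul.trans ?_
      have t1 : μ i0 ^ (a' + 2) * v i0 x ^ 2 * (μ i0 ^ (b' + 2) * v i0 x ^ 2)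
          ≤ 4 * L ^ 2 * (2 * R) ^ (a' + b' + 2) * v i0 x ^ 2 := by
        calc _ = (μ i0 ^ 2 * v i0 x ^ 2) * μ i0 ^ (a' + b' + 2) * v i0 x ^ 2 := by ring
          _ ≤ _ := by
            have := F6 x
            have := hμp (a' + b' + 2)
            gcongr
      have t2 : μ i0 ^ (a' + 2) * v i0 x ^ 2 * (L ^ b' * deg x)
          ≤ 4 * L ^ 2 * (2 * R) ^ (a' + b' + 2) * v i0 x ^ 2 := by
        calc _ = deg x * (μ i0 ^ (a' + 2) * L ^ b') * v i0 x ^ 2 := by ring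
          _ ≤ (4 * L ^ 2) * ((2 * R) ^ (a' + 2) * (2 * R) ^ b') * v i0 x ^ 2 := by
            have := F4 x
            have := hμp (a' + 2)
            have := hLp b'
            gcongr
          _ = _ := by ring
      have t3 : (L ^ a' * deg x) * (μ i0 ^ (b' + 2) * v i0 x ^ 2)
          ≤ 4 * L ^ 2 * (2 * R) ^ (a' + b' + 2) * v i0 x ^ 2 := by
        calc _ = deg x * (L ^ a' * μ i0 ^ (b' + 2)) * v i0 x ^ 2 := by ring
          _ ≤ (4 * L ^ 2) * ((2 * R) ^ a' * (2 * R) ^ (b' + 2)) * v i0 x ^ 2 := by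
            have := F4 x
            have := hμp (b' + 2)
            have := hLp a'
            gcongr
          _ = _ := by ring
      have e4 : (L ^ a' * deg x) * (L ^ b' * deg x) = L ^ (a' + b') * deg x ^ 2 := by ring
      rw [add_mul, mul_add, mul_add, e4]
      linarith
    have hsum := Finset.sum_le_sum (fun x (_ : x ∈ Finset.univ) => hpt x)
    rw [Finset.sum_add_distrib, ← Finset.mul_sum, ← Finset.mul_sum, hms, mul_one] at hsum
    have i1 : a' + 2 + (b' + 2) - 4 = a' + b' := by omega
    have i2 : a' + 2 + (b' + 2) - 1 = a' + b' + 2 + 1 := by omega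
    rw [i1] at p2 ⊢
    rw [i2] at p1 ⊢
    have h11 := mul_le_mul_of_nonneg_left F3 (pow_nonneg hL0 (a' + b'))
    have h12 : L ^ 2 * (2 * R) ^ (a' + b' + 2) ≤ L * (2 * R) ^ (a' + b' + 2 + 1) := by
      calc _ = L * (2 * R) ^ (a' + b' + 2) * L := by ring
        _ ≤ L * (2 * R) ^ (a' + b' + 2) * (2 * R) := by gcongr; linarith
        _ = _ := by ring
    linarith

noncomputable def ncpF {ι : Type} [Fintype ι] (A : Matrix ι ι ℝ) (g : ℕ → ι → ℝ) : ℕ → ι → ℝ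
  | 0 => g 0
  | (m + 1) => fun y => (∑ z, ncpF A g m z * A z y) * g (m + 1) y

lemma ncp_path {ι : Type} [Fintype ι] (A : Matrix ι ι ℝ) (g : ℕ → ι → ℝ) (m : ℕ) :
    ∀ h : ι → ℝ, ∑ w : Fin (m + 1) → ι, (∏ i : Fin m, A (w i.castSucc) (w i.succ)) *
      (∏ i : Fin (m + 1), g i (w i)) * h (w (Fin.last m)) = ∑ y, ncpF A g m y * h y := by
  induction m with
  | zero =>
    intro h
    rw [← Equiv.sum_comp (Equiv.funUnique (Fin 1) ι).symm]
    simp [ncpF]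
  | succ m ih =>
    intro h
    rw [← Equiv.sum_comp (Fin.snocEquiv (fun _ : Fin (m + 2) => ι)), Fintype.sum_prod_type]
    refine Finset.sum_congr rfl fun y _ => ?_
    have h1 := ih (fun z => A z y * (g (m + 1) y * h y))
    have h2 : ∑ z, ncpF A g m z * (A z y * (g (m + 1) y * h y)) = ncpF A g (m + 1) y * h y := by
      simp only [ncpF, Finset.sum_mul]
      exact Finset.sum_congr rfl fun z _ => by ring
    rw [← h2, ← h1]
    refine Finset.sum_congr rfl fun w _ => ?_
    have e : Fin.snocEquiv (fun _ : Fin (m + 2) => ι) (y, w) = Fin.snoc (α := fun _ => ι) w y := rfl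
    rw [e, Fin.prod_univ_castSucc, Fin.prod_univ_castSucc (n := m + 1)]
    simp only [Fin.snoc_castSucc, Fin.snoc_last, Fin.succ_last, Fin.succ_castSucc, Fin.val_castSucc,
      Fin.val_last]
    ring

lemma ncp_W {ι : Type} (A : Matrix ι ι ℝ) (m : ℕ) (x : Fin (m + 1) → ι) :
    ∏ i : Fin (m + 1), A (x i) (x (i + 1)) =
      (∏ i : Fin m, A (x i.castSucc) (x i.succ)) * A (x (Fin.last m)) (x 0) := by
  rw [Fin.prod_univ_castSucc]
  simp [Fin.coeSucc_eq_succ]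

lemma ncp_trace {ι : Type} [Fintype ι] [DecidableEq ι] (A : Matrix ι ι ℝ) (m : ℕ) :
    ∑ x : Fin (m + 1) → ι, ∏ i, A (x i) (x (i + 1)) = ∑ z, (A ^ (m + 1)) z z := by
  have hz : ∀ z, ∑ x : Fin (m + 1) → ι, (if x 0 = z then ∏ i, A (x i) (x (i + 1)) else 0)
      = (A ^ (m + 1)) z z := by
    intro z
    have h := ncp_path A (fun k y => if k = 0 then (if y = z then 1 else 0) else 1) m (fun y => A y z)
    have hF : ∀ k y, ncpF A (fun k y => if k = 0 then (if y = z then 1 else 0) else 1) k y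
        = (A ^ k) z y := by
      intro k
      induction k with
      | zero => intro y; simp [ncpF, Matrix.one_apply, eq_comm]
      | succ k ih => intro y; simp [ncpF, ih, pow_succ, Matrix.mul_apply]
    simp only [hF] at h
    rw [pow_succ, Matrix.mul_apply, ← h]
    refine Finset.sum_congr rfl fun x _ => ?_
    rw [ncp_W]
    have : (∏ i : Fin (m + 1), if (i : ℕ) = 0 then (if x i = z then (1 : ℝ) else 0) else 1)
        = if x 0 = z then 1 else 0 := by
      rw [Fin.prod_univ_succ]; simp
    rw [this]
    split_ifs with h0
    · rw [h0]; ring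
    · ring
  simp only [← hz]
  rw [Finset.sum_comm]
  simp

lemma ncp_trace2 {ι : Type} [Fintype ι] [DecidableEq ι] (A : Matrix ι ι ℝ) (m : ℕ)
    (a : Fin (m + 1)) (ha : a ≠ 0) :
    ∑ x : Fin (m + 1) → ι, (if x 0 = x a then ∏ i, A (x i) (x (i + 1)) else 0)
      = ∑ z, (A ^ (a : ℕ)) z z * (A ^ (m + 1 - (a : ℕ))) z z := by
  have ha0 : (a : ℕ) ≠ 0 := fun h => ha (Fin.ext h)
  have ham : (a : ℕ) ≤ m := Nat.lt_succ_iff.1 a.2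
  have hz : ∀ z, ∑ x : Fin (m + 1) → ι,
      (if x 0 = z then (if x a = z then ∏ i, A (x i) (x (i + 1)) else 0) else 0)
      = (A ^ (a : ℕ)) z z * (A ^ (m + 1 - (a : ℕ))) z z := by
    intro z
    set g : ℕ → ι → ℝ := fun k y => (if k = 0 then (if y = z then 1 else 0) else 1) *
      (if k = (a : ℕ) then (if y = z then 1 else 0) else 1) with hg
    have h := ncp_path A g m (fun y => A y z)
    have hF : ∀ k, k < (a : ℕ) → ∀ y, ncpF A g k y = (A ^ k) z y := by
      intro k
      induction k with
      | zero => intro _ y; simp [ncpF, hg, Matrix.one_apply, eq_comm, ha0.symm]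
      | succ k ih =>
        intro hk y
        have hg1 : g (k + 1) y = 1 := by simp [hg, hk.ne]
        simp only [ncpF, ih (by omega), hg1, mul_one]
        rw [pow_succ, Matrix.mul_apply]
    have hF2 : ∀ k y, ncpF A g ((a : ℕ) + k) y = (A ^ (a : ℕ)) z z * (A ^ k) z y := by
      intro k
      induction k with
      | zero =>
        intro y
        obtain ⟨b, hb⟩ := Nat.exists_eq_succ_of_ne_zero ha0
        have hF' := hF b (by omega)
        rw [hb] at hg ⊢
        simp only [Nat.succ_eq_add_one, add_zero, ncpF, hF']
        rw [← Matrix.mul_apply, ← pow_succ]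
        simp only [hg, Matrix.one_apply, pow_zero]
        by_cases hy : y = z
        · simp [hy]
        · simp [hy, Ne.symm hy]
      | succ k ih =>
        intro y
        rw [← add_assoc]
        simp only [ncpF, ih]
        have hg1 : g ((a : ℕ) + k + 1) y = 1 := by
          have : (a : ℕ) + k + 1 ≠ (a : ℕ) := by omega
          simp only [hg, this, if_false, Nat.succ_ne_zero, mul_one]
        rw [hg1, pow_succ _ k, Matrix.mul_apply, Finset.mul_sum, mul_one]
        exact Finset.sum_congr rfl fun x _ => by ring
    have hm : m = (a : ℕ) + (m - (a : ℕ)) := by omega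
    have h' : ∀ y, ncpF A g m y = (A ^ (a : ℕ)) z z * (A ^ (m - (a : ℕ))) z y := by
      intro y
      conv_lhs => rw [hm]
      exact hF2 _ _
    simp only [h'] at h
    rw [show m + 1 - (a : ℕ) = (m - (a : ℕ)) + 1 by omega, pow_succ _ (m - (a : ℕ)), Matrix.mul_apply, Finset.mul_sum]
    simp only [mul_assoc] at h
    rw [← h]
    refine Finset.sum_congr rfl fun x _ => ?_
    rw [ncp_W]
    have e1 : (∏ i : Fin (m + 1), if (i : ℕ) = 0 then (if x i = z then (1 : ℝ) else 0) else 1)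
        = if x 0 = z then 1 else 0 := by
      rw [Fin.prod_univ_succ]; simp
    have e2 : (∏ i : Fin (m + 1), if (i : ℕ) = (a : ℕ) then (if x i = z then (1 : ℝ) else 0) else 1)
        = if x a = z then 1 else 0 := by
      simp only [← Fin.ext_iff]
      simp
    have e3 : ∏ i : Fin (m + 1), g i (x i) = (if x 0 = z then 1 else 0) * (if x a = z then 1 else 0) := by
      rw [← e1, ← e2, ← Finset.prod_mul_distrib]
    rw [e3]
    by_cases h0 : x 0 = z
    · by_cases h1 : x a = z
      · simp [h0, h1]
      · simp [h0, h1]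
    · simp [h0]
  simp only [← hz]
  rw [Finset.sum_comm]
  refine Finset.sum_congr rfl fun x _ => ?_
  simp [eq_comm]

lemma ncp_rot {ι : Type} [Fintype ι] [DecidableEq ι] (A : Matrix ι ι ℝ) (m : ℕ)
    (i j : Fin (m + 1)) :
    ∑ x : Fin (m + 1) → ι, (if x i = x j then ∏ k, A (x k) (x (k + 1)) else 0)
      = ∑ x : Fin (m + 1) → ι, (if x 0 = x (j - i) then ∏ k, A (x k) (x (k + 1)) else 0) := by
  rw [← Equiv.sum_comp (Equiv.arrowCongr (Equiv.addRight i) (Equiv.refl ι))]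
  refine Finset.sum_congr rfl fun x _ => ?_
  simp only [Equiv.arrowCongr_apply, Equiv.coe_refl, Function.comp_apply, id,
    Equiv.addRight_symm, Equiv.coe_addRight, Equiv.symm_apply_apply]
  rw [← Equiv.prod_comp (Equiv.addRight i)]
  simp only [Equiv.coe_addRight, add_neg_cancel, sub_eq_add_neg, add_neg_cancel_right]
  have : ∀ k : Fin (m + 1), k + i + 1 + -i = k + 1 := fun k => by abel
  simp only [this]

lemma ncp_count {ι : Type} [Fintype ι] [DecidableEq ι] (A : Matrix ι ι ℝ) (hA0 : ∀ x y, 0 ≤ A x y)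
    (m : ℕ) (C : ℝ) (hC0 : 0 ≤ C)
    (hC : ∀ a b : ℕ, 1 ≤ a → 1 ≤ b → a + b = m + 1 → ∑ x, (A ^ a) x x * (A ^ b) x x ≤ C) :
    |∑ x : Fin (m + 1) → ι, (if Function.Injective x then ∏ i, A (x i) (x (i + 1)) else 0)
      - ∑ z, (A ^ (m + 1)) z z| ≤ ((m : ℝ) + 1) ^ 2 * C := by
  rw [← ncp_trace, abs_sub_comm, ← Finset.sum_sub_distrib]
  have hW : ∀ x : Fin (m + 1) → ι, 0 ≤ ∏ i, A (x i) (x (i + 1)) :=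
    fun x => Finset.prod_nonneg fun _ _ => hA0 _ _
  rw [abs_of_nonneg]
  · have hpt : ∀ x : Fin (m + 1) → ι, (∏ i, A (x i) (x (i + 1)))
        - (if Function.Injective x then ∏ i, A (x i) (x (i + 1)) else 0)
        ≤ ∑ i, ∑ j, if i = j then 0 else if x i = x j then ∏ k, A (x k) (x (k + 1)) else 0 := by
      intro x
      have hnn : ∀ i j : Fin (m + 1),
          0 ≤ (if i = j then 0 else if x i = x j then ∏ k, A (x k) (x (k + 1)) else 0) := by
        intro i j
        split_ifs
        · exact le_rfl
        · exact hW x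
        · exact le_rfl
      by_cases hx : Function.Injective x
      · rw [if_pos hx, sub_self]
        exact Finset.sum_nonneg fun i _ => Finset.sum_nonneg fun j _ => hnn i j
      · rw [if_neg hx, sub_zero]
        obtain ⟨i, j, hij, hne⟩ : ∃ i j, x i = x j ∧ i ≠ j := by
          simpa [Function.Injective] using hx
        have s1 := Finset.single_le_sum (fun j _ => hnn i j) (Finset.mem_univ j)
        have s2 := Finset.single_le_sum (fun i _ => Finset.sum_nonneg (s := Finset.univ) fun j _ => hnn i j)
          (Finset.mem_univ i) (s := Finset.univ)
        rw [if_neg hne, if_pos hij] at s1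
        exact s1.trans s2
    refine (Finset.sum_le_sum fun x _ => hpt x).trans ?_
    rw [Finset.sum_comm]
    have hij : ∀ i j : Fin (m + 1), ∑ x : Fin (m + 1) → ι,
        (if i = j then 0 else if x i = x j then ∏ k, A (x k) (x (k + 1)) else 0) ≤ C := by
      intro i j
      by_cases h : i = j
      · simp [h, hC0]
      · simp only [if_neg h]
        have hne : j - i ≠ 0 := fun h' => h (sub_eq_zero.1 h').symm
        rw [ncp_rot, ncp_trace2 A m (j - i) hne]
        have h0 : ((j - i : Fin (m + 1)) : ℕ) ≠ 0 := fun h => hne (Fin.ext h)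
        have h1 := (j - i).2
        exact hC _ _ (by omega) (by omega) (by omega)
    calc _ ≤ ∑ i : Fin (m + 1), ∑ j : Fin (m + 1), C := by
          refine Finset.sum_le_sum fun i _ => ?_
          rw [Finset.sum_comm]
          exact Finset.sum_le_sum fun j _ => hij i j
      _ = _ := by simp; ring
  · refine Finset.sum_nonneg fun x _ => ?_
    split_ifs
    · simp
    · simpa using hW x

lemma ncp_main {F : Type} [Field F] [Fintype F] [DecidableEq F] (d n : ℕ) (hn : 4 ≤ n)
    (t : F) (ht : t ≠ 0) (E : Finset (Fin d → F)) (L : ℝ) (hL : 1 ≤ L)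
    (hLq : L ^ 2 * (Fintype.card F : ℝ) = (Fintype.card F : ℝ) ^ d)
    (R : ℝ) (hRdef : R = (E.card : ℝ) / (Fintype.card F : ℝ)) (hR : 2 * L < R) :
    |(nondegCycleCountProd F d n t E : ℝ) - R ^ n| ≤
      n * L * (2 * R) ^ (n - 1) + 2 * (L ^ (n - 2) * (E.card : ℝ) * R) +
      (n : ℝ) ^ 2 * (12 * L * (2 * R) ^ (n - 1) + 4 * (L ^ (n - 4) * (E.card : ℝ) * R ^ 2)
          + 2 * (L ^ (n - 3) * (E.card : ℝ) * R)) := by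
  set q : ℝ := (Fintype.card F : ℝ) with hq
  have hq1 : 1 < q := by rw [hq]; exact_mod_cast Fintype.one_lt_card
  have hq0 : 0 < q := by linarith
  set A : Matrix (Fin d → F) (Fin d → F) ℝ := fun x y =>
    if x ∈ E ∧ y ∈ E ∧ ∑ j, x j * y j = t then 1 else 0 with hAdef
  set u : (Fin d → F) → ℝ := fun x => if x ∈ E then 1 else 0 with hudef
  have hN : (E.card : ℝ) = ∑ x, u x ^ 2 := by
    simp [hudef]
  have hA : ∀ x y, A x y = A y x := by
    intro x y
    simp only [hAdef]
    have : (∑ j, x j * y j) = ∑ j, y j * x j := Finset.sum_congr rfl fun j _ => mul_comm _ _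
    rw [this]
    congr 1
    apply propext
    tauto
  have h01 : ∀ x y, A x y * A x y = A x y := by
    intro x y; simp only [hAdef]; split_ifs <;> simp
  have huA : ∀ x y, A x y * u y = A x y := by
    intro x y; simp only [hAdef, hudef]
    by_cases hy : y ∈ E <;> simp [hy]
  have hu : ∀ x, u x ^ 2 = u x := by
    intro x; simp only [hudef]; split_ifs <;> simp
  have hA0 : ∀ x y, 0 ≤ A x y := fun x y => by rw [← h01]; exact mul_self_nonneg _
  have hB : ∀ f : (Fin d → F) → ℝ, ∑ x, ((∑ y, A x y * f y) - (∑ y, u y * f y) / q * u x) ^ 2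
      ≤ L ^ 2 * ∑ x, f x ^ 2 := by
    intro f
    have hfb := ncp_full_bound t ht (fun y => u y * f y)
    rw [← hq, ← hLq] at hfb
    have hfb' : ∑ x : Fin d → F, ((∑ y, if ∑ j, x j * y j = t then u y * f y else 0)
        - (∑ y, u y * f y) / q) ^ 2 ≤ L ^ 2 * ∑ y, (u y * f y) ^ 2 := by
      refine le_of_mul_le_mul_left (hfb.trans (le_of_eq ?_)) hq0
      ring
    refine le_trans (Finset.sum_le_sum fun x _ => ?_) (hfb'.trans ?_)
    · by_cases hx : x ∈ E
      · have : ∀ y, A x y * f y = if ∑ j, x j * y j = t then u y * f y else 0 := by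
          intro y
          simp only [hAdef, hudef]
          by_cases hy : y ∈ E <;> simp [hx, hy]
        simp only [this]
        simp [hudef, hx]
      · have : ∀ y, A x y * f y = 0 := by
          intro y; simp [hAdef, hx]
        simp only [this]
        have hux : u x = 0 := by simp [hudef, hx]
        rw [hux]
        simp only [Finset.sum_const_zero, mul_zero, sub_zero, ne_eq, OfNat.ofNat_ne_zero,
          not_false_eq_true, zero_pow]
        exact sq_nonneg _
    · apply mul_le_mul_of_nonneg_left _ (sq_nonneg L)
      refine Finset.sum_le_sum fun x _ => ?_
      simp only [hudef]
      split_ifs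
      · simp
      · simpa using sq_nonneg (f x)
  have hNL : (E.card : ℝ) ≤ L ^ 2 * q ^ 2 := by
    have h1 : (E.card : ℝ) ≤ q ^ d := by
      have := Finset.card_le_univ E
      rw [Fintype.card_fun, Fintype.card_fin] at this
      rw [hq]; exact_mod_cast this
    have h2 : L ^ 2 * q ≤ L ^ 2 * q ^ 2 := by
      apply mul_le_mul_of_nonneg_left _ (sq_nonneg L)
      nlinarith
    linarith
  obtain ⟨hT, hD⟩ := ncp_abstract A u hA h01 huA hu q L hq0 hL hB _ hN hNL R hRdef hR
  obtain ⟨m, rfl⟩ : ∃ m, n = m + 1 := ⟨n - 1, by omega⟩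
  have hR0 : 0 ≤ R := by linarith
  have hL0 : 0 ≤ L := by linarith
  have hcnt := ncp_count A hA0 m (12 * L * (2 * R) ^ (m + 1 - 1)
      + 4 * (L ^ (m + 1 - 4) * (E.card : ℝ) * R ^ 2)
      + 2 * (L ^ (m + 1 - 3) * (E.card : ℝ) * R)) (by positivity) (fun a b ha hb hab => by
    have := hD a b ha hb (by omega)
    rw [hab] at this
    exact this)
  have hTn := hT (m + 1) (by omega)
  have heq : (nondegCycleCountProd F d (m + 1) t E : ℝ) = ∑ x : Fin (m + 1) → (Fin d → F),
      (if Function.Injective x then ∏ i, A (x i) (x (i + 1)) else 0) := by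
    unfold nondegCycleCountProd
    rw [Finset.card_filter]
    push_cast
    refine Finset.sum_congr rfl fun x _ => ?_
    have hidx : ∀ i : Fin (m + 1), (⟨(i.val + 1) % (m + 1), Nat.mod_lt _ i.pos⟩ : Fin (m + 1)) = i + 1 := by
      intro i
      apply Fin.ext
      simp [Fin.val_add]
    simp only [hidx, hAdef]
    rw [Finset.prod_boole]
    by_cases hx : Function.Injective x
    · simp only [hx, true_and, if_true, Finset.mem_univ, true_implies]
      congr 1
      apply propext
      constructor
      · rintro ⟨h1, h2⟩ i
        exact ⟨h1 i, h1 _, h2 i⟩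
      · intro h
        exact ⟨fun i => (h i).1, fun i => (h i).2.2⟩
    · simp [hx]
  rw [heq]
  have hcast : ((m + 1 : ℕ) : ℝ) = (m : ℝ) + 1 := by push_cast; ring
  rw [hcast] at hTn ⊢
  calc _ = |(∑ x : Fin (m + 1) → (Fin d → F),
      (if Function.Injective x then ∏ i, A (x i) (x (i + 1)) else 0) - ∑ z, (A ^ (m + 1)) z z)
        + (∑ z, (A ^ (m + 1)) z z - R ^ (m + 1))| := by congr 1; ring
    _ ≤ _ := abs_add_le _ _
    _ ≤ _ := (add_le_add hcnt hTn).trans (le_of_eq (add_comm _ _))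

lemma ncp_big (C η : ℝ) (hη : 0 < η) : ∃ Q : ℕ, ∀ q : ℕ, Q ≤ q → C ≤ (q : ℝ) ^ η := by
  have h := (tendsto_rpow_atTop hη).comp tendsto_natCast_atTop_atTop
  have h2 := Filter.tendsto_atTop.1 h C
  obtain ⟨Q, hQ⟩ := Filter.eventually_atTop.1 h2
  exact ⟨Q, fun q hq => hQ q hq⟩

lemma ncp_arith (k : ℕ) (x L R N κ γ η₁ η₂ e a C₁ : ℝ) (hx : 0 < x) (hL : L = x ^ e)
    (hLR : L * x ^ κ ≤ R) (hN : N = R * x)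
    (hκ1 : κ * ((k : ℝ) + 2) = 1 + γ) (hκ2 : κ = γ + η₁) (hκ3 : e + κ * ((k : ℝ) + 1) = 1 + γ + η₂)
    (hC1 : C₁ ≤ x ^ η₁) (ha2 : 4 * a ≤ x ^ η₂) (ha3 : 2 * a ≤ L) :
    L ^ (k + 2) * N * R ≤ R ^ (k + 4) * x ^ (-γ) ∧
    C₁ * (L * R ^ (k + 3)) ≤ R ^ (k + 4) * x ^ (-γ) ∧
    4 * a * (L ^ k * N * R ^ 2) ≤ R ^ (k + 4) * x ^ (-γ) ∧
    2 * a * (L ^ (k + 1) * N * R) ≤ R ^ (k + 4) * x ^ (-γ) := by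
  have hL0 : 0 < L := by rw [hL]; exact Real.rpow_pos_of_pos hx _
  have hxκ : 0 < x ^ κ := Real.rpow_pos_of_pos hx _
  have hxγ : 0 < x ^ (-γ) := Real.rpow_pos_of_pos hx _
  have hR0 : 0 < R := lt_of_lt_of_le (mul_pos hL0 hxκ) hLR
  have hcan : x ^ γ * x ^ (-γ) = 1 := by
    rw [← Real.rpow_add hx]; simp
  have B1 : L ^ (k + 2) * N * R ≤ R ^ (k + 4) * x ^ (-γ) := by
    have h1 : (L * x ^ κ) ^ (k + 2) ≤ R ^ (k + 2) := pow_le_pow_left₀ (by positivity) hLR _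
    have h2 : (x ^ κ) ^ (k + 2) = x * x ^ γ := by
      rw [← Real.rpow_natCast, ← Real.rpow_mul hx.le]
      push_cast
      rw [hκ1, Real.rpow_add hx, Real.rpow_one]
    rw [mul_pow, h2] at h1
    calc _ = (L ^ (k + 2) * (x * x ^ γ)) * (R ^ 2 * x ^ (-γ)) := by
          rw [hN]
          calc _ = L ^ (k + 2) * x * R ^ 2 * 1 := by ring
            _ = L ^ (k + 2) * x * R ^ 2 * (x ^ γ * x ^ (-γ)) := by rw [hcan]
            _ = _ := by ring
      _ ≤ R ^ (k + 2) * (R ^ 2 * x ^ (-γ)) := by gcongr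
      _ = _ := by ring
  refine ⟨B1, ?_, ?_, ?_⟩
  · rw [hκ2, Real.rpow_add hx] at hLR
    calc _ ≤ x ^ η₁ * (L * R ^ (k + 3)) := by gcongr
      _ = x ^ η₁ * (L * R ^ (k + 3)) * (x ^ γ * x ^ (-γ)) := by rw [hcan, mul_one]
      _ = (L * (x ^ γ * x ^ η₁)) * (R ^ (k + 3) * x ^ (-γ)) := by ring
      _ ≤ R * (R ^ (k + 3) * x ^ (-γ)) := by gcongr
      _ = _ := by ring
  · have h1 : (L * x ^ κ) ^ (k + 1) ≤ R ^ (k + 1) := pow_le_pow_left₀ (by positivity) hLR _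
    have h2 : L * (x ^ κ) ^ (k + 1) = x * x ^ γ * x ^ η₂ := by
      rw [hL, ← Real.rpow_natCast, ← Real.rpow_mul hx.le, ← Real.rpow_add hx]
      push_cast
      rw [hκ3, Real.rpow_add hx, Real.rpow_add hx, Real.rpow_one]
    have h3 : (L * x ^ κ) ^ (k + 1) = L ^ k * (x * x ^ γ * x ^ η₂) := by
      rw [← h2]; ring
    rw [h3] at h1
    calc _ ≤ x ^ η₂ * (L ^ k * N * R ^ 2) := by rw [hN]; gcongr
      _ = x ^ η₂ * (L ^ k * N * R ^ 2) * (x ^ γ * x ^ (-γ)) := by rw [hcan, mul_one]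
      _ = (L ^ k * (x * x ^ γ * x ^ η₂)) * (R ^ 3 * x ^ (-γ)) := by rw [hN]; ring
      _ ≤ R ^ (k + 1) * (R ^ 3 * x ^ (-γ)) := by gcongr
      _ = _ := by ring
  · have hN0 : 0 ≤ N := by rw [hN]; positivity
    calc _ ≤ L * (L ^ (k + 1) * N * R) := by gcongr
      _ = L ^ (k + 2) * N * R := by ring
      _ ≤ _ := B1

set_option maxHeartbeats 2000000 in
theorem nondeg_cycle_count_prod (d n : ℕ) (hd : 2 ≤ d) (hn : 4 ≤ n) (δ : ℝ)
    (hδ0 : 0 < δ) (hδ1 : δ < 1 / (2 * ((n / 2 : ℕ) : ℝ) ^ 2))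
    (K : ℝ) (hK : K = if n = 4 then 48 else
      36 + 80 * (6 : ℝ) ^ (n / 2 - 2) + 12 * ((n / 2 : ℕ) : ℝ))
    (c : ℝ) (hc : c = ((n : ℝ) - 1) ^ (n - 3) * 2 ^ ((n - 1) * (n - 2) / 2 + 3 - n))
    (ε : ℝ) (hε : ε = if n % 2 = 0 then
        1 - (((n / 2 : ℕ) : ℝ) - 2) / (((n / 2 : ℕ) : ℝ) - 1) + δ
      else 1 - (2 * ((n / 2 : ℕ) : ℝ) - 3) / (2 * ((n / 2 : ℕ) : ℝ) - 1) + δ) :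
    ∃ Q : ℕ, ∀ (F : Type) [Field F] [Fintype F] [DecidableEq F],
      Q ≤ Fintype.card F → ∀ t : F, t ≠ 0 → ∀ E : Finset (Fin d → F),
      (Fintype.card F : ℝ) ^ ((1 / 2 : ℝ) * ((d : ℝ) + 2 -
          (if n % 2 = 0 then (((n / 2 : ℕ) : ℝ) - 2) / (((n / 2 : ℕ) : ℝ) - 1)
           else (2 * ((n / 2 : ℕ) : ℝ) - 3) / (2 * ((n / 2 : ℕ) : ℝ) - 1)) + δ)) ≤
        (E.card : ℝ) →
      |(nondegCycleCountProd F d n t E : ℝ) -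
          (E.card : ℝ) ^ n / (Fintype.card F : ℝ) ^ n| ≤
        (E.card : ℝ) ^ n / (Fintype.card F : ℝ) ^ n *
          (K * (Fintype.card F : ℝ) ^ (-(((n : ℝ) / 2 - 1) * δ)) +
           2 * (n : ℝ) * (Fintype.card F : ℝ) ^ (-(2 / ((n : ℝ) - 1))) +
           c * (Fintype.card F : ℝ) ^ (-(((d : ℝ) - 3) / 2) - ε)) := by
  have hn4 : (4 : ℝ) ≤ n := by exact_mod_cast hn
  have hd2 : (2 : ℝ) ≤ d := by exact_mod_cast hd
  set α : ℝ := (if n % 2 = 0 then (((n / 2 : ℕ) : ℝ) - 2) / (((n / 2 : ℕ) : ℝ) - 1)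
           else (2 * ((n / 2 : ℕ) : ℝ) - 3) / (2 * ((n / 2 : ℕ) : ℝ) - 1)) with hαdef
  have hα : α = 1 - 2 / ((n : ℝ) - 2) := by
    have h2 : (2 : ℝ) ≤ ((n / 2 : ℕ) : ℝ) := by
      have : 2 ≤ n / 2 := by omega
      exact_mod_cast this
    rw [hαdef]
    split_ifs with hpar
    · have hnn : (n : ℝ) = 2 * ((n / 2 : ℕ) : ℝ) := by
        have : n = 2 * (n / 2) := by omega
        exact_mod_cast this
      rw [hnn]
      have h3 : ((n / 2 : ℕ) : ℝ) - 1 ≠ 0 := by linarith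
      have h4 : 2 * ((n / 2 : ℕ) : ℝ) - 2 ≠ 0 := by intro h; apply h3; linarith
      field_simp
      ring
    · have hnn : (n : ℝ) = 2 * ((n / 2 : ℕ) : ℝ) + 1 := by
        have : n = 2 * (n / 2) + 1 := by omega
        exact_mod_cast this
      rw [hnn]
      have h3 : 2 * ((n / 2 : ℕ) : ℝ) - 1 ≠ 0 := by linarith
      have h4 : 2 * ((n / 2 : ℕ) : ℝ) + 1 - 2 ≠ 0 := by intro h; apply h3; linarith
      have h5 : 2 * ((n / 2 : ℕ) : ℝ) + 1 - 2 = 2 * ((n / 2 : ℕ) : ℝ) - 1 := by ring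
      rw [h5]
      field_simp
      ring
  have hK48 : 48 ≤ K := by
    rw [hK]
    split_ifs
    · exact le_rfl
    · have h1 : (1 : ℝ) ≤ 6 ^ (n / 2 - 2) := one_le_pow₀ (by norm_num)
      have h2 : (0 : ℝ) ≤ ((n / 2 : ℕ) : ℝ) := Nat.cast_nonneg _
      linarith
  have hc0 : 0 ≤ c := by
    rw [hc]
    have : 0 ≤ (n : ℝ) - 1 := by linarith
    positivity
  clear_value α
  clear hK hc hε hαdef
  -- the bound on `δ`
  have hδ2 : δ * ((n : ℝ) - 1) ^ 2 < 2 := by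
    have h2 : (2 : ℝ) ≤ ((n / 2 : ℕ) : ℝ) := by
      have : 2 ≤ n / 2 := by omega
      exact_mod_cast this
    have h3 : (n : ℝ) - 1 ≤ 2 * ((n / 2 : ℕ) : ℝ) := by
      have : n ≤ 2 * (n / 2) + 1 := by omega
      have : (n : ℝ) ≤ 2 * ((n / 2 : ℕ) : ℝ) + 1 := by exact_mod_cast this
      linarith
    have h4 : ((n : ℝ) - 1) ^ 2 ≤ (2 * ((n / 2 : ℕ) : ℝ)) ^ 2 :=
      pow_le_pow_left₀ (by linarith) h3 2
    rw [lt_div_iff₀ (by positivity)] at hδ1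
    nlinarith
  have hn2 : 0 < (n : ℝ) - 2 := by linarith
  obtain ⟨κ, hκ⟩ : ∃ κ : ℝ, κ = 1 / ((n : ℝ) - 2) + δ / 2 := ⟨_, rfl⟩
  obtain ⟨γ, hγ⟩ : ∃ γ : ℝ, γ = ((n : ℝ) / 2 - 1) * δ := ⟨_, rfl⟩
  have hκ0 : 0 < κ := by rw [hκ]; positivity
  have hη1 : 0 < κ - γ := by
    have e : κ - γ = (1 - ((n : ℝ) - 3) * ((n : ℝ) - 2) * δ / 2) / ((n : ℝ) - 2) := by
      rw [hκ, hγ]; field_simp; ring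
    rw [e]
    apply div_pos _ hn2
    nlinarith
  by_cases hvac : d = 2 ∧ n = 4
  · obtain ⟨rfl, rfl⟩ := hvac
    refine ⟨0, ?_⟩
    intro F _ _ _ _ t ht E hE
    exfalso
    have hq1 : (1 : ℝ) < (Fintype.card F : ℝ) := by exact_mod_cast Fintype.one_lt_card
    have h1 : (E.card : ℝ) ≤ (Fintype.card F : ℝ) ^ 2 := by
      have := Finset.card_le_univ E
      rw [Fintype.card_fun, Fintype.card_fin] at this
      exact_mod_cast this
    have h2 : (Fintype.card F : ℝ) ^ (2 : ℝ) < (Fintype.card F : ℝ) ^ ((1 / 2 : ℝ) * (((2 : ℕ) : ℝ) + 2 - α + δ)) := by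
      apply Real.rpow_lt_rpow_of_exponent_lt hq1
      rw [hα]; norm_num; linarith
    rw [Real.rpow_two] at h2
    linarith
  obtain ⟨η₂, hη₂⟩ : ∃ η₂ : ℝ, η₂ = ((d : ℝ) - 1) / 2 - 1 / ((n : ℝ) - 2) - δ / 2 := ⟨_, rfl⟩
  have hη2 : 0 < η₂ := by
    rw [hη₂]
    have hδ3 : δ < 2 / 9 := by nlinarith
    rcases Nat.lt_or_ge n 5 with h5 | h5
    · have : n = 4 := by omega
      have hd3 : 3 ≤ d := by
        by_contra hcon
        exact hvac ⟨by omega, this⟩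
      have hd3' : (3 : ℝ) ≤ d := by exact_mod_cast hd3
      subst this
      norm_num
      linarith
    · have h5' : (5 : ℝ) ≤ n := by exact_mod_cast h5
      have : 1 / ((n : ℝ) - 2) ≤ 1 / 3 := one_div_le_one_div_of_le (by norm_num) (by linarith)
      linarith
  obtain ⟨Q1, hQ1⟩ := ncp_big ((n + 12 * (n : ℝ) ^ 2) * 2 ^ (n - 1)) (κ - γ) hη1
  obtain ⟨Q2, hQ2⟩ := ncp_big (4 * (n : ℝ) ^ 2) η₂ hη2
  obtain ⟨Q3, hQ3⟩ := ncp_big (2 * (n : ℝ) ^ 2) (((d : ℝ) - 1) / 2) (by linarith)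
  obtain ⟨Q4, hQ4⟩ := ncp_big 3 κ hκ0
  refine ⟨max (max Q1 Q2) (max Q3 Q4), ?_⟩
  intro F _ _ _ hQ t ht E hE
  have q1 := hQ1 (Fintype.card F) (le_trans (by simp) hQ)
  have q2 := hQ2 (Fintype.card F) (le_trans (by simp) hQ)
  have q3 := hQ3 (Fintype.card F) (le_trans (by simp) hQ)
  have q4 := hQ4 (Fintype.card F) (le_trans (by simp) hQ)
  have hq1 : (1 : ℝ) < (Fintype.card F : ℝ) := by exact_mod_cast Fintype.one_lt_card
  rw [← hγ]
  obtain ⟨L, hLdef⟩ : ∃ L : ℝ, L = (Fintype.card F : ℝ) ^ (((d : ℝ) - 1) / 2) := ⟨_, rfl⟩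
  obtain ⟨R, hRdef⟩ : ∃ R : ℝ, R = (E.card : ℝ) / (Fintype.card F : ℝ) := ⟨_, rfl⟩
  have hmain := fun h1 h2 h3 => ncp_main d n hn t ht E L h1 h2 R hRdef h3
  rw [← div_pow, ← hRdef]
  generalize (nondegCycleCountProd F d n t E : ℝ) = cnt at *
  generalize (E.card : ℝ) = N at *
  generalize (Fintype.card F : ℝ) = x at *
  have hx0 : 0 < x := by linarith
  have hL1 : 1 ≤ L := by rw [hLdef]; exact Real.one_le_rpow hq1.le (by linarith)
  have hLx : L ^ 2 * x = x ^ d := by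
    rw [hLdef, ← Real.rpow_natCast, ← Real.rpow_mul hx0.le, ← Real.rpow_natCast x d]
    nth_rewrite 2 [← Real.rpow_one x]
    rw [← Real.rpow_add hx0]
    congr 1
    push_cast
    ring
  have hNR : N = R * x := by rw [hRdef]; field_simp
  have hLR : L * x ^ κ ≤ R := by
    rw [hRdef, le_div_iff₀ hx0]
    refine le_trans (le_of_eq ?_) hE
    rw [hLdef, ← Real.rpow_add hx0]
    nth_rewrite 2 [← Real.rpow_one x]
    rw [← Real.rpow_add hx0]
    congr 1
    rw [hα, hκ]
    ring
  have hR2 : 2 * L < R := by nlinarith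
  have hm := hmain hL1 hLx hR2
  clear hmain
  obtain ⟨k, rfl⟩ : ∃ k, n = k + 4 := ⟨n - 4, by omega⟩
  have hk2 : ((k + 4 : ℕ) : ℝ) - 2 = (k : ℝ) + 2 := by push_cast; ring
  rw [hk2] at hκ hη₂
  have hk0 : (k : ℝ) + 2 ≠ 0 := by positivity
  have hγ' : γ = ((k : ℝ) + 2) / 2 * δ := by rw [hγ]; push_cast; ring
  obtain ⟨b1, b2, b3, b4⟩ := ncp_arith k x L R N κ γ (κ - γ) η₂ (((d : ℝ) - 1) / 2)
    (((k + 4 : ℕ) : ℝ) ^ 2) _ hx0 hLdef hLR hNR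
    (by rw [hκ, hγ']; field_simp) (by ring)
    (by rw [hη₂, hκ, hγ']; field_simp; ring) q1 q2 (by rw [hLdef]; exact q3)
  have i1 : k + 4 - 1 = k + 3 := by omega
  have i2 : k + 4 - 2 = k + 2 := by omega
  have i3 : k + 4 - 3 = k + 1 := by omega
  have i4 : k + 4 - 4 = k := by omega
  rw [i1] at b2
  rw [i1, i2, i3, i4, mul_pow] at hm
  refine hm.trans ?_
  have hR0 : 0 < R := by linarith
  have hP : 0 ≤ R ^ (k + 4) * x ^ (-γ) := mul_nonneg (by positivity) (Real.rpow_nonneg hx0.le _)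
  have hK' : 48 * (R ^ (k + 4) * x ^ (-γ)) ≤ K * (R ^ (k + 4) * x ^ (-γ)) :=
    mul_le_mul_of_nonneg_right hK48 hP
  have hX1 : 0 ≤ R ^ (k + 4) * (2 * ((k + 4 : ℕ) : ℝ) * x ^ (-(2 / (((k + 4 : ℕ) : ℝ) - 1)))) :=
    mul_nonneg (by positivity) (mul_nonneg (by positivity) (Real.rpow_nonneg hx0.le _))
  have hX2 : 0 ≤ R ^ (k + 4) * (c * x ^ (-(((d : ℝ) - 3) / 2) - ε)) :=
    mul_nonneg (by positivity) (mul_nonneg hc0 (Real.rpow_nonneg hx0.le _))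
  rw [mul_add, mul_add]
  generalize ((k + 4 : ℕ) : ℝ) = n' at *
  generalize (2 : ℝ) ^ (k + 3) = T at *
  have e2 : (n' + 12 * n' ^ 2) * T * (L * R ^ (k + 3))
    = n' * L * (T * R ^ (k + 3)) + n' ^ 2 * (12 * L * (T * R ^ (k + 3))) := by ring
  rw [e2] at b2
  linarith
end
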